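/- arXiv:2602.03465 — 2 statements merged into one kernel-verified Lean document; each statement's English description precedes it below -/
import Mathlib

section
/- Let d ≥ 1 and let μ be a compactly supported positive finite Borel measure on ℝ^d satisfying the Fourier decay condition |μ̂(ξ)| ≤ C|ξ|^{−a} for all ξ ≠ 0 with a > 1/2, and the Frostman condition μ(B(x,r)) ≤ C r^b for all x ∈ ℝ^d and r > 0, with d − 1 < b ≤ d. Then there is a constant C' such that the restricted weak-type estimate ‖M_μ f‖_{L^{p_{(a,b)},∞}(ℝ^d)} ≤ C' ‖f‖_{L^{p_{(a,b)},1}(ℝ^d)} holds for every Schwartz function f on ℝ^d, where p_{(a,b)} = (2(d−b)+2a−1)/(d−b+2a−1). -/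
open MeasureTheory Real Set Metric FourierTransform
open scoped ENNReal NNReal RealInnerProductSpace

noncomputable section

variable {d : ℕ}

/-- Fourier transform of a finite Borel measure on ℝ^d:  μ̂(ξ) = ∫ e^{−2πi x·ξ} dμ(x). -/
def mFT (μ : Measure (EuclideanSpace ℝ (Fin d))) (ξ : EuclideanSpace ℝ (Fin d)) : ℂ :=
  ∫ x, Complex.exp (-(2 * (π : ℂ) * Complex.I * ((⟪x, ξ⟫ : ℝ) : ℂ))) ∂μ

/-- Convolution with the dilated measure: (f ∗ μ_t)(x) = ∫ f(x − t y) dμ(y). -/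
def convM (f : EuclideanSpace ℝ (Fin d) → ℂ) (μ : Measure (EuclideanSpace ℝ (Fin d)))
    (t : ℝ) (x : EuclideanSpace ℝ (Fin d)) : ℂ :=
  ∫ y, f (x - t • y) ∂μ

/-- Global maximal function M_μ f(x) = sup_{t>0} |(f ∗ μ_t)(x)|. -/
def Mmax (μ : Measure (EuclideanSpace ℝ (Fin d))) (f : EuclideanSpace ℝ (Fin d) → ℂ)
    (x : EuclideanSpace ℝ (Fin d)) : ℝ≥0∞ :=
  ⨆ t : {t : ℝ // 0 < t}, (‖convM f μ t x‖₊ : ℝ≥0∞)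

/-- Local maximal function M_μ^{loc} f(x) = sup_{t∈[1,2]} |(f ∗ μ_t)(x)|. -/
def MmaxLoc (μ : Measure (EuclideanSpace ℝ (Fin d))) (f : EuclideanSpace ℝ (Fin d) → ℂ)
    (x : EuclideanSpace ℝ (Fin d)) : ℝ≥0∞ :=
  ⨆ t : (Icc (1:ℝ) 2), (‖convM f μ t x‖₊ : ℝ≥0∞)

/-- L^p norm (in lintegral form) of an ℝ≥0∞-valued function on ℝ^d. -/
def lpE (g : EuclideanSpace ℝ (Fin d) → ℝ≥0∞) (p : ℝ) : ℝ≥0∞ :=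
  (∫⁻ x, g x ^ p) ^ (1 / p)

/-- Weak L^q quasinorm of an ℝ≥0∞-valued function on ℝ^d. -/
def wlpE (g : EuclideanSpace ℝ (Fin d) → ℝ≥0∞) (q : ℝ) : ℝ≥0∞ :=
  ⨆ l : ℝ≥0, (l : ℝ≥0∞) * (volume {x | (l : ℝ≥0∞) < g x}) ^ (1 / q)

/-- Lorentz L^{p,1} norm (up to a constant factor p) of a complex-valued function. -/
def lorentz1 (f : EuclideanSpace ℝ (Fin d) → ℂ) (p : ℝ) : ℝ≥0∞ :=
  ∫⁻ l in Ioi (0:ℝ), (volume {x | l < ‖f x‖}) ^ (1 / p)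

/-- Lorentz L^{p,r} quasinorm of a real-valued function,
‖f‖_{p,r} = ( ∫_0^∞ (λ · d_f(λ)^{1/p})^r dλ/λ )^{1/r}. -/
def lorentzR (f : EuclideanSpace ℝ (Fin d) → ℝ) (p r : ℝ) : ℝ≥0∞ :=
  (∫⁻ l in Ioi (0:ℝ),
      (ENNReal.ofReal l * (volume {x | l < |f x|}) ^ (1 / p)) ^ r / ENNReal.ofReal l) ^ (1 / r)

/-- Littlewood–Paley projection P_k for k ∈ ℤ: (P_k f)^(ξ) = β(2^{−k}|ξ|) f̂(ξ). -/
def Pproj (β : ℝ → ℝ) (k : ℤ) (f : EuclideanSpace ℝ (Fin d) → ℂ)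
    (x : EuclideanSpace ℝ (Fin d)) : ℂ :=
  ∫ ξ, Complex.exp (2 * (π : ℂ) * Complex.I * ((⟪x, ξ⟫ : ℝ) : ℂ)) *
    ((β ((2:ℝ) ^ (-k) * ‖ξ‖) : ℝ) : ℂ) * 𝓕 f ξ

/-- The multiplier operator T_j^t, with multiplier m_j(tξ) = μ̂(tξ) β(2^{−j}|tξ|). -/
def Tj (μ : Measure (EuclideanSpace ℝ (Fin d))) (β : ℝ → ℝ) (j : ℕ) (t : ℝ)
    (f : EuclideanSpace ℝ (Fin d) → ℂ) (x : EuclideanSpace ℝ (Fin d)) : ℂ :=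
  ∫ ξ, Complex.exp (2 * (π : ℂ) * Complex.I * ((⟪x, ξ⟫ : ℝ) : ℂ)) *
    (((β ((2:ℝ) ^ (-(j:ℤ)) * ‖t • ξ‖) : ℝ) : ℂ) * mFT μ (t • ξ)) * 𝓕 f ξ

/-- The maximal multiplier operator T_j^* f(x) = sup_{t>0} |T_j^t f(x)|. -/
def TjStar (μ : Measure (EuclideanSpace ℝ (Fin d))) (β : ℝ → ℝ) (j : ℕ)
    (f : EuclideanSpace ℝ (Fin d) → ℂ) (x : EuclideanSpace ℝ (Fin d)) : ℝ≥0∞ :=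
  ⨆ t : {t : ℝ // 0 < t}, (‖Tj μ β j t f x‖₊ : ℝ≥0∞)

/-- M_j f(x) = sup_{k∈ℤ} sup_{2^{−k} ≤ t < 2^{−k+1}} |(P_{k+j} f ∗ μ_t)(x)|. -/
def Mj (μ : Measure (EuclideanSpace ℝ (Fin d))) (β : ℝ → ℝ) (j : ℕ)
    (f : EuclideanSpace ℝ (Fin d) → ℂ) (x : EuclideanSpace ℝ (Fin d)) : ℝ≥0∞ :=
  ⨆ k : ℤ, ⨆ t : (Ico ((2:ℝ) ^ (-k)) ((2:ℝ) ^ (-k+1))),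
    (‖convM (Pproj β (k + j) f) μ t x‖₊ : ℝ≥0∞)

/-- P_j(μ_t ∗ μ̄_s)(x) = ∫ e^{2πi x·ξ} β(2^{−j}|ξ|) μ̂(tξ) conj(μ̂(sξ)) dξ. -/
def Kdisp (μ : Measure (EuclideanSpace ℝ (Fin d))) (β : ℝ → ℝ) (j : ℕ) (t s : ℝ)
    (x : EuclideanSpace ℝ (Fin d)) : ℂ :=
  ∫ ξ, Complex.exp (2 * (π : ℂ) * Complex.I * ((⟪x, ξ⟫ : ℝ) : ℂ)) *
    ((β ((2:ℝ) ^ (-(j:ℤ)) * ‖ξ‖) : ℝ) : ℂ) * (mFT μ (t • ξ) * (starRingEnd ℂ) (mFT μ (s • ξ)))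

/-- Convolution of a nonnegative function with a dilated measure, valued in [0,∞]. -/
def convNN (g : EuclideanSpace ℝ (Fin d) → ℝ) (σ : Measure (EuclideanSpace ℝ (Fin d)))
    (t : ℝ) (x : EuclideanSpace ℝ (Fin d)) : ℝ≥0∞ :=
  ∫⁻ y, ENNReal.ofReal (g (x - t • y)) ∂σ

/-- Plancherel for integrable square-integrable functions. -/
theorem plancherel_fourier {g : EuclideanSpace ℝ (Fin d) → ℂ} (h1 : Integrable g) (h2 : MemLp g 2) :
    ∫⁻ x, ‖𝓕 g x‖ₑ ^ 2 = ∫⁻ x, ‖g x‖ₑ ^ 2 := by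
  have hcont : Continuous (𝓕 g) :=
    VectorFourier.fourierIntegral_continuous Real.continuous_fourierChar
      (by exact continuous_inner) h1
  have key : (𝓕 (h2.toLp g) : Lp ℂ 2 (volume : Measure (EuclideanSpace ℝ (Fin d))))
      =ᵐ[volume] 𝓕 g := by
    apply ae_eq_of_integral_contDiff_smul_eq
    · exact (Lp.memLp _).locallyIntegrable (by norm_num)
    · exact hcont.locallyIntegrable
    · intro h h_smooth h_cpt
      have hg₁ : HasCompactSupport (Complex.ofRealCLM ∘ h) := h_cpt.comp_left rfl
      have hg₂ : ContDiff ℝ ((⊤ : ℕ∞) : WithTop ℕ∞) (Complex.ofRealCLM ∘ h) := by fun_prop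
      let S := hg₁.toSchwartzMap hg₂
      have e1 := DFunLike.congr_fun (Lp.fourier_toTemperedDistribution_eq (h2.toLp g)) S
      rw [TemperedDistribution.fourier_apply] at e1
      rw [Lp.toTemperedDistribution_apply, Lp.toTemperedDistribution_apply] at e1
      have e2 : ∫ x, (𝓕 S) x • (h2.toLp g) x = ∫ x, (𝓕 S) x • g x :=
        integral_congr_ae (by filter_upwards [h2.coeFn_toLp] with x hx; rw [hx])
      have e3 : ∫ x, (𝓕 S) x • g x = ∫ x, S x • 𝓕 g x := by
        have := VectorFourier.integral_fourierIntegral_smul_eq_flip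
          (L := innerₗ (EuclideanSpace ℝ (Fin d))) (μ := volume) (ν := volume) (f := S) (g := g)
          Real.continuous_fourierChar (by exact continuous_inner) S.integrable h1
        rw [flip_innerₗ] at this
        exact this
      rw [e2, e3] at e1
      have e4 : ∀ x, S x = (h x : ℂ) := fun x => rfl
      simp only [e4] at e1
      simpa using e1.symm
  have hn := Lp.norm_fourier_eq (h2.toLp g)
  have hn' : ‖(𝓕 (h2.toLp g) : Lp ℂ 2 (volume : Measure (EuclideanSpace ℝ (Fin d))))‖ₑ
      = ‖h2.toLp g‖ₑ := by
    rw [← ofReal_norm, hn, ofReal_norm]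
  rw [Lp.enorm_def, Lp.enorm_def, eLpNorm_congr_ae key, eLpNorm_congr_ae h2.coeFn_toLp,
    eLpNorm_eq_lintegral_rpow_enorm_toReal (by norm_num) (by norm_num),
    eLpNorm_eq_lintegral_rpow_enorm_toReal (by norm_num) (by norm_num)] at hn'
  simp only [ENNReal.toReal_ofNat, ENNReal.rpow_ofNat] at hn'
  exact (ENNReal.rpow_left_injective (by norm_num)) hn'

theorem plancherel_fourierInv {g : EuclideanSpace ℝ (Fin d) → ℂ} (h1 : Integrable g)
    (h2 : MemLp g 2) :
    ∫⁻ x, ‖𝓕⁻ g x‖ₑ ^ 2 = ∫⁻ x, ‖g x‖ₑ ^ 2 := by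
  rw [← plancherel_fourier h1 h2]
  simp only [Real.fourierInv_eq_fourier_neg]
  exact lintegral_neg_eq_self (fun x => ‖𝓕 g x‖ₑ ^ 2) 

/-- Operator with multiplier `m (t ξ)`. -/
def Fop (m : EuclideanSpace ℝ (Fin d) → ℂ) (f : SchwartzMap (EuclideanSpace ℝ (Fin d)) ℂ)
    (t : ℝ) (x : EuclideanSpace ℝ (Fin d)) : ℂ :=
  ∫ ξ, Complex.exp (2 * (π : ℂ) * Complex.I * ((⟪x, ξ⟫ : ℝ) : ℂ)) * (m (t • ξ) * 𝓕 f ξ)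

theorem norm_phase (r : ℝ) : ‖Complex.exp (2 * (π : ℂ) * Complex.I * (r : ℂ))‖ = 1 := by
  have : 2 * (π : ℂ) * Complex.I * (r : ℂ) = ((2 * π * r : ℝ) : ℂ) * Complex.I := by
    push_cast; ring
  rw [this, Complex.norm_exp_ofReal_mul_I]

theorem norm_phase_neg (r : ℝ) : ‖Complex.exp (-(2 * (π : ℂ) * Complex.I * (r : ℂ)))‖ = 1 := by
  have := norm_phase (-r)
  rw [← this]; congr 2; push_cast; ring

theorem Fop_eq (m : EuclideanSpace ℝ (Fin d) → ℂ) (f : SchwartzMap (EuclideanSpace ℝ (Fin d)) ℂ)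
    (t : ℝ) (x : EuclideanSpace ℝ (Fin d)) :
    Fop m f t x = 𝓕⁻ (fun ξ => m (t • ξ) * 𝓕 f ξ) x := by
  rw [Real.fourierInv_eq', Fop]
  congr 1; ext ξ
  rw [smul_eq_mul, real_inner_comm]
  congr 2
  push_cast; ring

theorem Fop_integrand_integrable {m : EuclideanSpace ℝ (Fin d) → ℂ} (hm : Continuous m) {B : ℝ}
    (hB : ∀ ξ, ‖m ξ‖ ≤ B) (f : SchwartzMap (EuclideanSpace ℝ (Fin d)) ℂ) (t : ℝ) :
    Integrable (fun ξ => m (t • ξ) * 𝓕 f ξ) := by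
  exact (𝓕 f).integrable.bdd_mul (c := B) (by fun_prop) (by simp [hB])

theorem Fop_phase_integrable {m : EuclideanSpace ℝ (Fin d) → ℂ} (hm : Continuous m) {B : ℝ}
    (hB : ∀ ξ, ‖m ξ‖ ≤ B) (f : SchwartzMap (EuclideanSpace ℝ (Fin d)) ℂ) (t : ℝ)
    (x : EuclideanSpace ℝ (Fin d)) :
    Integrable (fun ξ => Complex.exp (2 * (π : ℂ) * Complex.I * ((⟪x, ξ⟫ : ℝ) : ℂ)) *
      (m (t • ξ) * 𝓕 f ξ)) := by
  exact (Fop_integrand_integrable hm hB f t).bdd_mul (c := 1) (by fun_prop)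
    (by simp [norm_phase])

theorem Fop_continuous {m : EuclideanSpace ℝ (Fin d) → ℂ} (hm : Continuous m) {B : ℝ}
    (hB : ∀ ξ, ‖m ξ‖ ≤ B) (f : SchwartzMap (EuclideanSpace ℝ (Fin d)) ℂ) :
    Continuous (fun z : ℝ × EuclideanSpace ℝ (Fin d) => Fop m f z.1 z.2) := by
  unfold Fop
  have hc : Continuous (fun ξ => 𝓕 f ξ) := (𝓕 f).continuous
  apply continuous_of_dominated (bound := fun ξ => B * ‖𝓕 f ξ‖)
  · intro z; apply Continuous.aestronglyMeasurable; fun_prop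
  · intro z; filter_upwards with ξ
    rw [norm_mul, norm_phase, one_mul, norm_mul]
    gcongr; exact hB _
  · exact (𝓕 f).integrable.norm.const_mul B
  · filter_upwards with ξ; fun_prop

theorem Fop_plancherel {m : EuclideanSpace ℝ (Fin d) → ℂ} (hm : Continuous m) {B : ℝ}
    (hB : ∀ ξ, ‖m ξ‖ ≤ B) (f : SchwartzMap (EuclideanSpace ℝ (Fin d)) ℂ) (t : ℝ) :
    ∫⁻ x, ‖Fop m f t x‖ₑ ^ 2 = ∫⁻ ξ, ‖m (t • ξ)‖ₑ ^ 2 * ‖𝓕 f ξ‖ₑ ^ 2 := by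
  simp only [Fop_eq]
  rw [plancherel_fourierInv (Fop_integrand_integrable hm hB f t)]
  · simp only [enorm_mul, mul_pow]
  · refine ((𝓕 f).memLp 2 (μ := volume)).of_le_mul (c := B)
      (Fop_integrand_integrable hm hB f t).1 ?_
    filter_upwards with ξ
    rw [norm_mul]
    gcongr; exact hB _

theorem plancherel_schwartz (f : SchwartzMap (EuclideanSpace ℝ (Fin d)) ℂ) :
    ∫⁻ x, ‖𝓕 f x‖ₑ ^ 2 = ∫⁻ x, ‖f x‖ₑ ^ 2 :=
  plancherel_fourier f.integrable (f.memLp 2)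

theorem Fop_hasDerivAt {m m' : EuclideanSpace ℝ (Fin d) → ℂ} (hm : Continuous m)
    (hm' : Continuous m') {B0 B1 : ℝ}
    (hB0 : ∀ ξ, ‖m ξ‖ ≤ B0) (hB1 : ∀ ξ, ‖m' ξ‖ ≤ B1)
    (hder : ∀ ξ, ∀ t : ℝ, 0 < t → HasDerivAt (fun s : ℝ => m (s • ξ)) ((t⁻¹ : ℝ) * m' (t • ξ)) t)
    (f : SchwartzMap (EuclideanSpace ℝ (Fin d)) ℂ) {t : ℝ} (ht : 0 < t)
    (x : EuclideanSpace ℝ (Fin d)) :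
    HasDerivAt (fun s => Fop m f s x) ((t⁻¹ : ℝ) * Fop m' f t x) t := by
  have hc : Continuous (fun ξ => 𝓕 f ξ) := (𝓕 f).continuous
  have h := hasDerivAt_integral_of_dominated_loc_of_deriv_le (μ := (volume : Measure (EuclideanSpace ℝ (Fin d))))
    (F := fun (s : ℝ) ξ => Complex.exp (2 * (π : ℂ) * Complex.I * ((⟪x, ξ⟫ : ℝ) : ℂ)) *
      (m (s • ξ) * 𝓕 f ξ))
    (F' := fun (s : ℝ) ξ => Complex.exp (2 * (π : ℂ) * Complex.I * ((⟪x, ξ⟫ : ℝ) : ℂ)) *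
      (((s⁻¹ : ℝ) * m' (s • ξ)) * 𝓕 f ξ)) (x₀ := t) (s := Ioi (t / 2))
    (bound := fun ξ => (2 / t * B1) * ‖𝓕 f ξ‖)
    (Ioi_mem_nhds (by linarith))
    (by filter_upwards with s; apply Continuous.aestronglyMeasurable; fun_prop)
    (Fop_phase_integrable hm hB0 f t x)
    (by apply Continuous.aestronglyMeasurable; fun_prop)
    (by
      filter_upwards with ξ s hs
      have hs' : t / 2 < s := hs
      have hs0 : 0 < s := by linarith
      rw [norm_mul, norm_phase, one_mul, norm_mul, norm_mul]
      have h1 : ‖((s⁻¹ : ℝ) : ℂ)‖ ≤ 2 / t := by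
        rw [Complex.norm_real, Real.norm_of_nonneg (by positivity)]
        rw [inv_le_comm₀ hs0 (by positivity)]
        rw [inv_div]; exact hs'.le
      gcongr
      exact hB1 _)
    ((𝓕 f).integrable.norm.const_mul _)
    (by
      filter_upwards with ξ s hs
      have hs' : t / 2 < s := hs
      exact ((hder ξ s (by linarith)).mul_const _).const_mul _)
  have e : (t⁻¹ : ℝ) * Fop m' f t x =
      ∫ ξ, Complex.exp (2 * (π : ℂ) * Complex.I * ((⟪x, ξ⟫ : ℝ) : ℂ)) *
      (((t⁻¹ : ℝ) * m' (t • ξ)) * 𝓕 f ξ) := by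
    unfold Fop
    rw [← integral_const_mul]
    congr 1; ext ξ; ring
  rw [e]
  exact h.2

theorem Fop_continuous_t {m : EuclideanSpace ℝ (Fin d) → ℂ} (hm : Continuous m) {B : ℝ}
    (hB : ∀ ξ, ‖m ξ‖ ≤ B) (f : SchwartzMap (EuclideanSpace ℝ (Fin d)) ℂ)
    (x : EuclideanSpace ℝ (Fin d)) : Continuous (fun t => Fop m f t x) := by
  have h := (Fop_continuous hm hB f)
  exact Continuous.comp (f := fun s : ℝ => (s, x)) h (by fun_prop)

theorem Fop_continuous_x {m : EuclideanSpace ℝ (Fin d) → ℂ} (hm : Continuous m) {B : ℝ}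
    (hB : ∀ ξ, ‖m ξ‖ ≤ B) (f : SchwartzMap (EuclideanSpace ℝ (Fin d)) ℂ)
    (t : ℝ) : Continuous (fun x => Fop m f t x) := by
  have h := (Fop_continuous hm hB f)
  exact Continuous.comp (f := fun s : EuclideanSpace ℝ (Fin d) => (t, s)) h (by fun_prop)

theorem shell_lintegral {r : ℝ} (hr : 0 < r) (q : ℝ) (hq : 0 ≤ q) :
    ∫⁻ t in Ioi (0:ℝ), ENNReal.ofReal t⁻¹ * ({t : ℝ | r ≤ t * q ∧ t * q ≤ 4 * r}.indicator 1 t)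
      ≤ 3 := by
  rcases hq.eq_or_lt with rfl | hq
  · have : {t : ℝ | r ≤ t * 0 ∧ t * 0 ≤ 4 * r} = ∅ := by
      ext t; simp; intro h; linarith
    rw [this]; simp
  have hset : {t : ℝ | r ≤ t * q ∧ t * q ≤ 4 * r} = Icc (r / q) (4 * r / q) := by
    ext t; simp only [mem_ofPred_eq, mem_Icc, div_le_iff₀ hq, le_div_iff₀ hq]
  rw [hset]
  calc _ ≤ ∫⁻ t in Ioi (0:ℝ), (Icc (r / q) (4 * r / q)).indicator
        (fun _ => ENNReal.ofReal (q / r)) t := by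
        apply lintegral_mono
        intro t
        by_cases h : t ∈ Icc (r / q) (4 * r / q)
        · simp only [h, indicator_of_mem, Pi.one_apply, mul_one]
          apply ENNReal.ofReal_le_ofReal
          rw [← inv_div]
          exact inv_anti₀ (by positivity) h.1
        · simp [h]
    _ ≤ ∫⁻ t, (Icc (r / q) (4 * r / q)).indicator (fun _ => ENNReal.ofReal (q / r)) t :=
        setLIntegral_le_lintegral _ _
    _ = ENNReal.ofReal (q / r) * ENNReal.ofReal (4 * r / q - r / q) := by
        rw [lintegral_indicator measurableSet_Icc, setLIntegral_const, Real.volume_Icc]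
    _ = 3 := by
        rw [← ENNReal.ofReal_mul (by positivity)]
        have : q / r * (4 * r / q - r / q) = 3 := by field_simp; norm_num
        rw [this]; simp

set_option maxHeartbeats 1000000 in
theorem L2max {m m' : EuclideanSpace ℝ (Fin d) → ℂ} (hm : Continuous m)
    (hm' : Continuous m') {B0 B1 r κ : ℝ} (hr : 0 < r) (hκ : 0 < κ)
    (hB0 : ∀ ξ, ‖m ξ‖ ≤ B0) (hB1 : ∀ ξ, ‖m' ξ‖ ≤ B1)
    (hs0 : ∀ ξ, m ξ ≠ 0 → r ≤ ‖ξ‖ ∧ ‖ξ‖ ≤ 4 * r)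
    (hs1 : ∀ ξ, m' ξ ≠ 0 → r ≤ ‖ξ‖ ∧ ‖ξ‖ ≤ 4 * r)
    (hder : ∀ ξ, ∀ t : ℝ, 0 < t → HasDerivAt (fun s : ℝ => m (s • ξ)) ((t⁻¹ : ℝ) * m' (t • ξ)) t)
    (f : SchwartzMap (EuclideanSpace ℝ (Fin d)) ℂ) :
    ∃ G : EuclideanSpace ℝ (Fin d) → ℝ≥0∞, Measurable G ∧
      (∀ t : ℝ, 0 < t → ∀ x, ‖Fop m f t x‖ₑ ^ 2 ≤ G x) ∧
      ∫⁻ x, G x ≤ ENNReal.ofReal (3 * (κ * B0 ^ 2 + κ⁻¹ * B1 ^ 2)) * ∫⁻ x, ‖f x‖ₑ ^ 2 := by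
  have hcF := Fop_continuous hm hB0 f
  have hcF' := Fop_continuous hm' hB1 f
  have hmeasF : Measurable (fun z : ℝ × EuclideanSpace ℝ (Fin d) => ENNReal.ofReal z.1⁻¹ *
      (ENNReal.ofReal κ * ‖Fop m f z.1 z.2‖ₑ ^ 2 + ENNReal.ofReal κ⁻¹ * ‖Fop m' f z.1 z.2‖ₑ ^ 2)) := by
    have h1 := hcF.measurable
    have h2 := hcF'.measurable
    fun_prop
  refine ⟨fun x => ∫⁻ t in Ioi (0:ℝ), ENNReal.ofReal t⁻¹ *
      (ENNReal.ofReal κ * ‖Fop m f t x‖ₑ ^ 2 + ENNReal.ofReal κ⁻¹ * ‖Fop m' f t x‖ₑ ^ 2), ?_, ?_, ?_⟩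
  · exact hmeasF.lintegral_prod_left'
  · intro t ht x
    set G := ∫⁻ t in Ioi (0:ℝ), ENNReal.ofReal t⁻¹ *
      (ENNReal.ofReal κ * ‖Fop m f t x‖ₑ ^ 2 + ENNReal.ofReal κ⁻¹ * ‖Fop m' f t x‖ₑ ^ 2) with hG
    have hcx : Continuous (fun s => Fop m f s x) := Fop_continuous_t hm hB0 f x
    have hcx' : Continuous (fun s => Fop m' f s x) := Fop_continuous_t hm' hB1 f x
    have hstep : ∀ s, 0 < s → s ≤ t → ‖Fop m f t x‖ₑ ^ 2 ≤ ‖Fop m f s x‖ₑ ^ 2 + G := by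
      intro s hs hst
      have hd : ∀ u ∈ uIcc s t, HasDerivAt (fun u => ‖Fop m f u x‖ ^ 2)
          (2 * ⟪Fop m f u x, ((u⁻¹ : ℝ) : ℂ) * Fop m' f u x⟫) u := by
        intro u hu
        rw [uIcc_of_le hst] at hu
        exact (Fop_hasDerivAt hm hm' hB0 hB1 hder f (hs.trans_le hu.1) x).norm_sq
      have hco : ContinuousOn (fun u : ℝ => u⁻¹) (uIcc s t) := by
        apply continuousOn_inv₀.mono
        intro u hu
        rw [uIcc_of_le hst] at hu
        exact (hs.trans_le hu.1).ne'
      have hi : ContinuousOn (fun u => 2 * ⟪Fop m f u x, ((u⁻¹ : ℝ) : ℂ) * Fop m' f u x⟫) (uIcc s t) := by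
        apply ContinuousOn.mul continuousOn_const
        apply ContinuousOn.inner hcx.continuousOn
        apply ContinuousOn.mul _ hcx'.continuousOn
        exact Complex.continuous_ofReal.comp_continuousOn hco
      have hftc := intervalIntegral.integral_eq_sub_of_hasDerivAt hd hi.intervalIntegrable
      have hw : ContinuousOn (fun u => u⁻¹ * (κ * ‖Fop m f u x‖ ^ 2 + κ⁻¹ * ‖Fop m' f u x‖ ^ 2))
          (uIcc s t) := by
        apply hco.mul
        apply Continuous.continuousOn
        fun_prop
      have hle : ∫ u in s..t, 2 * ⟪Fop m f u x, ((u⁻¹ : ℝ) : ℂ) * Fop m' f u x⟫ ≤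
          ∫ u in s..t, u⁻¹ * (κ * ‖Fop m f u x‖ ^ 2 + κ⁻¹ * ‖Fop m' f u x‖ ^ 2) := by
        apply intervalIntegral.integral_mono_on hst hi.intervalIntegrable hw.intervalIntegrable
        intro u hu
        have hu0 : 0 < u := hs.trans_le hu.1
        have h1 := real_inner_le_norm (Fop m f u x) (((u⁻¹ : ℝ) : ℂ) * Fop m' f u x)
        rw [norm_mul, Complex.norm_real, Real.norm_of_nonneg (by positivity)] at h1
        set p := ‖Fop m f u x‖
        set q := ‖Fop m' f u x‖
        have h2 : 2 * (p * q) ≤ κ * p ^ 2 + κ⁻¹ * q ^ 2 := by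
          have := sq_nonneg (κ * p - q)
          have h3 : κ * p ^ 2 + κ⁻¹ * q ^ 2 - 2 * (p * q) = κ⁻¹ * (κ * p - q) ^ 2 := by
            field_simp; ring
          have : 0 ≤ κ⁻¹ * (κ * p - q) ^ 2 := by positivity
          linarith
        calc _ ≤ 2 * (p * (u⁻¹ * q)) := by linarith
          _ = u⁻¹ * (2 * (p * q)) := by ring
          _ ≤ _ := by gcongr
      have hint : ENNReal.ofReal (∫ u in s..t, u⁻¹ * (κ * ‖Fop m f u x‖ ^ 2 + κ⁻¹ * ‖Fop m' f u x‖ ^ 2))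
          ≤ G := by
        rw [intervalIntegral.integral_of_le hst]
        rw [ofReal_integral_eq_lintegral_ofReal]
        · rw [hG]
          calc _ ≤ ∫⁻ u in Ioi (0:ℝ), ENNReal.ofReal (u⁻¹ * (κ * ‖Fop m f u x‖ ^ 2 + κ⁻¹ * ‖Fop m' f u x‖ ^ 2)) := by
                apply lintegral_mono_set
                intro u hu; exact hs.trans hu.1
            _ = _ := by
              apply setLIntegral_congr_fun measurableSet_Ioi
              intro u hu
              have hu0 : 0 < u := hu
              simp only
              rw [ENNReal.ofReal_mul (by positivity), ENNReal.ofReal_add (by positivity) (by positivity),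
                ENNReal.ofReal_mul hκ.le, ENNReal.ofReal_mul (by positivity),
                ENNReal.ofReal_pow (norm_nonneg _), ENNReal.ofReal_pow (norm_nonneg _),
                ofReal_norm, ofReal_norm]
        · exact (intervalIntegrable_iff_integrableOn_Ioc_of_le hst).1 hw.intervalIntegrable
        · filter_upwards [ae_restrict_mem measurableSet_Ioc] with u hu
          have : 0 < u := hs.trans hu.1
          simp only [Pi.zero_apply]
          positivity
      have h3 : ‖Fop m f t x‖ ^ 2 ≤ ‖Fop m f s x‖ ^ 2 +
          ∫ u in s..t, u⁻¹ * (κ * ‖Fop m f u x‖ ^ 2 + κ⁻¹ * ‖Fop m' f u x‖ ^ 2) := by linarith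
      calc ‖Fop m f t x‖ₑ ^ 2 = ENNReal.ofReal (‖Fop m f t x‖ ^ 2) := by
            rw [ENNReal.ofReal_pow (norm_nonneg _), ofReal_norm]
        _ ≤ _ := ENNReal.ofReal_le_ofReal h3
        _ ≤ ENNReal.ofReal (‖Fop m f s x‖ ^ 2) + _ := ENNReal.ofReal_add_le
        _ ≤ _ := by
          gcongr
          rw [ENNReal.ofReal_pow (norm_nonneg _), ofReal_norm]
    have hm0 : m 0 = 0 := by
      by_contra h
      have := (hs0 0 h).1
      simp at this; linarith
    have h0 : Fop m f 0 x = 0 := by simp [Fop, hm0]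
    have hlim : Filter.Tendsto (fun s => ‖Fop m f s x‖ₑ ^ 2 + G) (nhdsWithin 0 (Ioi 0)) (nhds (0 + G)) := by
      apply Filter.Tendsto.add_const
      have : Continuous (fun s => ‖Fop m f s x‖ₑ ^ 2) := by fun_prop
      have h := this.tendsto 0
      simp only [h0, enorm_zero, ne_eq, OfNat.ofNat_ne_zero, not_false_eq_true, zero_pow] at h
      exact h.mono_left nhdsWithin_le_nhds
    rw [zero_add] at hlim
    apply ge_of_tendsto hlim
    filter_upwards [Ioc_mem_nhdsGT ht] with s hs
    exact hstep s hs.1 hs.2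
  · rw [lintegral_lintegral_swap]
    rotate_left
    · exact (hmeasF.comp measurable_swap).aemeasurable
    have hmm : Measurable m := hm.measurable
    have hmm' : Measurable m' := hm'.measurable
    have hFm : Measurable (fun ξ => 𝓕 f ξ) := (𝓕 f).continuous.measurable
    have e1 : ∀ t : ℝ, ∫⁻ x, ENNReal.ofReal t⁻¹ *
      (ENNReal.ofReal κ * ‖Fop m f t x‖ₑ ^ 2 + ENNReal.ofReal κ⁻¹ * ‖Fop m' f t x‖ₑ ^ 2) =
        ∫⁻ ξ, ENNReal.ofReal t⁻¹ * ((ENNReal.ofReal κ * ‖m (t • ξ)‖ₑ ^ 2 +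
          ENNReal.ofReal κ⁻¹ * ‖m' (t • ξ)‖ₑ ^ 2) * ‖𝓕 f ξ‖ₑ ^ 2) := by
      intro t
      have hcx : Measurable (fun s => Fop m f t s) := (Fop_continuous_x hm hB0 f t).measurable
      have hcx' : Measurable (fun s => Fop m' f t s) := (Fop_continuous_x hm' hB1 f t).measurable
      rw [lintegral_const_mul _ (by fun_prop), lintegral_add_left (by fun_prop),
        lintegral_const_mul _ (by fun_prop), lintegral_const_mul _ (by fun_prop),
        Fop_plancherel hm hB0, Fop_plancherel hm' hB1,
        ← lintegral_const_mul _ (by fun_prop), ← lintegral_const_mul _ (by fun_prop),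
        ← lintegral_add_left (by fun_prop), ← lintegral_const_mul _ (by fun_prop)]
      congr 1; ext ξ; ring
    simp only [e1]
    rw [lintegral_lintegral_swap]
    rotate_left
    · apply Measurable.aemeasurable
      fun_prop
    rw [← plancherel_schwartz f, ← lintegral_const_mul _ (by fun_prop)]
    apply lintegral_mono
    intro ξ
    simp only
    have hB0' : 0 ≤ B0 := (norm_nonneg _).trans (hB0 0)
    have hB1' : 0 ≤ B1 := (norm_nonneg _).trans (hB1 0)
    have hpt : ∀ t ∈ Ioi (0:ℝ), ENNReal.ofReal t⁻¹ * ((ENNReal.ofReal κ * ‖m (t • ξ)‖ₑ ^ 2 +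
          ENNReal.ofReal κ⁻¹ * ‖m' (t • ξ)‖ₑ ^ 2) * ‖𝓕 f ξ‖ₑ ^ 2) ≤
        (ENNReal.ofReal (κ * B0 ^ 2 + κ⁻¹ * B1 ^ 2) * ‖𝓕 f ξ‖ₑ ^ 2) *
        (ENNReal.ofReal t⁻¹ * ({t : ℝ | r ≤ t * ‖ξ‖ ∧ t * ‖ξ‖ ≤ 4 * r}.indicator 1 t)) := by
      intro t ht
      have ht0 : 0 < t := ht
      have hnorm : ‖t • ξ‖ = t * ‖ξ‖ := by rw [norm_smul, Real.norm_of_nonneg ht0.le]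
      by_cases h : r ≤ t * ‖ξ‖ ∧ t * ‖ξ‖ ≤ 4 * r
      · have hmem : t ∈ {t : ℝ | r ≤ t * ‖ξ‖ ∧ t * ‖ξ‖ ≤ 4 * r} := h
        rw [indicator_of_mem hmem, Pi.one_apply, mul_one, mul_comm (ENNReal.ofReal t⁻¹)]
        gcongr
        rw [ENNReal.ofReal_add (by positivity) (by positivity), ENNReal.ofReal_mul hκ.le,
          ENNReal.ofReal_mul (by positivity), ENNReal.ofReal_pow hB0', ENNReal.ofReal_pow hB1']
        gcongr
        · rw [← ofReal_norm]; exact ENNReal.ofReal_le_ofReal (hB0 _)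
        · rw [← ofReal_norm]; exact ENNReal.ofReal_le_ofReal (hB1 _)
      · have z0 : m (t • ξ) = 0 := by
          by_contra hh; exact h (hnorm ▸ hs0 _ hh)
        have z1 : m' (t • ξ) = 0 := by
          by_contra hh; exact h (hnorm ▸ hs1 _ hh)
        simp [z0, z1]
    calc _ ≤ ∫⁻ t in Ioi (0:ℝ), (ENNReal.ofReal (κ * B0 ^ 2 + κ⁻¹ * B1 ^ 2) * ‖𝓕 f ξ‖ₑ ^ 2) *
        (ENNReal.ofReal t⁻¹ * ({t : ℝ | r ≤ t * ‖ξ‖ ∧ t * ‖ξ‖ ≤ 4 * r}.indicator 1 t)) :=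
          setLIntegral_mono' measurableSet_Ioi hpt
      _ ≤ (ENNReal.ofReal (κ * B0 ^ 2 + κ⁻¹ * B1 ^ 2) * ‖𝓕 f ξ‖ₑ ^ 2) * 3 := by
          rw [lintegral_const_mul' _ _ (by finiteness)]
          gcongr
          exact shell_lintegral hr _ (norm_nonneg _)
      _ = _ := by
          rw [ENNReal.ofReal_mul (by norm_num : (0:ℝ) ≤ 3)]
          simp only [ENNReal.ofReal_ofNat]
          ring

theorem mFT_continuous (μ : Measure (EuclideanSpace ℝ (Fin d))) [IsFiniteMeasure μ] :
    Continuous (mFT μ) := by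
  unfold mFT
  apply continuous_of_dominated (bound := fun _ => 1)
  · intro z; apply Continuous.aestronglyMeasurable; fun_prop
  · intro z; filter_upwards with ξ
    rw [norm_phase_neg]
  · exact integrable_const _
  · filter_upwards with ξ; fun_prop

theorem mFT_bound (μ : Measure (EuclideanSpace ℝ (Fin d))) [IsFiniteMeasure μ]
    (ξ : EuclideanSpace ℝ (Fin d)) : ‖mFT μ ξ‖ ≤ μ.real univ := by
  unfold mFT
  refine (norm_integral_le_integral_norm _).trans ?_
  simp [norm_phase_neg]

/-- Radial derivative of the Fourier transform of a measure. -/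
def mD (μ : Measure (EuclideanSpace ℝ (Fin d))) (ξ : EuclideanSpace ℝ (Fin d)) : ℂ :=
  ∫ x, -(2 * (π : ℂ) * Complex.I * ((⟪x, ξ⟫ : ℝ) : ℂ)) *
    Complex.exp (-(2 * (π : ℂ) * Complex.I * ((⟪x, ξ⟫ : ℝ) : ℂ))) ∂μ

theorem norm_lin (r : ℝ) : ‖-(2 * (π : ℂ) * Complex.I * (r : ℂ))‖ = 2 * π * |r| := by
  rw [norm_neg, norm_mul, norm_mul, norm_mul, Complex.norm_I, Complex.norm_real, Complex.norm_real,
    Real.norm_of_nonneg pi_pos.le]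
  simp

theorem ae_norm_le {μ : Measure (EuclideanSpace ℝ (Fin d))} {R : ℝ}
    (hR : μ (closedBall 0 R)ᶜ = 0) : ∀ᵐ x ∂μ, ‖x‖ ≤ R := by
  rw [ae_iff]
  convert hR using 2
  ext x; simp

theorem mFT_hasDerivAt (μ : Measure (EuclideanSpace ℝ (Fin d))) [IsFiniteMeasure μ] {R : ℝ}
    (hR : μ (closedBall 0 R)ᶜ = 0) (ξ : EuclideanSpace ℝ (Fin d)) {t : ℝ} (ht : 0 < t) :
    HasDerivAt (fun s : ℝ => mFT μ (s • ξ)) ((t⁻¹ : ℝ) * mD μ (t • ξ)) t := by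
  have h := hasDerivAt_integral_of_dominated_loc_of_deriv_le (μ := μ)
    (F := fun (s : ℝ) x => Complex.exp (-(2 * (π : ℂ) * Complex.I * ((⟪x, s • ξ⟫ : ℝ) : ℂ))))
    (F' := fun (s : ℝ) x => -(2 * (π : ℂ) * Complex.I * ((⟪x, ξ⟫ : ℝ) : ℂ)) *
      Complex.exp (-(2 * (π : ℂ) * Complex.I * ((⟪x, s • ξ⟫ : ℝ) : ℂ)))) (x₀ := t) (s := univ)
    (bound := fun x => 2 * π * (R * ‖ξ‖))
    Filter.univ_mem
    (by filter_upwards with s; apply Continuous.aestronglyMeasurable; fun_prop)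
    (by
      apply (integrable_const (1 : ℝ)).mono'
      · apply Continuous.aestronglyMeasurable; fun_prop
      · filter_upwards with x; rw [norm_phase_neg])
    (by apply Continuous.aestronglyMeasurable; fun_prop)
    (by
      filter_upwards [ae_norm_le hR] with x hx s hs
      rw [norm_mul, norm_phase_neg, mul_one, norm_lin]
      gcongr
      exact (abs_real_inner_le_norm _ _).trans (by gcongr))
    (integrable_const _)
    (by
      filter_upwards with x s hs
      have h1 : HasDerivAt (fun s : ℝ => ((s : ℝ) : ℂ)) 1 s := Complex.ofRealCLM.hasDerivAt
      have h2 : HasDerivAt (fun s : ℝ => -(2 * (π : ℂ) * Complex.I * ((⟪x, ξ⟫ : ℝ) : ℂ)) * (s : ℂ))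
        (-(2 * (π : ℂ) * Complex.I * ((⟪x, ξ⟫ : ℝ) : ℂ)) * 1) s := h1.const_mul _
      have h3 := h2.cexp
      have e : ∀ s : ℝ, -(2 * (π : ℂ) * Complex.I * ((⟪x, s • ξ⟫ : ℝ) : ℂ)) =
        -(2 * (π : ℂ) * Complex.I * ((⟪x, ξ⟫ : ℝ) : ℂ)) * (s : ℂ) := by
        intro s; rw [inner_smul_right]; push_cast; ring
      simp only [e]
      refine h3.congr_deriv ?_
      ring)
  have e : (t⁻¹ : ℝ) * mD μ (t • ξ) = ∫ x, -(2 * (π : ℂ) * Complex.I * ((⟪x, ξ⟫ : ℝ) : ℂ)) *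
      Complex.exp (-(2 * (π : ℂ) * Complex.I * ((⟪x, t • ξ⟫ : ℝ) : ℂ))) ∂μ := by
    unfold mD
    rw [← integral_const_mul]
    congr 1; ext x
    have ht' : (t : ℂ) ≠ 0 := by exact_mod_cast ht.ne'
    rw [inner_smul_right]; push_cast; field_simp
  rw [e]
  exact h.2

theorem mD_continuous (μ : Measure (EuclideanSpace ℝ (Fin d))) [IsFiniteMeasure μ] {R : ℝ}
    (hR : μ (closedBall 0 R)ᶜ = 0) : Continuous (mD μ) := by
  unfold mD
  rw [continuous_iff_continuousAt]
  intro ξ0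
  apply continuousAt_of_dominated (bound := fun _ => 2 * π * (R * (‖ξ0‖ + 1)))
  · filter_upwards with z; apply Continuous.aestronglyMeasurable; fun_prop
  · filter_upwards [ball_mem_nhds ξ0 one_pos] with z hz
    filter_upwards [ae_norm_le hR] with x hx
    rw [norm_mul, norm_phase_neg, mul_one, norm_lin]
    have hz' : ‖z‖ ≤ ‖ξ0‖ + 1 := by
      have h1 : ‖z - ξ0‖ < 1 := by simpa [dist_eq_norm] using hz
      have h2 := norm_sub_norm_le z ξ0
      linarith
    have hR0 : 0 ≤ R := (norm_nonneg _).trans hx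
    gcongr
    exact (abs_real_inner_le_norm _ _).trans (by gcongr)
  · exact integrable_const _
  · filter_upwards with x
    apply Continuous.continuousAt; fun_prop

theorem mFT_decay_one (μ : Measure (EuclideanSpace ℝ (Fin d))) [IsFiniteMeasure μ]
    {a C : ℝ} (ha : 0 < a)
    (hdecay : ∀ ξ : EuclideanSpace ℝ (Fin d), ξ ≠ 0 → ‖mFT μ ξ‖ ≤ C * ‖ξ‖ ^ (-a)) :
    ∃ C2 : ℝ, 0 < C2 ∧ ∀ ξ, ‖mFT μ ξ‖ ≤ C2 * (1 + ‖ξ‖) ^ (-a) := by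
  refine ⟨2 ^ a * (|C| + μ.real univ + 1), by positivity, fun ξ => ?_⟩
  have hM : 0 ≤ μ.real univ := measureReal_nonneg
  rcases le_or_gt 1 ‖ξ‖ with h | h
  · have hne : ξ ≠ 0 := by rintro rfl; simp at h; linarith
    have h1 : ‖ξ‖ ^ (-a) ≤ 2 ^ a * (1 + ‖ξ‖) ^ (-a) := by
      have : (2 * ‖ξ‖) ^ (-a) ≤ (1 + ‖ξ‖) ^ (-a) :=
        Real.rpow_le_rpow_of_nonpos (by positivity) (by linarith) (by linarith)
      rw [Real.mul_rpow (by norm_num) (by positivity)] at this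
      calc ‖ξ‖ ^ (-a) = 2 ^ a * (2 ^ (-a) * ‖ξ‖ ^ (-a)) := by
            rw [← mul_assoc, ← Real.rpow_add (by norm_num)]; simp
        _ ≤ _ := by gcongr
    calc _ ≤ C * ‖ξ‖ ^ (-a) := hdecay ξ hne
      _ ≤ |C| * ‖ξ‖ ^ (-a) := by gcongr; exact le_abs_self C
      _ ≤ |C| * (2 ^ a * (1 + ‖ξ‖) ^ (-a)) := by gcongr
      _ = 2 ^ a * |C| * (1 + ‖ξ‖) ^ (-a) := by ring
      _ ≤ _ := by gcongr; linarith
  · have h1 : 1 ≤ 2 ^ a * (1 + ‖ξ‖) ^ (-a) := by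
      have : (2:ℝ) ^ (-a) ≤ (1 + ‖ξ‖) ^ (-a) :=
        Real.rpow_le_rpow_of_nonpos (by positivity) (by linarith) (by linarith)
      calc (1:ℝ) = 2 ^ a * 2 ^ (-a) := by rw [← Real.rpow_add (by norm_num)]; simp
        _ ≤ _ := by gcongr
    calc _ ≤ μ.real univ * 1 := by rw [mul_one]; exact mFT_bound μ ξ
      _ ≤ (|C| + μ.real univ + 1) * (2 ^ a * (1 + ‖ξ‖) ^ (-a)) := by
          gcongr; linarith [abs_nonneg C]
      _ = _ := by ring

theorem schwartz_weight_integrable (g : SchwartzMap (EuclideanSpace ℝ (Fin d)) ℂ) (a : ℝ) :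
    Integrable (fun η => ‖g η‖ * (1 + ‖η‖) ^ a) := by
  obtain ⟨n, hn⟩ := exists_nat_ge a
  have h1 := g.integrable_pow_mul volume 0
  have h2 := g.integrable_pow_mul volume n
  apply ((h1.add h2).const_mul (2 ^ n)).mono'
  · apply Continuous.aestronglyMeasurable
    have := g.continuous
    apply Continuous.mul (by fun_prop)
    apply Continuous.rpow_const (by fun_prop)
    intro x; left; positivity
  · filter_upwards with η
    rw [Real.norm_of_nonneg (by positivity)]
    have h3 : (1 + ‖η‖) ^ a ≤ (1 + ‖η‖) ^ n := by
      rw [← Real.rpow_natCast]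
      exact Real.rpow_le_rpow_of_exponent_le (by linarith [norm_nonneg η]) hn
    have h4 : (1 + ‖η‖) ^ n ≤ 2 ^ n * (1 + ‖η‖ ^ n) := by
      rcases le_total ‖η‖ 1 with h | h
      · calc (1 + ‖η‖) ^ n ≤ 2 ^ n := by gcongr; linarith
          _ ≤ _ := by
            have : (0:ℝ) < 2 ^ n := by positivity
            nlinarith [pow_nonneg (norm_nonneg η) n]
      · calc (1 + ‖η‖) ^ n ≤ (2 * ‖η‖) ^ n := by gcongr; linarith
          _ = 2 ^ n * ‖η‖ ^ n := by rw [mul_pow]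
          _ ≤ _ := by
            have : (0:ℝ) < 2 ^ n := by positivity
            nlinarith
    calc ‖g η‖ * (1 + ‖η‖) ^ a ≤ ‖g η‖ * (2 ^ n * (1 + ‖η‖ ^ n)) := by
          gcongr; exact h3.trans h4
      _ = _ := by simp only [Pi.add_apply]; ring

theorem schwartz_inversion (g : SchwartzMap (EuclideanSpace ℝ (Fin d)) ℂ)
    (x : EuclideanSpace ℝ (Fin d)) :
    g x = ∫ ξ, Complex.exp (2 * (π : ℂ) * Complex.I * ((⟪x, ξ⟫ : ℝ) : ℂ)) * 𝓕 g ξ := by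
  have h : (𝓕⁻ (𝓕 g)) x = g x := by rw [fourierInv_fourier_eq]
  rw [← h, SchwartzMap.fourierInv_coe, Real.fourierInv_eq']
  congr 1; ext ξ
  rw [smul_eq_mul, real_inner_comm]
  congr 2
  push_cast; ring

theorem schwartz_mul_decay (μ : Measure (EuclideanSpace ℝ (Fin d))) [IsFiniteMeasure μ]
    {a C2 : ℝ} (ha : 0 < a) (hC2 : 0 < C2)
    (hdecay : ∀ ξ, ‖mFT μ ξ‖ ≤ C2 * (1 + ‖ξ‖) ^ (-a))
    (g : SchwartzMap (EuclideanSpace ℝ (Fin d)) ℂ) :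
    ∃ C3 : ℝ, 0 ≤ C3 ∧ ∀ ξ, ‖∫ x, g x *
      Complex.exp (-(2 * (π : ℂ) * Complex.I * ((⟪x, ξ⟫ : ℝ) : ℂ))) ∂μ‖ ≤
        C3 * (1 + ‖ξ‖) ^ (-a) := by
  refine ⟨C2 * ∫ η, ‖𝓕 g η‖ * (1 + ‖η‖) ^ a, ?_, fun ξ => ?_⟩
  · have : 0 ≤ ∫ η, ‖𝓕 g η‖ * (1 + ‖η‖) ^ a := integral_nonneg (fun η => by positivity)
    positivity
  have hFc : Continuous (fun η => 𝓕 g η) := (𝓕 g).continuous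
  have e1 : ∫ x, g x * Complex.exp (-(2 * (π : ℂ) * Complex.I * ((⟪x, ξ⟫ : ℝ) : ℂ))) ∂μ =
      ∫ η, 𝓕 g η * mFT μ (ξ - η) := by
    calc _ = ∫ x, (∫ η, Complex.exp (2 * (π : ℂ) * Complex.I * ((⟪x, η⟫ : ℝ) : ℂ)) * 𝓕 g η *
          Complex.exp (-(2 * (π : ℂ) * Complex.I * ((⟪x, ξ⟫ : ℝ) : ℂ)))) ∂μ := by
          congr 1; ext x
          rw [schwartz_inversion g x, integral_mul_const]
      _ = ∫ η, (∫ x, Complex.exp (2 * (π : ℂ) * Complex.I * ((⟪x, η⟫ : ℝ) : ℂ)) * 𝓕 g η *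
          Complex.exp (-(2 * (π : ℂ) * Complex.I * ((⟪x, ξ⟫ : ℝ) : ℂ))) ∂μ) := by
          apply integral_integral_swap
          have hi : Integrable (fun z : EuclideanSpace ℝ (Fin d) × EuclideanSpace ℝ (Fin d) =>
              (1:ℝ) * ‖𝓕 g z.2‖) (μ.prod volume) :=
            (integrable_const (1:ℝ)).mul_prod (𝓕 g).integrable.norm
          apply hi.mono'
          · apply Continuous.aestronglyMeasurable
            simp only [Function.uncurry_def]
            fun_prop
          · filter_upwards with z
            simp only [Function.uncurry_def]
            rw [norm_mul, norm_mul, norm_phase, norm_phase_neg, mul_one]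
      _ = _ := by
          congr 1; ext η
          unfold mFT
          rw [← integral_const_mul]
          congr 1; ext x
          have : Complex.exp (-(2 * (π : ℂ) * Complex.I * ((⟪x, ξ - η⟫ : ℝ) : ℂ))) =
            Complex.exp (2 * (π : ℂ) * Complex.I * ((⟪x, η⟫ : ℝ) : ℂ)) *
            Complex.exp (-(2 * (π : ℂ) * Complex.I * ((⟪x, ξ⟫ : ℝ) : ℂ))) := by
            rw [← Complex.exp_add]
            congr 1
            rw [inner_sub_right]; push_cast; ring
          rw [this]; ring
  rw [e1]
  calc _ ≤ ∫ η, C2 * (1 + ‖ξ‖) ^ (-a) * (‖𝓕 g η‖ * (1 + ‖η‖) ^ a) := by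
        apply norm_integral_le_of_norm_le
        · exact (schwartz_weight_integrable (𝓕 g) a).const_mul _
        · filter_upwards with η
          rw [norm_mul]
          have h1 : (1 + ‖ξ - η‖) ^ (-a) ≤ (1 + ‖ξ‖) ^ (-a) * (1 + ‖η‖) ^ a := by
            have h2 : (1 + ‖ξ‖) ≤ (1 + ‖ξ - η‖) * (1 + ‖η‖) := by
              have := norm_le_norm_sub_add ξ η
              nlinarith [norm_nonneg (ξ - η), norm_nonneg η]
            have h3 : ((1 + ‖ξ - η‖) * (1 + ‖η‖)) ^ (-a) ≤ (1 + ‖ξ‖) ^ (-a) :=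
              Real.rpow_le_rpow_of_nonpos (by positivity) h2 (by linarith)
            rw [Real.mul_rpow (by positivity) (by positivity)] at h3
            calc (1 + ‖ξ - η‖) ^ (-a) = (1 + ‖ξ - η‖) ^ (-a) * (1 + ‖η‖) ^ (-a) * (1 + ‖η‖) ^ a := by
                  rw [mul_assoc, ← Real.rpow_add (by positivity)]; simp
              _ ≤ _ := by gcongr
          calc _ ≤ ‖𝓕 g η‖ * (C2 * ((1 + ‖ξ‖) ^ (-a) * (1 + ‖η‖) ^ a)) := by
                gcongr; exact (hdecay _).trans (by gcongr)
            _ = _ := by ring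
    _ = _ := by rw [integral_const_mul]; ring

theorem mD_decay (μ : Measure (EuclideanSpace ℝ (Fin d))) [IsFiniteMeasure μ]
    {R : ℝ} (hR0 : 0 < R) (hR : μ (closedBall 0 R)ᶜ = 0)
    {a C2 : ℝ} (ha : 0 < a) (hC2 : 0 < C2)
    (hdecay : ∀ ξ, ‖mFT μ ξ‖ ≤ C2 * (1 + ‖ξ‖) ^ (-a)) :
    ∃ C3 : ℝ, 0 < C3 ∧ ∀ ξ, ‖mD μ ξ‖ ≤ C3 * ‖ξ‖ * (1 + ‖ξ‖) ^ (-a) := by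
  let φ : ContDiffBump (0 : EuclideanSpace ℝ (Fin d)) := ⟨R, R + 1, hR0, by linarith⟩
  have hex : ∀ i : Fin d, ∃ C3 : ℝ, 0 ≤ C3 ∧ ∀ ξ, ‖∫ x, ((x i : ℝ) : ℂ) *
      Complex.exp (-(2 * (π : ℂ) * Complex.I * ((⟪x, ξ⟫ : ℝ) : ℂ))) ∂μ‖ ≤
        C3 * (1 + ‖ξ‖) ^ (-a) := by
    intro i
    let h : EuclideanSpace ℝ (Fin d) → ℝ := fun x => φ x * x i
    have hc : HasCompactSupport h := φ.hasCompactSupport.mul_right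
    have hsm : ContDiff ℝ ((⊤ : ℕ∞) : WithTop ℕ∞) h :=
      φ.contDiff.mul ((EuclideanSpace.proj i : EuclideanSpace ℝ (Fin d) →L[ℝ] ℝ).contDiff)
    have hg₁ : HasCompactSupport (Complex.ofRealCLM ∘ h) := hc.comp_left (by simp)
    have hg₂ : ContDiff ℝ ((⊤ : ℕ∞) : WithTop ℕ∞) (Complex.ofRealCLM ∘ h) := by fun_prop
    obtain ⟨C3, h0, h1⟩ := schwartz_mul_decay μ ha hC2 hdecay (hg₁.toSchwartzMap hg₂)
    refine ⟨C3, h0, fun ξ => ?_⟩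
    refine le_trans (le_of_eq ?_) (h1 ξ)
    congr 1
    apply integral_congr_ae
    filter_upwards [ae_norm_le hR] with x hx
    have : φ x = 1 := φ.one_of_mem_closedBall (by simpa using hx)
    have e : (hg₁.toSchwartzMap hg₂) x = ((φ x * x i : ℝ) : ℂ) := rfl
    rw [e, this, one_mul]
  choose K hK0 hK using hex
  refine ⟨2 * π * (∑ i, K i + 1), by
    have : 0 ≤ ∑ i, K i := Finset.sum_nonneg (fun i _ => hK0 i)
    positivity, fun ξ => ?_⟩
  have hint : ∀ i : Fin d, Integrable (fun x : EuclideanSpace ℝ (Fin d) => ((x i : ℝ) : ℂ) *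
      Complex.exp (-(2 * (π : ℂ) * Complex.I * ((⟪x, ξ⟫ : ℝ) : ℂ)))) μ := by
    intro i
    apply (integrable_const R).mono'
    · apply Continuous.aestronglyMeasurable; fun_prop
    · filter_upwards [ae_norm_le hR] with x hx
      rw [norm_mul, norm_phase_neg, mul_one, Complex.norm_real]
      exact (PiLp.norm_apply_le x i).trans hx
  have e : mD μ ξ = -(2 * (π : ℂ) * Complex.I) * ∑ i, ((ξ i : ℝ) : ℂ) * ∫ x, ((x i : ℝ) : ℂ) *
      Complex.exp (-(2 * (π : ℂ) * Complex.I * ((⟪x, ξ⟫ : ℝ) : ℂ))) ∂μ := by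
    simp only [← integral_const_mul]
    rw [← integral_finsetSum _ (fun i _ => (hint i).const_mul _), ← integral_const_mul]
    unfold mD
    congr 1; ext x
    have e2 : ((⟪x, ξ⟫ : ℝ) : ℂ) = ∑ i, ((ξ i : ℝ) : ℂ) * ((x i : ℝ) : ℂ) := by
      rw [PiLp.inner_apply]; push_cast
      simp
    simp only [← mul_assoc]
    rw [← Finset.sum_mul, ← e2]; ring
  rw [e, norm_mul]
  have e3 : ‖-(2 * (π : ℂ) * Complex.I)‖ = 2 * π := by
    have := norm_lin 1
    simpa using this
  rw [e3]
  have hpos : 0 ≤ (1 + ‖ξ‖) ^ (-a) := by positivity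
  calc _ ≤ 2 * π * ∑ i, ‖ξ‖ * (K i * (1 + ‖ξ‖) ^ (-a)) := by
        gcongr
        refine (norm_sum_le _ _).trans (Finset.sum_le_sum fun i _ => ?_)
        rw [norm_mul, Complex.norm_real]
        gcongr
        · exact PiLp.norm_apply_le ξ i
        · exact hK i ξ
    _ = 2 * π * (∑ i, K i) * ‖ξ‖ * (1 + ‖ξ‖) ^ (-a) := by
        rw [← Finset.mul_sum, ← Finset.sum_mul]; ring
    _ ≤ _ := by
        gcongr; linarith

/-- fixed frequency cutoff -/
def Abmp (d : ℕ) : ContDiffBump (0 : EuclideanSpace ℝ (Fin d)) := ⟨1, 2, by norm_num, by norm_num⟩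

theorem Abmp_contDiff : ContDiff ℝ ((⊤ : ℕ∞) : WithTop ℕ∞) (fun ξ => Abmp d ξ) := (Abmp d).contDiff

theorem Abmp_one {ξ : EuclideanSpace ℝ (Fin d)} (h : ‖ξ‖ ≤ 1) : Abmp d ξ = 1 := by
  apply (Abmp d).one_of_mem_closedBall
  simpa [Abmp] using h

theorem Abmp_zero {ξ : EuclideanSpace ℝ (Fin d)} (h : 2 ≤ ‖ξ‖) : Abmp d ξ = 0 := by
  apply (Abmp d).zero_of_le_dist
  simpa [Abmp] using h

/-- annular cutoff -/
def psi (ξ : EuclideanSpace ℝ (Fin d)) : ℝ := Abmp d ((2⁻¹ : ℝ) • ξ) - Abmp d ξ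

theorem psi_contDiff : ContDiff ℝ ((⊤ : ℕ∞) : WithTop ℕ∞) (fun ξ => psi (d := d) ξ) := by
  unfold psi
  exact (Abmp_contDiff.comp (contDiff_const_smul _)).sub Abmp_contDiff

theorem psi_support : Function.support (psi (d := d)) ⊆ {ξ | 1 ≤ ‖ξ‖ ∧ ‖ξ‖ ≤ 4} := by
  intro ξ hξ
  rw [Function.mem_support] at hξ
  constructor
  · by_contra h
    push Not at h
    apply hξ
    unfold psi
    rw [Abmp_one, Abmp_one h.le, sub_self]
    rw [norm_smul]; norm_num; linarith
  · by_contra h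
    push Not at h
    apply hξ
    unfold psi
    rw [Abmp_zero, Abmp_zero (by linarith), sub_self]
    rw [norm_smul]; norm_num; linarith

theorem psi_tsupport : tsupport (psi (d := d)) ⊆ {ξ | 1 ≤ ‖ξ‖ ∧ ‖ξ‖ ≤ 4} := by
  apply closure_minimal psi_support
  exact (isClosed_le continuous_const continuous_norm).inter
    (isClosed_le continuous_norm continuous_const)

theorem psi_bound (ξ : EuclideanSpace ℝ (Fin d)) : |psi ξ| ≤ 1 := by
  unfold psi
  have h1 := (Abmp d).nonneg (x := ξ)
  have h2 := (Abmp d).le_one (x := ξ)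
  have h3 := (Abmp d).nonneg (x := (2⁻¹ : ℝ) • ξ)
  have h4 := (Abmp d).le_one (x := (2⁻¹ : ℝ) • ξ)
  rw [abs_le]; constructor <;> linarith

/-- radial derivative of psi -/
def psiD (ξ : EuclideanSpace ℝ (Fin d)) : ℝ := fderiv ℝ psi ξ ξ

theorem psiD_continuous : Continuous (psiD (d := d)) := by
  unfold psiD
  have : Continuous (fderiv ℝ (psi (d := d))) := psi_contDiff.continuous_fderiv (by simp)
  exact this.clm_apply continuous_id

theorem psiD_support : Function.support (psiD (d := d)) ⊆ {ξ | 1 ≤ ‖ξ‖ ∧ ‖ξ‖ ≤ 4} := by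
  intro ξ hξ
  apply psi_tsupport
  apply support_fderiv_subset ℝ
  rw [Function.mem_support] at hξ ⊢
  intro h
  apply hξ
  unfold psiD
  rw [h]; simp

theorem psiD_bound : ∃ C : ℝ, 0 < C ∧ ∀ ξ : EuclideanSpace ℝ (Fin d), |psiD ξ| ≤ C := by
  obtain ⟨C, hC⟩ := (isCompact_closedBall (0 : EuclideanSpace ℝ (Fin d)) 4).exists_bound_of_continuousOn
    psiD_continuous.continuousOn
  refine ⟨|C| + 1, by positivity, fun ξ => ?_⟩
  by_cases h : psiD ξ = 0
  · rw [h]; simp; positivity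
  · have := psiD_support (Function.mem_support.2 h)
    have h2 := hC ξ (by simpa using this.2)
    rw [Real.norm_eq_abs] at h2
    linarith [le_abs_self C]

/-- multiplier piece -/
def mE (μ : Measure (EuclideanSpace ℝ (Fin d))) (ε : ℝ) (ζ : EuclideanSpace ℝ (Fin d)) : ℂ :=
  mFT μ ζ * ((psi (ε • ζ) : ℝ) : ℂ)

/-- radial derivative of the multiplier piece -/
def mE' (μ : Measure (EuclideanSpace ℝ (Fin d))) (ε : ℝ) (ζ : EuclideanSpace ℝ (Fin d)) : ℂ :=
  mD μ ζ * ((psi (ε • ζ) : ℝ) : ℂ) + mFT μ ζ * ((psiD (ε • ζ) : ℝ) : ℂ)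

theorem mE_continuous (μ : Measure (EuclideanSpace ℝ (Fin d))) [IsFiniteMeasure μ] (ε : ℝ) :
    Continuous (mE μ ε) := by
  unfold mE
  have h1 : Continuous (fun ξ => psi (d := d) ξ) := psi_contDiff.continuous
  have h2 : Continuous (fun ζ : EuclideanSpace ℝ (Fin d) => psi (ε • ζ)) :=
    h1.comp (continuous_const_smul ε)
  exact (mFT_continuous μ).mul (Complex.continuous_ofReal.comp h2)

theorem mE'_continuous (μ : Measure (EuclideanSpace ℝ (Fin d))) [IsFiniteMeasure μ]
    {R : ℝ} (hR : μ (closedBall 0 R)ᶜ = 0) (ε : ℝ) :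
    Continuous (mE' μ ε) := by
  unfold mE'
  have h1 : Continuous (fun ξ => psi (d := d) ξ) := psi_contDiff.continuous
  have h2 : Continuous (fun ζ : EuclideanSpace ℝ (Fin d) => psi (ε • ζ)) :=
    h1.comp (continuous_const_smul ε)
  have h3 : Continuous (fun ζ : EuclideanSpace ℝ (Fin d) => psiD (ε • ζ)) :=
    psiD_continuous.comp (continuous_const_smul ε)
  exact ((mD_continuous μ hR).mul (Complex.continuous_ofReal.comp h2)).add
    ((mFT_continuous μ).mul (Complex.continuous_ofReal.comp h3))

theorem mE_hasDerivAt (μ : Measure (EuclideanSpace ℝ (Fin d))) [IsFiniteMeasure μ]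
    {R : ℝ} (hR : μ (closedBall 0 R)ᶜ = 0) (ε : ℝ) (ξ : EuclideanSpace ℝ (Fin d)) {t : ℝ}
    (ht : 0 < t) : HasDerivAt (fun s : ℝ => mE μ ε (s • ξ)) ((t⁻¹ : ℝ) * mE' μ ε (t • ξ)) t := by
  have h1 := mFT_hasDerivAt μ hR ξ ht
  have h2 : HasDerivAt (fun s : ℝ => psi (ε • (s • ξ))) (t⁻¹ * psiD (ε • (t • ξ))) t := by
    have hd1 : HasDerivAt (fun s : ℝ => ε • (s • ξ)) (ε • ξ) t := by
      have := ((hasDerivAt_id t).smul_const ξ).const_smul ε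
      rw [one_smul] at this
      exact this
    have hd2 : HasFDerivAt (psi (d := d)) (fderiv ℝ psi (ε • (t • ξ))) (ε • (t • ξ)) :=
      (psi_contDiff.differentiable (by simp) _).hasFDerivAt
    refine (hd2.comp_hasDerivAt t hd1).congr_deriv ?_
    unfold psiD
    have : ε • (t • ξ) = t • (ε • ξ) := smul_comm _ _ _
    conv_rhs => rw [show fderiv ℝ psi (ε • t • ξ) (ε • t • ξ) =
      fderiv ℝ psi (ε • t • ξ) (t • (ε • ξ)) by rw [this], map_smul]
    rw [smul_eq_mul]; field_simp
  unfold mE mE'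
  refine (h1.mul h2.ofReal_comp).congr_deriv ?_
  push_cast
  ring

theorem shell_of_scaled {ε : ℝ} (hε : 0 < ε) {ζ : EuclideanSpace ℝ (Fin d)}
    (h : 1 ≤ ‖ε • ζ‖ ∧ ‖ε • ζ‖ ≤ 4) : ε⁻¹ ≤ ‖ζ‖ ∧ ‖ζ‖ ≤ 4 * ε⁻¹ := by
  rw [norm_smul, Real.norm_of_nonneg hε.le] at h
  constructor
  · rw [inv_le_iff_one_le_mul₀ hε]; linarith [h.1, mul_comm ε ‖ζ‖]
  · rw [← div_eq_mul_inv, le_div_iff₀ hε]; linarith [h.2, mul_comm ε ‖ζ‖]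

theorem mE_L2 (μ : Measure (EuclideanSpace ℝ (Fin d))) [IsFiniteMeasure μ]
    {R : ℝ} (hR0 : 0 < R) (hR : μ (closedBall 0 R)ᶜ = 0) {a C : ℝ} (ha : 0 < a)
    (hdecay : ∀ ξ : EuclideanSpace ℝ (Fin d), ξ ≠ 0 → ‖mFT μ ξ‖ ≤ C * ‖ξ‖ ^ (-a)) :
    ∃ K : ℝ, 0 < K ∧ ∀ ε : ℝ, 0 < ε → ε ≤ 1 → ∀ f : SchwartzMap (EuclideanSpace ℝ (Fin d)) ℂ,
      ∃ G : EuclideanSpace ℝ (Fin d) → ℝ≥0∞, Measurable G ∧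
      (∀ t : ℝ, 0 < t → ∀ x, ‖Fop (mE μ ε) f t x‖ₑ ^ 2 ≤ G x) ∧
      ∫⁻ x, G x ≤ ENNReal.ofReal (K * ε ^ (2 * a - 1)) * ∫⁻ x, ‖f x‖ₑ ^ 2 := by
  obtain ⟨C2, hC2, hd2⟩ := mFT_decay_one μ ha hdecay
  obtain ⟨C3, hC3, hd3⟩ := mD_decay μ hR0 hR ha hC2 hd2
  obtain ⟨C4, hC4, hd4⟩ := psiD_bound (d := d)
  refine ⟨3 * (C2 ^ 2 + (4 * C3 + C2 * C4) ^ 2), by positivity, fun ε hε hε1 f => ?_⟩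
  have hw : ∀ ζ : EuclideanSpace ℝ (Fin d), ε⁻¹ ≤ ‖ζ‖ → (1 + ‖ζ‖) ^ (-a) ≤ ε ^ a := by
    intro ζ hζ
    have : (1 + ‖ζ‖) ^ (-a) ≤ (ε⁻¹) ^ (-a) :=
      Real.rpow_le_rpow_of_nonpos (by positivity) (by linarith) (by linarith)
    refine this.trans_eq ?_
    rw [Real.inv_rpow hε.le, Real.rpow_neg hε.le, inv_inv]
  have hεa : 0 < ε ^ a := by positivity
  have hs0 : ∀ ξ, mE μ ε ξ ≠ 0 → ε⁻¹ ≤ ‖ξ‖ ∧ ‖ξ‖ ≤ 4 * ε⁻¹ := by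
    intro ξ h
    apply shell_of_scaled hε
    apply psi_support
    rw [Function.mem_support]
    rintro h0
    apply h; unfold mE; rw [h0]; simp
  have hs1 : ∀ ξ, mE' μ ε ξ ≠ 0 → ε⁻¹ ≤ ‖ξ‖ ∧ ‖ξ‖ ≤ 4 * ε⁻¹ := by
    intro ξ h
    apply shell_of_scaled hε
    by_cases h0 : psi (ε • ξ) = 0
    · apply psiD_support
      rw [Function.mem_support]
      rintro h1
      apply h; unfold mE'; rw [h0, h1]; simp
    · exact psi_support (Function.mem_support.2 h0)
  have hB0 : ∀ ξ, ‖mE μ ε ξ‖ ≤ C2 * ε ^ a := by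
    intro ξ
    by_cases h : mE μ ε ξ = 0
    · rw [h]; simp; positivity
    · unfold mE
      rw [norm_mul, Complex.norm_real, Real.norm_eq_abs]
      calc _ ≤ (C2 * (1 + ‖ξ‖) ^ (-a)) * 1 :=
            mul_le_mul (hd2 ξ) (psi_bound _) (abs_nonneg _) (by positivity)
        _ ≤ _ := by rw [mul_one]; gcongr; exact hw ξ (hs0 ξ h).1
  have hB1 : ∀ ξ, ‖mE' μ ε ξ‖ ≤ (4 * C3 + C2 * C4) * (ε ^ a * ε⁻¹) := by
    intro ξ
    by_cases h : mE' μ ε ξ = 0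
    · rw [h]; simp; positivity
    · have h1 := hs1 ξ h
      have hw1 := hw ξ h1.1
      have hi : 1 ≤ ε⁻¹ := (one_le_inv₀ hε).2 hε1
      unfold mE'
      refine (norm_add_le _ _).trans ?_
      rw [norm_mul, Complex.norm_real, Real.norm_eq_abs, norm_mul, Complex.norm_real,
        Real.norm_eq_abs]
      have e1 : ‖mD μ ξ‖ * |psi (ε • ξ)| ≤ C3 * (4 * ε⁻¹) * ε ^ a := by
        calc _ ≤ (C3 * ‖ξ‖ * (1 + ‖ξ‖) ^ (-a)) * 1 :=
            mul_le_mul (hd3 ξ) (psi_bound _) (abs_nonneg _) (by positivity)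
          _ ≤ _ := by rw [mul_one]; gcongr; exact h1.2
      have e2 : ‖mFT μ ξ‖ * |psiD (ε • ξ)| ≤ (C2 * ε ^ a) * C4 := by
        calc _ ≤ (C2 * (1 + ‖ξ‖) ^ (-a)) * C4 :=
            mul_le_mul (hd2 ξ) (hd4 _) (abs_nonneg _) (by positivity)
          _ ≤ _ := by gcongr
      have e3 : (C2 * ε ^ a) * C4 * 1 ≤ (C2 * ε ^ a) * C4 * ε⁻¹ := by gcongr
      nlinarith
  obtain ⟨G, hG, hG1, hG2⟩ := L2max (mE_continuous μ ε) (mE'_continuous μ hR ε)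
    (inv_pos.2 hε) (inv_pos.2 hε) hB0 hB1 hs0 hs1 (fun ξ t ht => mE_hasDerivAt μ hR ε ξ ht) f
  refine ⟨G, hG, hG1, hG2.trans_eq ?_⟩
  congr 2
  have : ε ^ (2 * a - 1) = ε ^ a * ε ^ a * ε⁻¹ := by
    rw [← Real.rpow_add hε, Real.rpow_sub hε, Real.rpow_one, two_mul]; rfl
  rw [this, inv_inv]
  field_simp

theorem convM_eq_Fop (μ : Measure (EuclideanSpace ℝ (Fin d))) [IsFiniteMeasure μ]
    (f : SchwartzMap (EuclideanSpace ℝ (Fin d)) ℂ) (t : ℝ) (x : EuclideanSpace ℝ (Fin d)) :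
    convM f μ t x = Fop (mFT μ) f t x := by
  have hFc : Continuous (fun η => 𝓕 f η) := (𝓕 f).continuous
  unfold convM Fop
  calc _ = ∫ y, (∫ ξ, Complex.exp (2 * (π : ℂ) * Complex.I * ((⟪x - t • y, ξ⟫ : ℝ) : ℂ)) * 𝓕 f ξ) ∂μ := by
        congr 1; ext y
        rw [schwartz_inversion f (x - t • y)]
    _ = ∫ ξ, (∫ y, Complex.exp (2 * (π : ℂ) * Complex.I * ((⟪x - t • y, ξ⟫ : ℝ) : ℂ)) * 𝓕 f ξ ∂μ) := by
        apply integral_integral_swap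
        have hi : Integrable (fun z : EuclideanSpace ℝ (Fin d) × EuclideanSpace ℝ (Fin d) =>
            (1:ℝ) * ‖𝓕 f z.2‖) (μ.prod volume) :=
          (integrable_const (1:ℝ)).mul_prod (𝓕 f).integrable.norm
        apply hi.mono'
        · apply Continuous.aestronglyMeasurable
          simp only [Function.uncurry_def]
          fun_prop
        · filter_upwards with z
          simp only [Function.uncurry_def]
          rw [norm_mul, norm_phase]
    _ = _ := by
        congr 1; ext ξ
        unfold mFT
        rw [← mul_assoc, ← integral_const_mul, ← integral_mul_const]
        congr 1; ext y
        rw [← Complex.exp_add]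
        congr 2
        rw [inner_sub_left, real_inner_smul_left, real_inner_smul_right]; push_cast; ring

/-- low frequency multiplier -/
def mA (μ : Measure (EuclideanSpace ℝ (Fin d))) (ε : ℝ) (ζ : EuclideanSpace ℝ (Fin d)) : ℂ :=
  mFT μ ζ * ((Abmp d (ε • ζ) : ℝ) : ℂ)

theorem mA_continuous (μ : Measure (EuclideanSpace ℝ (Fin d))) [IsFiniteMeasure μ] (ε : ℝ) :
    Continuous (mA μ ε) := by
  unfold mA
  have h1 : Continuous (fun ξ => Abmp d ξ) := Abmp_contDiff.continuous
  have h2 : Continuous (fun ζ : EuclideanSpace ℝ (Fin d) => Abmp d (ε • ζ)) :=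
    h1.comp (continuous_const_smul ε)
  exact (mFT_continuous μ).mul (Complex.continuous_ofReal.comp h2)

theorem mA_bound (μ : Measure (EuclideanSpace ℝ (Fin d))) [IsFiniteMeasure μ] (ε : ℝ)
    (ζ : EuclideanSpace ℝ (Fin d)) : ‖mA μ ε ζ‖ ≤ μ.real univ := by
  unfold mA
  rw [norm_mul, Complex.norm_real, Real.norm_of_nonneg (Abmp d).nonneg]
  calc _ ≤ μ.real univ * 1 :=
        mul_le_mul (mFT_bound μ ζ) (Abmp d).le_one (Abmp d).nonneg measureReal_nonneg
    _ = _ := mul_one _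

theorem mE_bound (μ : Measure (EuclideanSpace ℝ (Fin d))) [IsFiniteMeasure μ] (ε : ℝ)
    (ζ : EuclideanSpace ℝ (Fin d)) : ‖mE μ ε ζ‖ ≤ μ.real univ := by
  unfold mE
  rw [norm_mul, Complex.norm_real, Real.norm_eq_abs]
  calc _ ≤ μ.real univ * 1 :=
        mul_le_mul (mFT_bound μ ζ) (psi_bound _) (abs_nonneg _) measureReal_nonneg
    _ = _ := mul_one _

theorem Fop_step (μ : Measure (EuclideanSpace ℝ (Fin d))) [IsFiniteMeasure μ]
    (f : SchwartzMap (EuclideanSpace ℝ (Fin d)) ℂ) (ε t : ℝ) (x : EuclideanSpace ℝ (Fin d)) :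
    Fop (mA μ (ε * 2⁻¹)) f t x = Fop (mA μ ε) f t x + Fop (mE μ ε) f t x := by
  have h1 := Fop_phase_integrable (mA_continuous μ ε) (mA_bound μ ε) f t x
  have h2 := Fop_phase_integrable (mE_continuous μ ε) (mE_bound μ ε) f t x
  unfold Fop
  rw [← integral_add h1 h2]
  congr 1; ext ξ
  have : mA μ (ε * 2⁻¹) (t • ξ) = mA μ ε (t • ξ) + mE μ ε (t • ξ) := by
    unfold mA mE psi
    rw [smul_smul (2⁻¹ : ℝ) ε, mul_comm (2⁻¹ : ℝ) ε]
    push_cast; ring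
  rw [this]; ring

theorem Fop_telescope (μ : Measure (EuclideanSpace ℝ (Fin d))) [IsFiniteMeasure μ]
    (f : SchwartzMap (EuclideanSpace ℝ (Fin d)) ℂ) (ε t : ℝ) (x : EuclideanSpace ℝ (Fin d)) (J : ℕ) :
    Fop (mA μ (ε * 2⁻¹ ^ J)) f t x = Fop (mA μ ε) f t x +
      ∑ j ∈ Finset.range J, Fop (mE μ (ε * 2⁻¹ ^ j)) f t x := by
  induction J with
  | zero => simp
  | succ J ih => rw [Finset.sum_range_succ, ← add_assoc, ← ih, ← Fop_step, pow_succ, mul_assoc]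

theorem Fop_limit (μ : Measure (EuclideanSpace ℝ (Fin d))) [IsFiniteMeasure μ]
    (f : SchwartzMap (EuclideanSpace ℝ (Fin d)) ℂ) (ε t : ℝ) (x : EuclideanSpace ℝ (Fin d)) :
    Filter.Tendsto (fun J : ℕ => Fop (mA μ (ε * 2⁻¹ ^ J)) f t x) Filter.atTop
      (nhds (Fop (mFT μ) f t x)) := by
  unfold Fop
  apply tendsto_integral_of_dominated_convergence (fun ξ => μ.real univ * ‖𝓕 f ξ‖)
  · intro J
    exact (Fop_phase_integrable (mA_continuous μ _) (mA_bound μ _) f t x).aestronglyMeasurable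
  · exact (𝓕 f).integrable.norm.const_mul _
  · intro J
    filter_upwards with ξ
    rw [norm_mul, norm_phase, norm_mul, one_mul]
    gcongr
    exact mA_bound μ _ _
  · filter_upwards with ξ
    have hlim : Filter.Tendsto (fun J : ℕ => ε * (2⁻¹ : ℝ) ^ J) Filter.atTop (nhds 0) := by
      have := (tendsto_pow_atTop_nhds_zero_of_lt_one (r := (2⁻¹ : ℝ)) (by norm_num)
        (by norm_num)).const_mul ε
      simpa using this
    have h2 : Filter.Tendsto (fun J : ℕ => mA μ (ε * 2⁻¹ ^ J) (t • ξ)) Filter.atTop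
        (nhds (mFT μ (t • ξ))) := by
      unfold mA
      have h1 : Continuous (fun ξ => Abmp d ξ) := Abmp_contDiff.continuous
      have h3 : Continuous (fun e : ℝ => mFT μ (t • ξ) * ((Abmp d (e • (t • ξ)) : ℝ) : ℂ)) :=
        continuous_const.mul (Complex.continuous_ofReal.comp (h1.comp
          (continuous_id.smul continuous_const)))
      have h4 := (h3.tendsto 0).comp hlim
      simp only [zero_smul] at h4
      rw [Abmp_one (by simp)] at h4
      rw [Complex.ofReal_one, mul_one] at h4
      exact h4
    exact (h2.mul_const _).const_mul _

theorem convM_le (μ : Measure (EuclideanSpace ℝ (Fin d))) [IsFiniteMeasure μ]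
    (f : SchwartzMap (EuclideanSpace ℝ (Fin d)) ℂ) (ε t : ℝ) (x : EuclideanSpace ℝ (Fin d)) :
    ‖convM f μ t x‖ₑ ≤ ‖Fop (mA μ ε) f t x‖ₑ +
      ∑' j : ℕ, ‖Fop (mE μ (ε * 2⁻¹ ^ j)) f t x‖ₑ := by
  rw [convM_eq_Fop]
  refine le_of_tendsto (Fop_limit μ f ε t x).enorm (Filter.Eventually.of_forall fun J => ?_)
  rw [Fop_telescope]
  refine (enorm_add_le _ _).trans ?_
  gcongr
  exact (enorm_sum_le _ _).trans (ENNReal.sum_le_tsum _)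

theorem eL2_eq (g : EuclideanSpace ℝ (Fin d) → ℝ≥0∞) :
    eLpNorm g 2 volume = (∫⁻ x, g x ^ 2) ^ (1 / 2 : ℝ) := by
  rw [eLpNorm_eq_lintegral_rpow_enorm_toReal (by norm_num) (by norm_num)]
  simp

theorem eL2_tsum_le (g : ℕ → EuclideanSpace ℝ (Fin d) → ℝ≥0∞) (hg : ∀ j, Measurable (g j)) :
    eLpNorm (fun x => ∑' j, g j x) 2 volume ≤ ∑' j, eLpNorm (g j) 2 volume := by
  have h1 : ∀ n : ℕ, eLpNorm (fun x => ∑ j ∈ Finset.range n, g j x) 2 volume ≤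
      ∑' j, eLpNorm (g j) 2 volume := by
    intro n
    have := eLpNorm_sum_le (μ := volume) (p := 2) (s := Finset.range n) (f := g)
      (fun i _ => (hg i).aestronglyMeasurable) (by norm_num)
    have e : (∑ i ∈ Finset.range n, g i) = fun x => ∑ j ∈ Finset.range n, g j x := by
      ext x; simp
    rw [e] at this
    exact this.trans (ENNReal.sum_le_tsum _)
  rw [eL2_eq]
  rw [one_div, ENNReal.rpow_inv_le_iff (by norm_num)]
  set S := ∑' j, eLpNorm (g j) 2 volume
  have h2 : ∀ n : ℕ, ∫⁻ x, (∑ j ∈ Finset.range n, g j x) ^ 2 ≤ S ^ (2:ℝ) := by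
    intro n
    have := h1 n
    rwa [eL2_eq, one_div, ENNReal.rpow_inv_le_iff (by norm_num)] at this
  calc ∫⁻ x, (∑' j, g j x) ^ 2 = ∫⁻ x, Filter.liminf (fun n : ℕ =>
        (∑ j ∈ Finset.range n, g j x) ^ 2) Filter.atTop := by
        congr 1; ext x
        symm
        apply Filter.Tendsto.liminf_eq
        exact ENNReal.Tendsto.pow (ENNReal.tendsto_nat_tsum _)
    _ ≤ Filter.liminf (fun n : ℕ => ∫⁻ x, (∑ j ∈ Finset.range n, g j x) ^ 2) Filter.atTop := by
        apply lintegral_liminf_le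
        intro n
        exact (Finset.measurable_fun_sum _ (fun i _ => hg i)).pow_const 2
    _ ≤ S ^ (2:ℝ) := by
        refine (Filter.liminf_le_limsup).trans ?_
        exact Filter.limsup_le_of_le (h := Filter.Eventually.of_forall h2)

theorem geom_sum_bound {K ε θ : ℝ} (hK : 0 < K) (hε : 0 < ε) (hθ : 0 < θ) (N : ℝ≥0∞) :
    ∑' j : ℕ, (ENNReal.ofReal (K * (ε * 2⁻¹ ^ j) ^ (2 * θ)) * N) ^ (1 / 2 : ℝ) ≤
      ENNReal.ofReal (K ^ (1 / 2 : ℝ) * (1 - 2⁻¹ ^ θ)⁻¹ * ε ^ θ) * N ^ (1 / 2 : ℝ) := by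
  have hq0 : (0:ℝ) < 2⁻¹ ^ θ := by positivity
  have hq1 : (2⁻¹ : ℝ) ^ θ < 1 := Real.rpow_lt_one (by norm_num) (by norm_num) hθ
  have e : ∀ j : ℕ, (ENNReal.ofReal (K * (ε * 2⁻¹ ^ j) ^ (2 * θ)) * N) ^ (1 / 2 : ℝ) =
      ENNReal.ofReal ((2⁻¹ : ℝ) ^ θ) ^ j * (ENNReal.ofReal (K ^ (1 / 2 : ℝ) * ε ^ θ) * N ^ (1 / 2 : ℝ)) := by
    intro j
    rw [ENNReal.mul_rpow_of_nonneg _ _ (by norm_num), ENNReal.ofReal_rpow_of_nonneg (by positivity)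
      (by norm_num), ← ENNReal.ofReal_pow hq0.le, ← mul_assoc, ← ENNReal.ofReal_mul (by positivity)]
    congr 2
    rw [Real.mul_rpow hK.le (by positivity), ← Real.rpow_mul (by positivity),
      Real.mul_rpow hε.le (by positivity)]
    have : 2 * θ * (1 / 2) = θ := by ring
    rw [this, ← Real.rpow_natCast, ← Real.rpow_mul (by norm_num), ← Real.rpow_natCast,
      ← Real.rpow_mul (by norm_num), mul_comm θ]
    ring
  simp_rw [e]
  rw [ENNReal.tsum_mul_right, ENNReal.tsum_geometric, ← mul_assoc]
  gcongr
  rw [← ENNReal.ofReal_one, ← ENNReal.ofReal_sub _ hq0.le, ← ENNReal.ofReal_inv_of_pos (by linarith),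
    ← ENNReal.ofReal_mul (inv_nonneg.2 (by linarith))]
  apply ENNReal.ofReal_le_ofReal
  apply le_of_eq; ring

/-- splitting into the low frequency part and an `L²` controlled part -/
theorem split_L2 (μ : Measure (EuclideanSpace ℝ (Fin d))) [IsFiniteMeasure μ]
    {R : ℝ} (hR0 : 0 < R) (hR : μ (closedBall 0 R)ᶜ = 0) {a C : ℝ} (ha : 1 / 2 < a)
    (hdecay : ∀ ξ : EuclideanSpace ℝ (Fin d), ξ ≠ 0 → ‖mFT μ ξ‖ ≤ C * ‖ξ‖ ^ (-a)) :
    ∃ K : ℝ, 0 < K ∧ ∀ ε : ℝ, 0 < ε → ε ≤ 1 → ∀ f : SchwartzMap (EuclideanSpace ℝ (Fin d)) ℂ,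
      ∃ H : EuclideanSpace ℝ (Fin d) → ℝ≥0∞, Measurable H ∧
      (∀ t : ℝ, 0 < t → ∀ x, ‖convM f μ t x‖ₑ ≤ ‖Fop (mA μ ε) f t x‖ₑ + H x) ∧
      eLpNorm H 2 volume ≤ ENNReal.ofReal (K * ε ^ (a - 1 / 2)) * (∫⁻ x, ‖f x‖ₑ ^ 2) ^ (1 / 2 : ℝ) := by
  obtain ⟨K, hK, hL⟩ := mE_L2 μ hR0 hR (by linarith : 0 < a) hdecay
  have hq1 : (2⁻¹ : ℝ) ^ (a - 1 / 2) < 1 := Real.rpow_lt_one (by norm_num) (by norm_num) (by linarith)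
  refine ⟨K ^ (1 / 2 : ℝ) * (1 - 2⁻¹ ^ (a - 1 / 2))⁻¹, ?_, fun ε hε hε1 f => ?_⟩
  · have : 0 < (1 - (2⁻¹ : ℝ) ^ (a - 1 / 2))⁻¹ := inv_pos.2 (by linarith)
    positivity
  have hp : ∀ j : ℕ, (0:ℝ) < ε * 2⁻¹ ^ j := fun j => by positivity
  have hp1 : ∀ j : ℕ, ε * (2⁻¹ : ℝ) ^ j ≤ 1 := fun j =>
    mul_le_one₀ hε1 (by positivity) (pow_le_one₀ (by norm_num) (by norm_num))
  choose G hG hG1 hG2 using fun j : ℕ => hL _ (hp j) (hp1 j) f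
  refine ⟨fun x => ∑' j, G j x ^ (1 / 2 : ℝ), ?_, ?_, ?_⟩
  · exact Measurable.tsum (fun j => (hG j).pow_const _)
  · intro t ht x
    refine (convM_le μ f ε t x).trans ?_
    refine add_le_add le_rfl (ENNReal.tsum_le_tsum fun j => ?_)
    rw [one_div, ENNReal.le_rpow_inv_iff (by norm_num)]
    simpa using hG1 j t ht x
  · refine (eL2_tsum_le _ (fun j => (hG j).pow_const _)).trans ?_
    refine le_trans ?_ (geom_sum_bound hK hε (by linarith : 0 < a - 1 / 2) _)
    gcongr with j
    rw [eL2_eq]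
    gcongr
    refine (le_of_eq ?_).trans ((hG2 j).trans (le_of_eq ?_))
    · congr 1; ext x
      rw [← ENNReal.rpow_natCast, ← ENNReal.rpow_mul]; norm_num
    · congr 3; ring_nf

theorem lint_affine (F : EuclideanSpace ℝ (Fin d) → ℝ≥0∞) (hF : Measurable F)
    (u : EuclideanSpace ℝ (Fin d)) {s : ℝ} (hs : s ≠ 0) :
    ∫⁻ z, F (u + s • z) = ENNReal.ofReal ((|s| ^ d)⁻¹) * ∫⁻ w, F w := by
  have h1 : ∫⁻ z, F (u + s • z) = ∫⁻ w, F (u + w) ∂(Measure.map (s • ·) volume) := by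
    rw [lintegral_map (by fun_prop) (by fun_prop)]
  rw [h1, Measure.map_addHaar_smul volume hs, lintegral_smul_measure, lintegral_add_left_eq_self]
  rw [finrank_euclideanSpace_fin, abs_inv, abs_pow, smul_eq_mul]

theorem smoothing_swap (ν : Measure (EuclideanSpace ℝ (Fin d))) [SFinite ν]
    {k h : EuclideanSpace ℝ (Fin d) → ℂ} (hk : Integrable k ν) (hkc : Continuous k)
    (hh : Integrable h) (hhc : Continuous h)
    (u : EuclideanSpace ℝ (Fin d)) (s : ℝ) :
    ∫ z, k z * (∫ ξ, Complex.exp (2 * (π : ℂ) * Complex.I * ((⟪u - s • z, ξ⟫ : ℝ) : ℂ)) * h ξ) ∂ν =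
    ∫ ξ, Complex.exp (2 * (π : ℂ) * Complex.I * ((⟪u, ξ⟫ : ℝ) : ℂ)) *
      ((∫ z, Complex.exp (-(2 * (π : ℂ) * Complex.I * ((⟪z, s • ξ⟫ : ℝ) : ℂ))) * k z ∂ν) * h ξ) := by
  calc _ = ∫ z, (∫ ξ, k z * (Complex.exp (2 * (π : ℂ) * Complex.I * ((⟪u - s • z, ξ⟫ : ℝ) : ℂ)) * h ξ)) ∂ν := by
        congr 1; ext z
        rw [integral_const_mul]
    _ = ∫ ξ, (∫ z, k z * (Complex.exp (2 * (π : ℂ) * Complex.I * ((⟪u - s • z, ξ⟫ : ℝ) : ℂ)) * h ξ) ∂ν) := by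
        apply integral_integral_swap
        have hi : Integrable (fun z : EuclideanSpace ℝ (Fin d) × EuclideanSpace ℝ (Fin d) =>
            ‖k z.1‖ * ‖h z.2‖) (ν.prod volume) := hk.norm.mul_prod hh.norm
        apply hi.mono'
        · apply Continuous.aestronglyMeasurable
          simp only [Function.uncurry_def]
          fun_prop
        · filter_upwards with z
          simp only [Function.uncurry_def]
          rw [norm_mul, norm_mul, norm_phase, one_mul]
    _ = _ := by
        congr 1; ext ξ
        rw [← integral_mul_const, ← integral_const_mul]
        congr 1; ext y
        have : Complex.exp (2 * (π : ℂ) * Complex.I * ((⟪u - s • y, ξ⟫ : ℝ) : ℂ)) =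
          Complex.exp (2 * (π : ℂ) * Complex.I * ((⟪u, ξ⟫ : ℝ) : ℂ)) *
          Complex.exp (-(2 * (π : ℂ) * Complex.I * ((⟪y, s • ξ⟫ : ℝ) : ℂ))) := by
          rw [← Complex.exp_add]
          congr 1
          rw [inner_sub_left, real_inner_smul_left, real_inner_smul_right]; push_cast; ring
        rw [this]; ring

theorem AbC_hasCompactSupport :
    HasCompactSupport (Complex.ofRealCLM ∘ (fun ξ => Abmp d ξ)) :=
  (Abmp d).hasCompactSupport.comp_left (map_zero _)

theorem AbC_contDiff : ContDiff ℝ ((⊤ : ℕ∞) : WithTop ℕ∞)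
    (Complex.ofRealCLM ∘ (fun ξ => Abmp d ξ)) :=
  Complex.ofRealCLM.contDiff.comp Abmp_contDiff

/-- the smooth kernel whose Fourier transform is the cutoff -/
def phiK (d : ℕ) : SchwartzMap (EuclideanSpace ℝ (Fin d)) ℂ :=
  𝓕⁻ (AbC_hasCompactSupport.toSchwartzMap AbC_contDiff : SchwartzMap (EuclideanSpace ℝ (Fin d)) ℂ)

theorem phiK_fourier (ζ : EuclideanSpace ℝ (Fin d)) :
    ∫ z, Complex.exp (-(2 * (π : ℂ) * Complex.I * ((⟪z, ζ⟫ : ℝ) : ℂ))) * phiK d z =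
      ((Abmp d ζ : ℝ) : ℂ) := by
  have h : 𝓕 (phiK d) ζ = ((Abmp d ζ : ℝ) : ℂ) := by
    unfold phiK
    rw [fourier_fourierInv_eq]
    rfl
  rw [← h, SchwartzMap.fourier_coe, Real.fourier_eq']
  congr 1; ext z
  rw [smul_eq_mul]
  congr 2
  push_cast; ring

theorem Fop_mA_eq (μ : Measure (EuclideanSpace ℝ (Fin d))) [IsFiniteMeasure μ]
    (f : SchwartzMap (EuclideanSpace ℝ (Fin d)) ℂ) (ε t : ℝ) (x : EuclideanSpace ℝ (Fin d)) :
    Fop (mA μ ε) f t x = ∫ y, (∫ z, phiK d z * f (x - t • y - (t * ε) • z)) ∂μ := by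
  have hFc : Continuous (fun η => 𝓕 f η) := (𝓕 f).continuous
  have hAc : Continuous (fun ξ => Abmp d ξ) := Abmp_contDiff.continuous
  have hAc2 : Continuous (fun ξ : EuclideanSpace ℝ (Fin d) => Abmp d ((t * ε) • ξ)) :=
    hAc.comp (continuous_const_smul _)
  have hi : Integrable (fun ξ => ((Abmp d ((t * ε) • ξ) : ℝ) : ℂ) * 𝓕 f ξ) := by
    have hFi : Integrable (fun η => 𝓕 f η) := (𝓕 f).integrable
    apply hFi.bdd_mul (c := 1)
    · exact (Complex.continuous_ofReal.comp hAc2).aestronglyMeasurable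
    · filter_upwards with ξ
      rw [Complex.norm_real, Real.norm_of_nonneg (Abmp d).nonneg]
      exact (Abmp d).le_one
  have e1 : ∀ u : EuclideanSpace ℝ (Fin d), ∫ z, phiK d z * f (u - (t * ε) • z) =
      ∫ ξ, Complex.exp (2 * (π : ℂ) * Complex.I * ((⟪u, ξ⟫ : ℝ) : ℂ)) *
        (((Abmp d ((t * ε) • ξ) : ℝ) : ℂ) * 𝓕 f ξ) := by
    intro u
    have := smoothing_swap volume (phiK d).integrable (phiK d).continuous (𝓕 f).integrable hFc u
      (t * ε)
    simp_rw [phiK_fourier] at this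
    rw [← this]
    congr 1; ext z
    rw [← schwartz_inversion]
  simp_rw [e1]
  have := smoothing_swap μ (integrable_const (1:ℂ)) continuous_const hi
    ((Complex.continuous_ofReal.comp hAc2).mul hFc) x t
  simp only [one_mul, mul_one] at this
  rw [this]
  unfold Fop
  congr 1; ext ξ
  unfold mA
  rw [smul_smul, mul_comm ε t, mul_assoc (mFT μ (t • ξ))]
  rfl

theorem phiK_decay (N : ℕ) : ∃ D : ℝ, 0 < D ∧ ∀ z : EuclideanSpace ℝ (Fin d),
    ‖phiK d z‖ₑ ≤ ∑' n : ℕ, ENNReal.ofReal (D * (((n:ℝ) + 1) ^ N)⁻¹) *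
      (ball (0 : EuclideanSpace ℝ (Fin d)) ((n:ℝ) + 1)).indicator 1 z := by
  have h0 := (SchwartzMap.one_add_le_sup_seminorm_apply (𝕜 := ℝ) (m := (N, 0)) (k := N) (n := 0)
    le_rfl le_rfl (phiK d))
  set D0 := 2 ^ N * ((Finset.Iic (N, 0)).sup fun m => SchwartzMap.seminorm ℝ m.1 m.2) (phiK d)
  refine ⟨|D0| + 1, by positivity, fun z => ?_⟩
  have h1 := h0 z
  rw [norm_iteratedFDeriv_zero] at h1
  refine le_trans ?_ (ENNReal.le_tsum ⌊‖z‖⌋₊)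
  have hz : z ∈ ball (0 : EuclideanSpace ℝ (Fin d)) (((⌊‖z‖⌋₊ : ℕ) : ℝ) + 1) := by
    rw [mem_ball_zero_iff]; exact Nat.lt_floor_add_one _
  rw [indicator_of_mem hz, Pi.one_apply, mul_one, ← ofReal_norm]
  apply ENNReal.ofReal_le_ofReal
  have h2 : (((⌊‖z‖⌋₊ : ℕ) : ℝ) + 1) ≤ 1 + ‖z‖ := by linarith [Nat.floor_le (norm_nonneg z)]
  rw [← div_eq_mul_inv, le_div_iff₀ (by positivity)]
  calc ‖phiK d z‖ * (((⌊‖z‖⌋₊ : ℕ) : ℝ) + 1) ^ N ≤ ‖phiK d z‖ * (1 + ‖z‖) ^ N := by gcongr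
    _ = (1 + ‖z‖) ^ N * ‖phiK d z‖ := mul_comm _ _
    _ ≤ D0 := h1
    _ ≤ _ := by linarith [le_abs_self D0]

theorem piece_bound (μ : Measure (EuclideanSpace ℝ (Fin d))) [IsFiniteMeasure μ]
    {R : ℝ} (hR : μ (closedBall 0 R)ᶜ = 0) {b C : ℝ}
    (hfrostman : ∀ (x : EuclideanSpace ℝ (Fin d)) (r : ℝ), 0 < r →
      μ (ball x r) ≤ ENNReal.ofReal (C * r ^ b))
    (F : EuclideanSpace ℝ (Fin d) → ℝ≥0∞) (hF : Measurable F) {ε ρ : ℝ} (hε : 0 < ε) (hε1 : ε ≤ 1)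
    (hρ : 0 < ρ) :
    ∫⁻ y, (∫⁻ z, (ball (0 : EuclideanSpace ℝ (Fin d)) ρ).indicator 1 z * F (y + ε • z)) ∂μ ≤
      ENNReal.ofReal (|C| * ρ ^ b * ε ^ (-((d:ℝ) - b))) * ∫⁻ w in ball 0 (R + ρ), F w := by
  have e1 : ∀ y : EuclideanSpace ℝ (Fin d),
      ∫⁻ z, (ball (0 : EuclideanSpace ℝ (Fin d)) ρ).indicator 1 z * F (y + ε • z) =
      ENNReal.ofReal ((ε ^ d)⁻¹) * ∫⁻ w, (ball y (ε * ρ)).indicator 1 w * F w := by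
    intro y
    have hm : Measurable (fun w => (ball y (ε * ρ)).indicator (1 : EuclideanSpace ℝ (Fin d) → ℝ≥0∞) w * F w) :=
      (measurable_one.indicator measurableSet_ball).mul hF
    have := lint_affine _ hm y hε.ne'
    rw [abs_of_pos hε] at this
    rw [← this]
    congr 1; ext z
    congr 1
    by_cases hz : z ∈ ball (0 : EuclideanSpace ℝ (Fin d)) ρ
    · rw [indicator_of_mem hz, indicator_of_mem]
      · rfl
      · rw [mem_ball_zero_iff] at hz
        rw [mem_ball, dist_eq_norm, add_sub_cancel_left, norm_smul, Real.norm_of_nonneg hε.le]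
        gcongr
    · rw [indicator_of_notMem hz, indicator_of_notMem]
      intro h
      apply hz
      rw [mem_ball, dist_eq_norm, add_sub_cancel_left, norm_smul, Real.norm_of_nonneg hε.le] at h
      rw [mem_ball_zero_iff]
      exact lt_of_mul_lt_mul_left h hε.le
  simp_rw [e1]
  rw [lintegral_const_mul']
  swap
  · exact ENNReal.ofReal_ne_top
  have hjm : Measurable (Function.uncurry (fun y w : EuclideanSpace ℝ (Fin d) =>
      (ball y (ε * ρ)).indicator (1 : EuclideanSpace ℝ (Fin d) → ℝ≥0∞) w * F w)) := by
    have hs : MeasurableSet {p : EuclideanSpace ℝ (Fin d) × EuclideanSpace ℝ (Fin d) |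
        dist p.2 p.1 < ε * ρ} := (isOpen_lt (by fun_prop) (by fun_prop)).measurableSet
    have : (fun p : EuclideanSpace ℝ (Fin d) × EuclideanSpace ℝ (Fin d) =>
      (ball p.1 (ε * ρ)).indicator (1 : EuclideanSpace ℝ (Fin d) → ℝ≥0∞) p.2 * F p.2) = fun p =>
      {p : EuclideanSpace ℝ (Fin d) × EuclideanSpace ℝ (Fin d) |
        dist p.2 p.1 < ε * ρ}.indicator 1 p * F p.2 := by
      ext p
      simp [indicator, mem_ball]
    simp only [Function.uncurry_def]
    rw [this]
    exact (measurable_one.indicator hs).mul (hF.comp measurable_snd)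
  rw [lintegral_lintegral_swap hjm.aemeasurable]
  have e2 : ∀ w : EuclideanSpace ℝ (Fin d), ∫⁻ y, (ball y (ε * ρ)).indicator 1 w * F w ∂μ ≤
      (ball (0 : EuclideanSpace ℝ (Fin d)) (R + ρ)).indicator
        (fun w => ENNReal.ofReal (|C| * (ε * ρ) ^ b) * F w) w := by
    intro w
    by_cases hw : w ∈ ball (0 : EuclideanSpace ℝ (Fin d)) (R + ρ)
    · rw [indicator_of_mem hw, lintegral_mul_const]
      · gcongr
        have : ∀ y, (ball y (ε * ρ)).indicator (1 : EuclideanSpace ℝ (Fin d) → ℝ≥0∞) w = (ball w (ε * ρ)).indicator 1 y := by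
          intro y
          simp [indicator, mem_ball, dist_comm]
        simp_rw [this]
        rw [lintegral_indicator_one measurableSet_ball]
        refine (hfrostman w _ (by positivity)).trans ?_
        apply ENNReal.ofReal_le_ofReal
        gcongr
        exact le_abs_self C
      · have : (fun y => (ball y (ε * ρ)).indicator (1 : EuclideanSpace ℝ (Fin d) → ℝ≥0∞) w) =
          fun y => (ball w (ε * ρ)).indicator 1 y := by
          ext y
          simp [indicator, mem_ball, dist_comm]
        rw [this]
        exact measurable_one.indicator measurableSet_ball
    · rw [indicator_of_notMem hw, nonpos_iff_eq_zero]
      rw [lintegral_congr_ae (g := fun _ => 0)]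
      · simp
      · filter_upwards [ae_norm_le hR] with y hy
        rw [indicator_of_notMem, zero_mul]
        intro h
        apply hw
        rw [mem_ball, dist_eq_norm] at h
        rw [mem_ball_zero_iff]
        have h1 := norm_le_norm_sub_add w y
        have h2 : ε * ρ ≤ 1 * ρ := by gcongr
        linarith
  calc _ ≤ ENNReal.ofReal ((ε ^ d)⁻¹) * ∫⁻ w, (ball (0 : EuclideanSpace ℝ (Fin d)) (R + ρ)).indicator
        (fun w => ENNReal.ofReal (|C| * (ε * ρ) ^ b) * F w) w := by
        gcongr with w; exact e2 w
    _ = ENNReal.ofReal ((ε ^ d)⁻¹) * (ENNReal.ofReal (|C| * (ε * ρ) ^ b) * ∫⁻ w in ball 0 (R + ρ), F w) := by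
        rw [lintegral_indicator measurableSet_ball, lintegral_const_mul _ hF]
    _ = _ := by
        rw [← mul_assoc, ← ENNReal.ofReal_mul (by positivity)]
        congr 2
        rw [neg_sub, Real.rpow_sub hε, Real.rpow_natCast, Real.mul_rpow hε.le hρ.le]
        field_simp

theorem Fop_mA_le (μ : Measure (EuclideanSpace ℝ (Fin d))) [IsFiniteMeasure μ]
    {R : ℝ} (hR : μ (closedBall 0 R)ᶜ = 0) {b C : ℝ}
    (hfrostman : ∀ (x : EuclideanSpace ℝ (Fin d)) (r : ℝ), 0 < r →
      μ (ball x r) ≤ ENNReal.ofReal (C * r ^ b)) (N : ℕ) :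
    ∃ D : ℝ, 0 < D ∧ ∀ (ε : ℝ), 0 < ε → ε ≤ 1 → ∀ f : SchwartzMap (EuclideanSpace ℝ (Fin d)) ℂ,
      ∀ (t : ℝ) (x : EuclideanSpace ℝ (Fin d)),
      ‖Fop (mA μ ε) f t x‖ₑ ≤ ∑' n : ℕ, ENNReal.ofReal (D * (((n:ℝ) + 1) ^ N)⁻¹ * ((n:ℝ) + 1) ^ b) *
        ∫⁻ w in ball 0 (R + ((n:ℝ) + 1)), ENNReal.ofReal (ε ^ (-((d:ℝ) - b))) * ‖f (x - t • w)‖ₑ := by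
  obtain ⟨D, hD, hDb⟩ := phiK_decay (d := d) N
  refine ⟨D * (|C| + 1), by positivity, fun ε hε hε1 f t x => ?_⟩
  have hfm : Measurable (fun w : EuclideanSpace ℝ (Fin d) => ‖f (x - t • w)‖ₑ) :=
    (f.continuous.comp (by fun_prop : Continuous fun w : EuclideanSpace ℝ (Fin d) => x - t • w)).enorm.measurable
  rw [Fop_mA_eq]
  have hin : ∀ n : ℕ, Measurable (fun z => (ball (0 : EuclideanSpace ℝ (Fin d)) ((n:ℝ) + 1)).indicator
      (1 : EuclideanSpace ℝ (Fin d) → ℝ≥0∞) z) := fun n => measurable_one.indicator measurableSet_ball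
  calc _ ≤ ∫⁻ y, ‖∫ z, phiK d z * f (x - t • y - (t * ε) • z)‖ₑ ∂μ := enorm_integral_le_lintegral_enorm _
    _ ≤ ∫⁻ y, (∫⁻ z, ∑' n : ℕ, ENNReal.ofReal (D * (((n:ℝ) + 1) ^ N)⁻¹) *
          ((ball (0 : EuclideanSpace ℝ (Fin d)) ((n:ℝ) + 1)).indicator 1 z *
            ‖f (x - t • (y + ε • z))‖ₑ)) ∂μ := by
        apply lintegral_mono
        intro y
        refine (enorm_integral_le_lintegral_enorm _).trans ?_
        apply lintegral_mono
        intro z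
        dsimp only
        simp_rw [← mul_assoc]
        rw [enorm_mul, ENNReal.tsum_mul_right]
        have : x - t • y - (t * ε) • z = x - t • (y + ε • z) := by
          rw [smul_add, smul_smul]; abel
        rw [this]
        gcongr
        exact hDb z
    _ = ∑' n : ℕ, ENNReal.ofReal (D * (((n:ℝ) + 1) ^ N)⁻¹) * ∫⁻ y, (∫⁻ z,
          (ball (0 : EuclideanSpace ℝ (Fin d)) ((n:ℝ) + 1)).indicator 1 z *
            ‖f (x - t • (y + ε • z))‖ₑ) ∂μ := by
        have hg : ∀ n : ℕ, Measurable (fun p : EuclideanSpace ℝ (Fin d) × EuclideanSpace ℝ (Fin d) =>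
            (ball (0 : EuclideanSpace ℝ (Fin d)) ((n:ℝ) + 1)).indicator 1 p.2 *
              ‖f (x - t • (p.1 + ε • p.2))‖ₑ) := by
          intro n
          refine ((hin n).comp measurable_snd).mul ?_
          exact (f.continuous.comp (by fun_prop : Continuous fun p :
            EuclideanSpace ℝ (Fin d) × EuclideanSpace ℝ (Fin d) => x - t • (p.1 + ε • p.2))).enorm.measurable
        have e1 : ∀ y : EuclideanSpace ℝ (Fin d), (∫⁻ z, ∑' n : ℕ, ENNReal.ofReal (D * (((n:ℝ) + 1) ^ N)⁻¹) *
          ((ball (0 : EuclideanSpace ℝ (Fin d)) ((n:ℝ) + 1)).indicator 1 z *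
            ‖f (x - t • (y + ε • z))‖ₑ)) = ∑' n : ℕ, ENNReal.ofReal (D * (((n:ℝ) + 1) ^ N)⁻¹) *
            ∫⁻ z, ((ball (0 : EuclideanSpace ℝ (Fin d)) ((n:ℝ) + 1)).indicator 1 z *
            ‖f (x - t • (y + ε • z))‖ₑ) := by
          intro y
          have hgy : ∀ n : ℕ, Measurable (fun z : EuclideanSpace ℝ (Fin d) =>
            (ball (0 : EuclideanSpace ℝ (Fin d)) ((n:ℝ) + 1)).indicator 1 z *
              ‖f (x - t • (y + ε • z))‖ₑ) := fun n => by
            refine (hin n).mul ?_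
            exact (f.continuous.comp (by fun_prop : Continuous fun z :
              EuclideanSpace ℝ (Fin d) => x - t • (y + ε • z))).enorm.measurable
          rw [lintegral_tsum (fun n => ((hgy n).const_mul _).aemeasurable)]
          congr 1; ext n
          rw [lintegral_const_mul _ (hgy n)]
        simp_rw [e1]
        rw [lintegral_tsum]
        · congr 1; ext n
          rw [lintegral_const_mul]
          exact (hg n).lintegral_prod_right'
        · intro n
          exact ((hg n).lintegral_prod_right'.const_mul _).aemeasurable
    _ ≤ _ := by
        apply ENNReal.tsum_le_tsum
        intro n
        refine (mul_le_mul_right (piece_bound μ hR hfrostman _ hfm hε hε1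
          (by positivity : (0:ℝ) < (n:ℝ) + 1)) _).trans ?_
        rw [lintegral_const_mul _ hfm, ← mul_assoc, ← mul_assoc, ← ENNReal.ofReal_mul (by positivity),
          ← ENNReal.ofReal_mul (by positivity)]
        refine mul_le_mul_left (ENNReal.ofReal_le_ofReal ?_) _
        have h0 : 0 ≤ D * (((n:ℝ) + 1) ^ N)⁻¹ * ((n:ℝ) + 1) ^ b * ε ^ (-((d:ℝ) - b)) := by positivity
        nlinarith

theorem low_bound (μ : Measure (EuclideanSpace ℝ (Fin d))) [IsFiniteMeasure μ]
    {R : ℝ} (hR0 : 0 < R) (hR : μ (closedBall 0 R)ᶜ = 0) {b C : ℝ} (hb2 : b ≤ d)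
    (hfrostman : ∀ (x : EuclideanSpace ℝ (Fin d)) (r : ℝ), 0 < r →
      μ (ball x r) ≤ ENNReal.ofReal (C * r ^ b)) :
    ∃ K : ℝ, 0 < K ∧ ∀ (s : Finset ℕ) (ε : ℕ → ℝ) (f : ℕ → SchwartzMap (EuclideanSpace ℝ (Fin d)) ℂ),
      (∀ k, 0 < ε k ∧ ε k ≤ 1) → ∀ (Λ : ℝ≥0∞) (x : EuclideanSpace ℝ (Fin d)),
      (∀ r : ℝ, 0 < r → ∫⁻ y in ball x r, ∑ k ∈ s, ENNReal.ofReal (ε k ^ (-((d:ℝ) - b))) * ‖f k y‖ₑ ≤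
        Λ * ENNReal.ofReal (r ^ d)) → ∀ t : ℝ, 0 < t →
      ∑ k ∈ s, ‖Fop (mA μ (ε k)) (f k) t x‖ₑ ≤ ENNReal.ofReal K * Λ := by
  obtain ⟨D, hD, hDb⟩ := Fop_mA_le μ hR hfrostman (2 * d + 2)
  have hsum : Summable (fun n : ℕ => D * (R + 1) ^ d * (((n:ℝ) + 1) ^ 2)⁻¹) := by
    apply Summable.mul_left
    have := (summable_nat_add_iff 1).2 (Real.summable_nat_pow_inv (p := 2).2 (by norm_num))
    simpa using this
  refine ⟨∑' n : ℕ, D * (R + 1) ^ d * (((n:ℝ) + 1) ^ 2)⁻¹, ?_, ?_⟩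
  · refine hsum.tsum_pos (fun n => by positivity) 0 (by positivity)
  intro s ε f hε Λ x hx t ht
  set h : EuclideanSpace ℝ (Fin d) → ℝ≥0∞ := fun y =>
    ∑ k ∈ s, ENNReal.ofReal (ε k ^ (-((d:ℝ) - b))) * ‖f k y‖ₑ with hh
  have hhm : Measurable h := Finset.measurable_fun_sum _ (fun k _ =>
    ((f k).continuous.enorm.measurable).const_mul _)
  have key : ∀ ρ : ℝ, 0 < ρ → ∫⁻ w in ball 0 ρ, h (x - t • w) ≤ Λ * ENNReal.ofReal (ρ ^ d) := by
    intro ρ hρ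
    have e1 : ∫⁻ w in ball 0 ρ, h (x - t • w) = ∫⁻ w, (ball x (t * ρ)).indicator h (x + (-t) • w) := by
      rw [← lintegral_indicator measurableSet_ball]
      congr 1; ext w
      have e0 : x + (-t) • w = x - t • w := by rw [neg_smul, sub_eq_add_neg]
      have : w ∈ ball (0 : EuclideanSpace ℝ (Fin d)) ρ ↔ x - t • w ∈ ball x (t * ρ) := by
        rw [mem_ball_zero_iff, mem_ball, dist_eq_norm, sub_sub_cancel_left, norm_neg, norm_smul,
          Real.norm_of_nonneg ht.le]
        exact (mul_lt_mul_iff_right₀ ht).symm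
      rw [e0]
      by_cases hw : w ∈ ball (0 : EuclideanSpace ℝ (Fin d)) ρ
      · rw [indicator_of_mem hw, indicator_of_mem (this.1 hw)]
      · rw [indicator_of_notMem hw, indicator_of_notMem (fun h' => hw (this.2 h'))]
    rw [e1, lint_affine _ (hhm.indicator measurableSet_ball) x (neg_ne_zero.2 ht.ne'),
      lintegral_indicator measurableSet_ball, abs_neg, abs_of_pos ht]
    calc _ ≤ ENNReal.ofReal ((t ^ d)⁻¹) * (Λ * ENNReal.ofReal ((t * ρ) ^ d)) := by
          gcongr; exact hx _ (by positivity)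
      _ = Λ * (ENNReal.ofReal ((t ^ d)⁻¹) * ENNReal.ofReal ((t * ρ) ^ d)) := by ring
      _ = _ := by
          rw [← ENNReal.ofReal_mul (by positivity)]
          congr 2
          rw [mul_pow]; field_simp
  calc _ ≤ ∑ k ∈ s, ∑' n : ℕ, ENNReal.ofReal (D * (((n:ℝ) + 1) ^ (2 * d + 2))⁻¹ * ((n:ℝ) + 1) ^ b) *
        ∫⁻ w in ball 0 (R + ((n:ℝ) + 1)), ENNReal.ofReal (ε k ^ (-((d:ℝ) - b))) * ‖f k (x - t • w)‖ₑ :=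
        Finset.sum_le_sum fun k _ => hDb _ (hε k).1 (hε k).2 (f k) t x
    _ = ∑' n : ℕ, ENNReal.ofReal (D * (((n:ℝ) + 1) ^ (2 * d + 2))⁻¹ * ((n:ℝ) + 1) ^ b) *
        ∫⁻ w in ball 0 (R + ((n:ℝ) + 1)), h (x - t • w) := by
        rw [← Summable.tsum_finsetSum (fun _ _ => ENNReal.summable)]
        congr 1; ext n
        rw [← Finset.mul_sum, ← lintegral_finsetSum]
        intro k _
        refine Measurable.const_mul ?_ _
        exact ((f k).continuous.comp (by fun_prop : Continuous fun w :
          EuclideanSpace ℝ (Fin d) => x - t • w)).enorm.measurable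
    _ ≤ ∑' n : ℕ, ENNReal.ofReal (D * (R + 1) ^ d * (((n:ℝ) + 1) ^ 2)⁻¹) * Λ := by
        apply ENNReal.tsum_le_tsum
        intro n
        refine (mul_le_mul_right (key _ (by positivity)) _).trans ?_
        rw [mul_left_comm, mul_comm Λ, ← ENNReal.ofReal_mul (by positivity)]
        refine mul_le_mul_left (ENNReal.ofReal_le_ofReal ?_) _
        have hn : (1:ℝ) ≤ (n:ℝ) + 1 := by linarith [(Nat.cast_nonneg n : (0:ℝ) ≤ n)]
        have h1 : ((n:ℝ) + 1) ^ b ≤ ((n:ℝ) + 1) ^ d := by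
          rw [← Real.rpow_natCast]
          exact Real.rpow_le_rpow_of_exponent_le hn hb2
        have h2 : (R + ((n:ℝ) + 1)) ^ d ≤ (R + 1) ^ d * ((n:ℝ) + 1) ^ d := by
          rw [← mul_pow]; gcongr; nlinarith
        calc _ ≤ D * (((n:ℝ) + 1) ^ (2 * d + 2))⁻¹ * ((n:ℝ) + 1) ^ d *
              ((R + 1) ^ d * ((n:ℝ) + 1) ^ d) := by gcongr
          _ = _ := by
              rw [pow_add, pow_mul', pow_two (((n:ℝ) + 1) ^ d)]; field_simp
    _ = _ := by
        rw [ENNReal.tsum_mul_right, ENNReal.ofReal_tsum_of_nonneg (fun n => by positivity) hsum]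

/-- weak type (1,1) bound for the (covering form of the) Hardy-Littlewood maximal function -/
theorem HL_weak (hd : 1 ≤ d) : ∃ V : ℝ, 0 < V ∧ ∀ (h : EuclideanSpace ℝ (Fin d) → ℝ≥0∞) (Λ : ℝ),
    0 < Λ → ∫⁻ x, h x ≠ ∞ →
    ENNReal.ofReal Λ * volume {x | ∃ r : ℝ, 0 < r ∧
      ENNReal.ofReal Λ * ENNReal.ofReal (r ^ d) < ∫⁻ y in ball x r, h y} ≤
    ENNReal.ofReal V * ∫⁻ x, h x := by
  have hvol : volume (ball (0 : EuclideanSpace ℝ (Fin d)) 1) ≠ ∞ := measure_ball_lt_top.ne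
  refine ⟨5 ^ d * ((volume (ball (0 : EuclideanSpace ℝ (Fin d)) 1)).toReal + 1), by positivity, ?_⟩
  intro h Λ hΛ hI
  set I := ∫⁻ x, h x with hIdef
  let T : Set (EuclideanSpace ℝ (Fin d) × ℝ) := {q | 0 < q.2 ∧
    ENNReal.ofReal Λ * ENNReal.ofReal (q.2 ^ d) < ∫⁻ y in ball q.1 q.2, h y}
  have hbd : ∀ q ∈ T, q.2 ≤ max 1 (I.toReal / Λ) := by
    intro q hq
    rcases le_or_gt q.2 1 with h1 | h1
    · exact le_max_of_le_left h1
    · apply le_max_of_le_right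
      have h2 : ENNReal.ofReal (Λ * q.2 ^ d) < I := by
        rw [ENNReal.ofReal_mul hΛ.le]
        exact lt_of_lt_of_le hq.2 (setLIntegral_le_lintegral _ _)
      have h3 := (ENNReal.ofReal_lt_iff_lt_toReal (mul_nonneg hΛ.le (pow_nonneg hq.1.le _)) hI).1 h2
      rw [le_div_iff₀ hΛ]
      have h4 : q.2 ≤ q.2 ^ d := le_self_pow₀ h1.le (by omega)
      nlinarith
  obtain ⟨u, huT, hdis, hcov⟩ := Vitali.exists_disjoint_subfamily_covering_enlargement_closedBall T
    (fun q => q.1) (fun q => q.2) _ hbd 5 (by norm_num)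
  have hcount : u.Countable := by
    apply hdis.countable_of_nonempty_interior
    intro q hq
    refine ⟨q.1, ?_⟩
    apply ball_subset_interior_closedBall
    exact mem_ball_self (huT hq).1
  have hsub : {x | ∃ r : ℝ, 0 < r ∧
      ENNReal.ofReal Λ * ENNReal.ofReal (r ^ d) < ∫⁻ y in ball x r, h y} ⊆
      ⋃ q ∈ u, closedBall q.1 (5 * q.2) := by
    rintro x ⟨r, hr, hx⟩
    obtain ⟨q, hq, hqs⟩ := hcov (x, r) ⟨hr, hx⟩
    exact mem_biUnion hq (hqs (mem_closedBall_self hr.le))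
  set v := volume (ball (0 : EuclideanSpace ℝ (Fin d)) 1)
  have hdisb : u.PairwiseDisjoint fun q => ball q.1 q.2 :=
    hdis.mono fun q => ball_subset_closedBall
  calc _ ≤ ENNReal.ofReal Λ * ∑' q : u, volume (closedBall q.1.1 (5 * q.1.2)) := by
        gcongr
        exact (measure_mono hsub).trans (measure_biUnion_le volume hcount _)
    _ = ∑' q : u, ENNReal.ofReal Λ * volume (closedBall q.1.1 (5 * q.1.2)) := by
        rw [ENNReal.tsum_mul_left]
    _ ≤ ∑' q : u, ENNReal.ofReal (5 ^ d) * v * ∫⁻ y in ball q.1.1 q.1.2, h y := by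
        apply ENNReal.tsum_le_tsum
        rintro ⟨q, hq⟩
        have h1 := huT hq
        rw [Measure.addHaar_closedBall _ _ (by linarith [h1.1]), finrank_euclideanSpace_fin, mul_pow,
          ENNReal.ofReal_mul (by positivity)]
        calc _ = ENNReal.ofReal (5 ^ d) * v * (ENNReal.ofReal Λ * ENNReal.ofReal (q.2 ^ d)) := by ring
          _ ≤ _ := by gcongr; exact h1.2.le
    _ = ENNReal.ofReal (5 ^ d) * v * ∫⁻ y in ⋃ q ∈ u, ball q.1 q.2, h y := by
        rw [ENNReal.tsum_mul_left, lintegral_biUnion hcount (fun _ _ => measurableSet_ball) hdisb]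
    _ ≤ ENNReal.ofReal (5 ^ d) * ENNReal.ofReal (v.toReal + 1) * I := by
        gcongr
        · refine (ENNReal.ofReal_toReal hvol).ge.trans ?_
          exact ENNReal.ofReal_le_ofReal (by linarith)
        · exact setLIntegral_le_lintegral _ _
    _ = _ := by rw [← ENNReal.ofReal_mul (by positivity)]

/-- one-dimensional cutoff -/
def chiB : ContDiffBump (0 : ℝ) := ⟨1, 4, by norm_num, by norm_num⟩

theorem chiB_one {u : ℝ} (h0 : 0 ≤ u) (h : u ≤ 1) : chiB u = 1 := by
  apply chiB.one_of_mem_closedBall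
  simpa [chiB, abs_of_nonneg h0] using h

theorem chiB_zero {u : ℝ} (h : 4 ≤ u) : chiB u = 0 := by
  apply chiB.zero_of_le_dist
  simp only [chiB, Real.dist_eq, sub_zero]
  exact h.trans (le_abs_self u)

/-- the part of `f` above height `s` -/
def hiFun (f : SchwartzMap (EuclideanSpace ℝ (Fin d)) ℂ) (s : ℝ) (x : EuclideanSpace ℝ (Fin d)) : ℂ :=
  ((1 - chiB (‖f x‖ ^ 2 / s ^ 2) : ℝ) : ℂ) * f x

theorem hiFun_zero (f : SchwartzMap (EuclideanSpace ℝ (Fin d)) ℂ) {s : ℝ} (hs : 0 < s)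
    {x : EuclideanSpace ℝ (Fin d)} (h : ‖f x‖ ≤ s) : hiFun f s x = 0 := by
  unfold hiFun
  rw [chiB_one (by positivity)]
  · simp
  · rw [div_le_one (by positivity)]; gcongr

theorem hiFun_eq (f : SchwartzMap (EuclideanSpace ℝ (Fin d)) ℂ) {s : ℝ} (hs : 0 < s)
    {x : EuclideanSpace ℝ (Fin d)} (h : 2 * s ≤ ‖f x‖) : hiFun f s x = f x := by
  unfold hiFun
  rw [chiB_zero]
  · simp
  · rw [le_div_iff₀ (by positivity)]; nlinarith

theorem hiFun_compact (f : SchwartzMap (EuclideanSpace ℝ (Fin d)) ℂ) {s : ℝ} (hs : 0 < s) :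
    HasCompactSupport (hiFun f s) := by
  have h1 : Filter.Tendsto f (Filter.cocompact _) (nhds 0) := zero_at_infty f
  have h2 : {x | ‖f x‖ < s} ∈ Filter.cocompact (EuclideanSpace ℝ (Fin d)) := by
    have := h1.norm
    rw [norm_zero] at this
    exact this.eventually_lt_const hs
  rw [Filter.mem_cocompact] at h2
  obtain ⟨K, hK, hKs⟩ := h2
  apply HasCompactSupport.intro hK
  intro x hx
  have h3 : ‖f x‖ < s := hKs hx
  exact hiFun_zero f hs h3.le

theorem hiFun_contDiff (f : SchwartzMap (EuclideanSpace ℝ (Fin d)) ℂ) (s : ℝ) :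
    ContDiff ℝ ((⊤ : ℕ∞) : WithTop ℕ∞) (hiFun f s) := by
  unfold hiFun
  have hf : ContDiff ℝ ((⊤ : ℕ∞) : WithTop ℕ∞) (fun x => f x) := f.smooth _
  have h1 : ContDiff ℝ ((⊤ : ℕ∞) : WithTop ℕ∞) (fun x => ‖f x‖ ^ 2 / s ^ 2) :=
    (hf.norm_sq ℝ).div_const _
  have h2 : ContDiff ℝ ((⊤ : ℕ∞) : WithTop ℕ∞) (fun x => 1 - chiB (‖f x‖ ^ 2 / s ^ 2)) :=
    contDiff_const.sub (chiB.contDiff.comp h1)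
  exact (Complex.ofRealCLM.contDiff.comp h2).mul hf

/-- the part of `f` above height `s`, as a Schwartz function -/
def hiS (f : SchwartzMap (EuclideanSpace ℝ (Fin d)) ℂ) (s : ℝ) (hs : 0 < s) :
    SchwartzMap (EuclideanSpace ℝ (Fin d)) ℂ :=
  (hiFun_compact f hs).toSchwartzMap (hiFun_contDiff f s)

theorem hiS_apply (f : SchwartzMap (EuclideanSpace ℝ (Fin d)) ℂ) {s : ℝ} (hs : 0 < s)
    (x : EuclideanSpace ℝ (Fin d)) : hiS f s hs x = hiFun f s x := rfl

theorem decomp (f : SchwartzMap (EuclideanSpace ℝ (Fin d)) ℂ) {s0 : ℝ} (hs0 : 0 < s0) :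
    ∃ (K : ℕ) (fk : ℕ → SchwartzMap (EuclideanSpace ℝ (Fin d)) ℂ)
      (fl : SchwartzMap (EuclideanSpace ℝ (Fin d)) ℂ),
      f = fl + ∑ k ∈ Finset.range K, fk k ∧ (∀ x, ‖fl x‖ ≤ 2 * s0) ∧
      (∀ k x, ‖fk k x‖ ≤ 4 * (2 ^ k * s0)) ∧ (∀ k x, fk k x ≠ 0 → 2 ^ k * s0 < ‖f x‖) := by
  have hs : ∀ k : ℕ, 0 < 2 ^ k * s0 := fun k => by positivity
  obtain ⟨M, hM⟩ : ∃ M, ∀ x, ‖f x‖ ≤ M := ⟨_, fun x => SchwartzMap.norm_le_seminorm ℝ f x⟩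
  obtain ⟨K, hK⟩ : ∃ K : ℕ, M ≤ 2 ^ K * s0 := by
    obtain ⟨K, hK⟩ := pow_unbounded_of_one_lt (M / s0) (by norm_num : (1:ℝ) < 2)
    exact ⟨K, by rw [div_lt_iff₀ hs0] at hK; exact hK.le⟩
  refine ⟨K, fun k => hiS f _ (hs k) - hiS f _ (hs (k+1)), f - hiS f _ (hs 0), ?_, ?_, ?_, ?_⟩
  · rw [Finset.sum_range_sub']
    have : hiS f _ (hs K) = 0 := by
      ext x
      rw [hiS_apply, hiFun_zero f (hs K) ((hM x).trans hK)]; rfl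
    rw [this]; simp
  · intro x
    rw [SchwartzMap.sub_apply, hiS_apply]
    have : 2 ^ 0 * s0 = s0 := by simp
    rw [this]
    rcases le_or_gt (2 * s0) ‖f x‖ with h | h
    · rw [hiFun_eq f hs0 h]; simp; linarith
    · refine le_trans ?_ h.le
      unfold hiFun
      have e : f x - ((1 - chiB (‖f x‖ ^ 2 / s0 ^ 2) : ℝ) : ℂ) * f x =
        ((chiB (‖f x‖ ^ 2 / s0 ^ 2) : ℝ) : ℂ) * f x := by push_cast; ring
      rw [e, norm_mul, Complex.norm_real, Real.norm_of_nonneg chiB.nonneg]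
      exact mul_le_of_le_one_left (norm_nonneg _) chiB.le_one
  · intro k x
    rw [SchwartzMap.sub_apply, hiS_apply, hiS_apply]
    rcases le_or_gt (2 * (2 ^ (k + 1) * s0)) ‖f x‖ with h | h
    · rw [hiFun_eq f (hs (k+1)) h, hiFun_eq f (hs k)]
      · simp; positivity
      · refine le_trans ?_ h; rw [pow_succ]; nlinarith [hs k]
    · have h' : ‖f x‖ ≤ 4 * (2 ^ k * s0) := by rw [pow_succ] at h; linarith
      refine le_trans ?_ h'
      unfold hiFun
      set p := chiB (‖f x‖ ^ 2 / (2 ^ k * s0) ^ 2)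
      set q := chiB (‖f x‖ ^ 2 / (2 ^ (k+1) * s0) ^ 2)
      have e : ((1 - p : ℝ) : ℂ) * f x - ((1 - q : ℝ) : ℂ) * f x = ((q - p : ℝ) : ℂ) * f x := by
        push_cast; ring
      rw [e, norm_mul, Complex.norm_real]
      apply mul_le_of_le_one_left (norm_nonneg _)
      have hp0 : 0 ≤ p := chiB.nonneg
      have hp1 : p ≤ 1 := chiB.le_one
      have hq0 : 0 ≤ q := chiB.nonneg
      have hq1 : q ≤ 1 := chiB.le_one
      rw [Real.norm_eq_abs, abs_le]; constructor <;> linarith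
  · intro k x hx
    by_contra h
    push Not at h
    apply hx
    rw [SchwartzMap.sub_apply, hiS_apply, hiS_apply, hiFun_zero f (hs k) h, hiFun_zero f (hs (k+1))]
    · simp
    · refine h.trans ?_
      rw [pow_succ]; nlinarith [hs k]

theorem lor_piece (f : EuclideanSpace ℝ (Fin d) → ℂ) {p u v : ℝ} (hp : 0 < p) :
    ENNReal.ofReal (v - u) * (volume {x | v < ‖f x‖}) ^ (1 / p) ≤
      ∫⁻ l in Ioc u v, (volume {x | l < ‖f x‖}) ^ (1 / p) := by
  rw [← Real.volume_Ioc, mul_comm, ← setLIntegral_const]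
  apply setLIntegral_mono' measurableSet_Ioc
  intro l hl
  apply ENNReal.rpow_le_rpow _ (by positivity)
  apply measure_mono
  intro x hx
  exact lt_of_le_of_lt hl.2 hx

theorem lor_first (f : EuclideanSpace ℝ (Fin d) → ℂ) {p v : ℝ} (hp : 0 < p) :
    ENNReal.ofReal v * (volume {x | v < ‖f x‖}) ^ (1 / p) ≤ lorentz1 f p := by
  have := lor_piece f (u := 0) (v := v) hp
  rw [sub_zero] at this
  exact this.trans (lintegral_mono_set Ioc_subset_Ioi_self)

theorem lor_sum (f : EuclideanSpace ℝ (Fin d) → ℂ) {p s : ℝ} (hp : 0 < p) (hs : 0 < s) (K : ℕ) :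
    ∑ k ∈ Finset.range K, ENNReal.ofReal (2 ^ k * s) * (volume {x | 2 ^ k * s < ‖f x‖}) ^ (1 / p)
      ≤ 2 * lorentz1 f p := by
  have key : ∑ k ∈ Finset.range K, ENNReal.ofReal (2 ^ k * s) *
      (volume {x | 2 ^ k * s < ‖f x‖}) ^ (1 / p)
      ≤ 2 * ∫⁻ l in Ioc 0 (2 ^ K * s / 2), (volume {x | l < ‖f x‖}) ^ (1 / p) := by
    induction K with
    | zero => simp
    | succ K ih =>
      have hK : 0 < 2 ^ K * s := by positivity
      have e : (2:ℝ) ^ (K+1) * s / 2 = 2 ^ K * s := by rw [pow_succ]; ring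
      rw [Finset.sum_range_succ, e, ← Ioc_union_Ioc_eq_Ioc (b := 2 ^ K * s / 2) (by positivity) (by linarith),
        lintegral_union measurableSet_Ioc (by
          rw [Set.disjoint_left]; intro x hx hy; exact absurd hx.2 (not_le.2 hy.1)), mul_add]
      refine add_le_add ih ?_
      refine le_trans ?_ (mul_le_mul_right (lor_piece f hp) 2)
      rw [← mul_assoc]
      apply mul_le_mul_left
      have : (2:ℝ≥0∞) = ENNReal.ofReal 2 := by simp
      rw [this, ← ENNReal.ofReal_mul (by norm_num)]
      apply ENNReal.ofReal_le_ofReal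
      linarith
  exact key.trans (mul_le_mul_right (lintegral_mono_set Ioc_subset_Ioi_self) 2)

theorem level_fin (f : SchwartzMap (EuclideanSpace ℝ (Fin d)) ℂ) {s : ℝ} (hs : 0 < s) :
    volume {x | s < ‖f x‖} ≠ ∞ :=
  (f.integrable (μ := volume).measure_norm_gt_lt_top hs).ne

theorem piece_L1 {f g : EuclideanSpace ℝ (Fin d) → ℂ} (hf : Continuous f) {s A : ℝ} (hA : 0 ≤ A)
    (hfin : volume {x | s < ‖f x‖} ≠ ∞)
    (h1 : ∀ x, ‖g x‖ ≤ A) (h2 : ∀ x, g x ≠ 0 → s < ‖f x‖) :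
    ∫⁻ x, ‖g x‖ₑ ≤ ENNReal.ofReal (A * (volume {x | s < ‖f x‖}).toReal) := by
  have hm : MeasurableSet {x | s < ‖f x‖} := (isOpen_lt continuous_const hf.norm).measurableSet
  calc ∫⁻ x, ‖g x‖ₑ ≤ ∫⁻ x, ({x | s < ‖f x‖}).indicator (fun _ => ENNReal.ofReal A) x := by
        apply lintegral_mono
        intro x
        by_cases hx : g x = 0
        · simp [hx]
        · simp only; rw [indicator_of_mem (show x ∈ {x | s < ‖f x‖} from h2 x hx), ← ofReal_norm]
          exact ENNReal.ofReal_le_ofReal (h1 x)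
    _ = _ := by
        rw [lintegral_indicator_const hm, ENNReal.ofReal_mul hA, ENNReal.ofReal_toReal hfin]

theorem piece_L2 {f g : EuclideanSpace ℝ (Fin d) → ℂ} (hf : Continuous f) {s A : ℝ} (hA : 0 ≤ A)
    (hfin : volume {x | s < ‖f x‖} ≠ ∞)
    (h1 : ∀ x, ‖g x‖ ≤ A) (h2 : ∀ x, g x ≠ 0 → s < ‖f x‖) :
    (∫⁻ x, ‖g x‖ₑ ^ 2) ^ (1/2:ℝ) ≤
      ENNReal.ofReal (A * (volume {x | s < ‖f x‖}).toReal ^ (1/2:ℝ)) := by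
  have hm : MeasurableSet {x | s < ‖f x‖} := (isOpen_lt continuous_const hf.norm).measurableSet
  have : ∫⁻ x, ‖g x‖ₑ ^ 2 ≤ ENNReal.ofReal (A ^ 2 * (volume {x | s < ‖f x‖}).toReal) := by
    calc ∫⁻ x, ‖g x‖ₑ ^ 2 ≤ ∫⁻ x, ({x | s < ‖f x‖}).indicator (fun _ => ENNReal.ofReal (A^2)) x := by
          apply lintegral_mono
          intro x
          by_cases hx : g x = 0
          · simp [hx]
          · simp only
            rw [indicator_of_mem (show x ∈ {x | s < ‖f x‖} from h2 x hx), ← ofReal_norm, ENNReal.ofReal_pow hA]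
            exact pow_le_pow_left₀ (by positivity) (ENNReal.ofReal_le_ofReal (h1 x)) 2
      _ = _ := by
          rw [lintegral_indicator_const hm, ENNReal.ofReal_mul (by positivity),
            ENNReal.ofReal_toReal hfin]
  refine (ENNReal.rpow_le_rpow this (by norm_num)).trans ?_
  rw [ENNReal.ofReal_rpow_of_nonneg (by positivity) (by norm_num),
    Real.mul_rpow (by positivity) (by positivity), ← Real.sqrt_eq_rpow, Real.sqrt_sq hA]

theorem exp_one {δ a D Λ s : ℝ} (hδ : 0 ≤ δ) (ha : 1/2 < a) (hD : 0 < D) (hΛ : 0 < Λ) :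
    ((Λ ^ ((2*δ+2*a-1)/(δ+2*a-1)) * D) ^ (1/(2*δ+2*a-1))) ^ (-δ) * (s * D) =
      s * D ^ (1/((2*δ+2*a-1)/(δ+2*a-1))) * Λ ^ (1 - (2*δ+2*a-1)/(δ+2*a-1)) := by
  have hq : 0 < 2*δ+2*a-1 := by linarith
  have hq' : 0 < δ+2*a-1 := by linarith
  have hqn := hq.ne'
  have hqn' := hq'.ne'
  rw [← Real.rpow_mul (by positivity), Real.mul_rpow (by positivity) hD.le, ← Real.rpow_mul hΛ.le]
  have e1 : (2*δ+2*a-1)/(δ+2*a-1) * (1/(2*δ+2*a-1) * -δ) = 1 - (2*δ+2*a-1)/(δ+2*a-1) := by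
    obtain ⟨q, r, hqr, hr⟩ : ∃ q r : ℝ, q = 2*δ+2*a-1 ∧ r = δ+2*a-1 := ⟨_, _, rfl, rfl⟩
    rw [← hqr] at hqn; rw [← hr] at hqn'; rw [← hqr, ← hr]
    have h1 : δ = q - r := by rw [hqr, hr]; ring
    have h2 : a = r - q/2 + 1/2 := by rw [hqr, hr]; ring
    clear hqr hr hq hq' ; subst h1 h2; field_simp; ring
  have e2 : 1/((2*δ+2*a-1)/(δ+2*a-1)) = 1/(2*δ+2*a-1) * -δ + 1 := by
    obtain ⟨q, r, hqr, hr⟩ : ∃ q r : ℝ, q = 2*δ+2*a-1 ∧ r = δ+2*a-1 := ⟨_, _, rfl, rfl⟩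
    rw [← hqr] at hqn; rw [← hr] at hqn'; rw [← hqr, ← hr]
    have h1 : δ = q - r := by rw [hqr, hr]; ring
    have h2 : a = r - q/2 + 1/2 := by rw [hqr, hr]; ring
    clear hqr hr hq hq' ; subst h1 h2; field_simp; ring
  rw [e1, e2, Real.rpow_add_one hD.ne']
  ring

theorem exp_two {δ a D Λ s : ℝ} (hδ : 0 ≤ δ) (ha : 1/2 < a) (hD : 0 < D) (hΛ : 0 < Λ) :
    ((Λ ^ ((2*δ+2*a-1)/(δ+2*a-1)) * D) ^ (1/(2*δ+2*a-1))) ^ (a - 1/2) * (s * D^(1/2:ℝ)) =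
      s * D ^ (1/((2*δ+2*a-1)/(δ+2*a-1))) * Λ ^ (1 - (2*δ+2*a-1)/(δ+2*a-1)/2) := by
  have hq : 0 < 2*δ+2*a-1 := by linarith
  have hq' : 0 < δ+2*a-1 := by linarith
  have hqn := hq.ne'
  have hqn' := hq'.ne'
  rw [← Real.rpow_mul (by positivity), Real.mul_rpow (by positivity) hD.le, ← Real.rpow_mul hΛ.le]
  have e1 : (2*δ+2*a-1)/(δ+2*a-1) * (1/(2*δ+2*a-1) * (a-1/2)) = 1 - (2*δ+2*a-1)/(δ+2*a-1)/2 := by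
    obtain ⟨q, r, hqr, hr⟩ : ∃ q r : ℝ, q = 2*δ+2*a-1 ∧ r = δ+2*a-1 := ⟨_, _, rfl, rfl⟩
    rw [← hqr] at hqn; rw [← hr] at hqn'; rw [← hqr, ← hr]
    have h1 : δ = q - r := by rw [hqr, hr]; ring
    have h2 : a = r - q/2 + 1/2 := by rw [hqr, hr]; ring
    clear hqr hr hq hq' ; subst h1 h2; field_simp; ring
  have e2 : 1/((2*δ+2*a-1)/(δ+2*a-1)) = 1/(2*δ+2*a-1) * (a-1/2) + 1/2 := by
    obtain ⟨q, r, hqr, hr⟩ : ∃ q r : ℝ, q = 2*δ+2*a-1 ∧ r = δ+2*a-1 := ⟨_, _, rfl, rfl⟩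
    rw [← hqr] at hqn; rw [← hr] at hqn'; rw [← hqr, ← hr]
    have h1 : δ = q - r := by rw [hqr, hr]; ring
    have h2 : a = r - q/2 + 1/2 := by rw [hqr, hr]; ring
    clear hqr hr hq hq' ; subst h1 h2; field_simp; ring
  rw [e1, e2, Real.rpow_add hD]
  ring

/-- choice of the scale parameter -/
theorem exists_eps {δ a D Λ : ℝ} (hδ : 0 ≤ δ) (ha : 1/2 < a) (hD : 0 ≤ D) (hΛ : 0 < Λ)
    (h : Λ ^ ((2*δ+2*a-1)/(δ+2*a-1)) * D ≤ 1) :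
    ∃ ε : ℝ, 0 < ε ∧ ε ≤ 1 ∧ ∀ s : ℝ,
      ε ^ (-δ) * (s * D) = s * D ^ (1/((2*δ+2*a-1)/(δ+2*a-1))) * Λ ^ (1 - (2*δ+2*a-1)/(δ+2*a-1)) ∧
      ε ^ (a-1/2) * (s * D^(1/2:ℝ)) =
        s * D ^ (1/((2*δ+2*a-1)/(δ+2*a-1))) * Λ ^ (1 - (2*δ+2*a-1)/(δ+2*a-1)/2) := by
  have hq : 0 < 2*δ+2*a-1 := by linarith
  have hq' : 0 < δ+2*a-1 := by linarith
  rcases hD.eq_or_lt with h0 | h0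
  · refine ⟨1, one_pos, le_rfl, fun s => ?_⟩
    rw [← h0, Real.zero_rpow (by positivity), Real.zero_rpow (by positivity)]
    simp
  · exact ⟨_, by positivity, Real.rpow_le_one (by positivity) h (by positivity), fun s =>
      ⟨exp_one hδ ha h0 hΛ, exp_two hδ ha h0 hΛ⟩⟩

theorem convM_int (μ : Measure (EuclideanSpace ℝ (Fin d))) [IsFiniteMeasure μ]
    (f : SchwartzMap (EuclideanSpace ℝ (Fin d)) ℂ) (t : ℝ) (x : EuclideanSpace ℝ (Fin d)) :
    Integrable (fun y => f (x - t • y)) μ := by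
  obtain ⟨C, hC⟩ := f.decay 0 0
  apply Integrable.of_bound (C := C) (Continuous.aestronglyMeasurable
    (f.continuous.comp (by fun_prop)))
  filter_upwards with y
  simpa using hC.2 (x - t • y)

theorem convM_split (μ : Measure (EuclideanSpace ℝ (Fin d))) [IsFiniteMeasure μ]
    (f fl : SchwartzMap (EuclideanSpace ℝ (Fin d)) ℂ) (K : ℕ)
    (fk : ℕ → SchwartzMap (EuclideanSpace ℝ (Fin d)) ℂ)
    (h : f = fl + ∑ k ∈ Finset.range K, fk k) (t : ℝ) (x : EuclideanSpace ℝ (Fin d)) :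
    convM f μ t x = convM fl μ t x + ∑ k ∈ Finset.range K, convM (fk k) μ t x := by
  unfold convM
  rw [← integral_finsetSum _ (fun k _ => convM_int μ (fk k) t x),
    ← integral_add (convM_int μ fl t x) (integrable_finsetSum _ fun k _ => convM_int μ (fk k) t x)]
  congr 1
  ext y
  rw [h, SchwartzMap.add_apply, SchwartzMap.sum_apply]

theorem convM_low (μ : Measure (EuclideanSpace ℝ (Fin d))) [IsFiniteMeasure μ]
    (f : SchwartzMap (EuclideanSpace ℝ (Fin d)) ℂ) {A : ℝ} (h : ∀ x, ‖f x‖ ≤ A)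
    (t : ℝ) (x : EuclideanSpace ℝ (Fin d)) :
    ‖convM f μ t x‖ ≤ A * μ.real univ :=
  norm_integral_le_of_norm_le_const (Filter.Eventually.of_forall fun y => h _)

/-- decomposition data adapted to a height, with all estimates -/
theorem pieces {δ a p : ℝ} (hδ : 0 ≤ δ) (ha : 1/2 < a) (hp : p = (2*δ+2*a-1)/(δ+2*a-1))
    (f : SchwartzMap (EuclideanSpace ℝ (Fin d)) ℂ) {s0 L : ℝ} (hs0 : 0 < s0) (hL : 0 < L)
    (hlor : lorentz1 f p ≤ ENNReal.ofReal L) :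
    ∃ (K : ℕ) (fk : ℕ → SchwartzMap (EuclideanSpace ℝ (Fin d)) ℂ)
      (fl : SchwartzMap (EuclideanSpace ℝ (Fin d)) ℂ) (ε : ℕ → ℝ),
      f = fl + ∑ k ∈ Finset.range K, fk k ∧ (∀ x, ‖fl x‖ ≤ 2*s0) ∧
      (∀ k, 0 < ε k ∧ ε k ≤ 1) ∧
      ∑ k ∈ Finset.range K, ENNReal.ofReal (ε k ^ (-δ)) * ∫⁻ x, ‖fk k x‖ₑ ≤
        ENNReal.ofReal (8 * L * (s0/L) ^ (1-p)) ∧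
      ∑ k ∈ Finset.range K, ENNReal.ofReal (ε k ^ (a-1/2)) * (∫⁻ x, ‖fk k x‖ₑ^2)^(1/2:ℝ) ≤
        ENNReal.ofReal (8 * L * (s0/L) ^ (1-p/2)) := by
  have hq : 0 < 2*δ+2*a-1 := by linarith
  have hq' : 0 < δ+2*a-1 := by linarith
  have hp0 : 0 < p := by rw [hp]; positivity
  obtain ⟨K, fk, fl, hf, hfl, hfk1, hfk2⟩ := decomp f hs0
  have hΛ : 0 < s0 / L := by positivity
  set D : ℕ → ℝ := fun k => (volume {x | 2^k*s0 < ‖f x‖}).toReal with hDdef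
  have hfin : ∀ k : ℕ, volume {x | 2^k*s0 < ‖f x‖} ≠ ∞ := fun k => level_fin f (by positivity)
  have hvol : ∀ k, volume {x | 2^k*s0 < ‖f x‖} = ENNReal.ofReal (D k) := fun k =>
    (ENNReal.ofReal_toReal (hfin k)).symm
  have hD0 : ∀ k, 0 ≤ D k := fun k => ENNReal.toReal_nonneg
  have hle : ∀ k, (s0/L)^p * D k ≤ 1 := by
    intro k
    have h1 := (lor_first f (v := s0) hp0).trans hlor
    have h2 : volume {x | 2^k*s0 < ‖f x‖} ≤ volume {x | s0 < ‖f x‖} := by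
      apply measure_mono
      intro x hx
      refine lt_of_le_of_lt ?_ (show 2^k*s0 < ‖f x‖ from hx)
      have : (1:ℝ) ≤ 2^k := one_le_pow₀ (by norm_num)
      nlinarith
    have h3 : ENNReal.ofReal s0 * (ENNReal.ofReal (D k)) ^ (1/p) ≤ ENNReal.ofReal L := by
      rw [← hvol]
      exact (mul_le_mul_right (ENNReal.rpow_le_rpow h2 (by positivity)) _).trans h1
    rw [ENNReal.ofReal_rpow_of_nonneg (hD0 k) (by positivity), ← ENNReal.ofReal_mul hs0.le,
      ENNReal.ofReal_le_ofReal_iff hL.le] at h3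
    have h4 : s0 / L * D k ^ (1/p) ≤ 1 := by
      rw [div_mul_eq_mul_div, div_le_one hL]; exact h3
    have h5 := Real.rpow_le_one (mul_nonneg hΛ.le (Real.rpow_nonneg (hD0 k) _)) h4 hp0.le
    rwa [Real.mul_rpow hΛ.le (Real.rpow_nonneg (hD0 k) _), ← Real.rpow_mul (hD0 k),
      one_div_mul_cancel hp0.ne', Real.rpow_one] at h5
  have hsum : ∑ k ∈ Finset.range K, (2^k*s0) * D k ^ (1/p) ≤ 2 * L := by
    have h1 := (lor_sum f hp0 hs0 K).trans (mul_le_mul_right hlor 2)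
    have e2 : (2:ℝ≥0∞) = ENNReal.ofReal 2 := by simp
    have e3 : 2 * ENNReal.ofReal L = ENNReal.ofReal (2 * L) := by
      rw [ENNReal.ofReal_mul (by norm_num), ← e2]
    rw [e3] at h1
    rw [← ENNReal.ofReal_le_ofReal_iff (by positivity), ENNReal.ofReal_sum_of_nonneg
      (fun k _ => mul_nonneg (by positivity) (Real.rpow_nonneg (hD0 k) _))]
    refine le_trans (le_of_eq (Finset.sum_congr rfl fun k _ => ?_)) h1
    rw [ENNReal.ofReal_mul (by positivity), hvol,
      ENNReal.ofReal_rpow_of_nonneg (hD0 k) (by positivity)]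
  have hle' := hle
  rw [hp] at hle'
  choose ε he0 he1 he using fun k => exists_eps hδ ha (hD0 k) hΛ (hle' k)
  rw [← hp] at he
  have gen : ∀ (A : ℕ → ℝ≥0∞) (M : ℝ), 0 ≤ M →
      (∀ k, A k ≤ ENNReal.ofReal (4 * ((2^k*s0) * D k ^ (1/p)) * M)) →
      ∑ k ∈ Finset.range K, A k ≤ ENNReal.ofReal (8 * L * M) := by
    intro A M hM hA
    refine (Finset.sum_le_sum fun k _ => hA k).trans ?_
    rw [← ENNReal.ofReal_sum_of_nonneg (fun k _ => mul_nonneg (mul_nonneg (by norm_num)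
      (mul_nonneg (by positivity) (Real.rpow_nonneg (hD0 k) _))) hM)]
    apply ENNReal.ofReal_le_ofReal
    rw [← Finset.sum_mul, ← Finset.mul_sum]
    nlinarith
  refine ⟨K, fk, fl, ε, hf, hfl, fun k => ⟨he0 k, he1 k⟩, ?_, ?_⟩
  · apply gen _ _ (by positivity)
    intro k
    refine (mul_le_mul_right (piece_L1 f.continuous (by positivity) (hfin k) (hfk1 k) (hfk2 k)) _).trans ?_
    rw [← ENNReal.ofReal_mul (Real.rpow_nonneg (he0 k).le _)]
    apply ENNReal.ofReal_le_ofReal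
    change ε k ^ (-δ) * (4 * (2^k*s0) * D k) ≤ _
    rw [(he k (4 * (2^k*s0))).1]
    exact le_of_eq (by ring)
  · apply gen _ _ (by positivity)
    intro k
    refine (mul_le_mul_right (piece_L2 f.continuous (by positivity) (hfin k) (hfk1 k) (hfk2 k)) _).trans ?_
    rw [← ENNReal.ofReal_mul (Real.rpow_nonneg (he0 k).le _)]
    apply ENNReal.ofReal_le_ofReal
    change ε k ^ (a-1/2) * (4 * (2^k*s0) * D k ^ (1/2:ℝ)) ≤ _
    rw [(he k (4 * (2^k*s0))).2]
    exact le_of_eq (by ring)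

theorem cheb2 {H : EuclideanSpace ℝ (Fin d) → ℝ≥0∞} (hH : Measurable H) {l B : ℝ} (hl : 0 < l)
    (hB : 0 ≤ B) (h : eLpNorm H 2 volume ≤ ENNReal.ofReal B) :
    volume {x | ENNReal.ofReal l ≤ H x} ≤ ENNReal.ofReal (B^2 / l^2) := by
  have h1 : ∫⁻ x, H x ^ 2 ≤ ENNReal.ofReal (B^2) := by
    rw [eL2_eq] at h
    have := ENNReal.rpow_le_rpow h (z := 2) (by norm_num)
    rw [← ENNReal.rpow_mul] at this
    norm_num at this
    rwa [← ENNReal.ofReal_pow hB] at this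
  have h2 := mul_meas_ge_le_lintegral (μ := volume) (hH.pow_const 2) (ENNReal.ofReal (l^2))
  rw [ENNReal.ofReal_div_of_pos (by positivity), ENNReal.le_div_iff_mul_le
    (Or.inl (by simp; positivity)) (Or.inl ENNReal.ofReal_ne_top), mul_comm]
  refine le_trans ?_ (h2.trans h1)
  apply mul_le_mul_right
  apply measure_mono
  intro x hx
  change ENNReal.ofReal (l^2) ≤ H x ^ 2
  rw [ENNReal.ofReal_pow hl.le]
  exact pow_le_pow_left₀ (by positivity) hx 2

theorem core (hd : 1 ≤ d) (μ : Measure (EuclideanSpace ℝ (Fin d)))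
    [IsFiniteMeasure μ] {R a b C : ℝ} (hR0 : 0 < R) (hR : μ (closedBall 0 R)ᶜ = 0)
    (ha : 1/2 < a) (hb2 : b ≤ d)
    (hdecay : ∀ ξ : EuclideanSpace ℝ (Fin d), ξ ≠ 0 → ‖mFT μ ξ‖ ≤ C * ‖ξ‖ ^ (-a))
    (hfrostman : ∀ (x : EuclideanSpace ℝ (Fin d)) (r : ℝ), 0 < r →
      μ (ball x r) ≤ ENNReal.ofReal (C * r ^ b)) {p : ℝ}
    (hp : p = (2*((d:ℝ)-b)+2*a-1)/((d:ℝ)-b+2*a-1)) :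
    ∃ Q : ℝ, 0 < Q ∧ ∀ (f : SchwartzMap (EuclideanSpace ℝ (Fin d)) ℂ) (l L : ℝ), 0 < l → 0 < L →
      lorentz1 f p ≤ ENNReal.ofReal L →
      volume {x | ENNReal.ofReal l < Mmax μ f x} ≤ ENNReal.ofReal (Q * (L/l)^p) := by
  obtain ⟨K2, hK2, hsplit⟩ := split_L2 μ hR0 hR ha hdecay
  obtain ⟨K1, hK1, hlow⟩ := low_bound μ hR0 hR hb2 hfrostman
  obtain ⟨V, hV, hHL⟩ := HL_weak hd
  set c : ℝ := 1 / (4 * (μ.real univ + 1)) with hc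
  have hmu : 0 ≤ μ.real univ := measureReal_nonneg
  have hc0 : 0 < c := by positivity
  refine ⟨32 * V * K1 * c^(1-p) + 1024 * K2^2 * c^(2-p), by positivity, ?_⟩
  intro f l L hl hL hlor
  have hs0 : 0 < c * l := by positivity
  obtain ⟨K, fk, fl, ε, hf, hfl, hε, hS1, hS2⟩ := pieces (sub_nonneg.2 hb2) ha hp f hs0 hL hlor
  choose H hHm hH1 hH2 using fun k => hsplit (ε k) (hε k).1 (hε k).2 (fk k)
  set h : EuclideanSpace ℝ (Fin d) → ℝ≥0∞ := fun y =>
    ∑ k ∈ Finset.range K, ENNReal.ofReal (ε k ^ (-((d:ℝ)-b))) * ‖fk k y‖ₑ with hh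
  have hmk : ∀ k, Measurable fun y => ‖fk k y‖ₑ := fun k => (fk k).continuous.enorm.measurable
  have hint : ∫⁻ x, h x ≤ ENNReal.ofReal (8 * L * (c*l/L) ^ (1-p)) := by
    rw [hh, lintegral_finsetSum _ (fun k _ => (hmk k).const_mul _)]
    refine le_trans (le_of_eq (Finset.sum_congr rfl fun k _ => ?_)) hS1
    rw [lintegral_const_mul _ (hmk k)]
  set Λ : ℝ := l / (4 * K1) with hΛ
  have hΛ0 : 0 < Λ := by positivity
  have hbad := (hHL h Λ hΛ0 (ne_top_of_le_ne_top ENNReal.ofReal_ne_top hint)).trans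
    (mul_le_mul_right hint _)
  set G : EuclideanSpace ℝ (Fin d) → ℝ≥0∞ := ∑ k ∈ Finset.range K, H k with hG
  have hGm : Measurable G := by
    have := Finset.measurable_fun_sum (Finset.range K) (f := H) fun k _ => hHm k
    convert this using 1
    ext x; rw [hG, Finset.sum_apply]
  have hG2 : eLpNorm G 2 volume ≤ ENNReal.ofReal (K2 * (8 * L * (c*l/L) ^ (1-p/2))) := by
    refine (eLpNorm_sum_le (fun k _ => (hHm k).aestronglyMeasurable) (by norm_num)).trans ?_
    refine (Finset.sum_le_sum fun k _ => hH2 k).trans ?_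
    rw [ENNReal.ofReal_mul hK2.le]
    refine le_trans (le_of_eq ?_) (mul_le_mul_right hS2 _)
    rw [Finset.mul_sum]
    refine Finset.sum_congr rfl fun k _ => ?_
    rw [ENNReal.ofReal_mul hK2.le, mul_assoc]
  have hcheb := cheb2 hGm (l := l/4) (by positivity) (by positivity) hG2
  have hincl : {x | ENNReal.ofReal l < Mmax μ f x} ⊆
      {x | ∃ r:ℝ, 0<r ∧ ENNReal.ofReal Λ * ENNReal.ofReal (r^d) < ∫⁻ y in ball x r, h y} ∪
      {x | ENNReal.ofReal (l/4) ≤ G x} := by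
    intro x hx
    by_contra hn
    rw [mem_union, not_or] at hn
    obtain ⟨hn1, hn2⟩ := hn
    have hn1 : ∀ r:ℝ, 0<r → ∫⁻ y in ball x r, h y ≤ ENNReal.ofReal Λ * ENNReal.ofReal (r^d) := by
      intro r hr
      by_contra h'
      exact hn1 ⟨r, hr, not_le.1 h'⟩
    have hn2 : G x < ENNReal.ofReal (l/4) := not_le.1 hn2
    obtain ⟨⟨t, ht⟩, hlt⟩ := lt_iSup_iff.1 (show ENNReal.ofReal l < Mmax μ f x from hx)
    have hlt : ENNReal.ofReal l < ‖convM f μ t x‖ₑ := hlt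
    have hA := hlow (Finset.range K) ε fk hε (ENNReal.ofReal Λ) x hn1 t ht
    rw [← ENNReal.ofReal_mul hK1.le, show K1 * Λ = l/4 by rw [hΛ]; field_simp] at hA
    have hB : ‖convM fl μ t x‖ₑ ≤ ENNReal.ofReal (l/2) := by
      rw [← ofReal_norm]
      apply ENNReal.ofReal_le_ofReal
      refine (convM_low μ fl hfl t x).trans ?_
      have : c * (μ.real univ + 1) = 1/4 := by rw [hc]; field_simp
      nlinarith
    have hC : ∑ k ∈ Finset.range K, ‖convM (fk k) μ t x‖ₑ ≤
        ∑ k ∈ Finset.range K, ‖Fop (mA μ (ε k)) (fk k) t x‖ₑ + G x := by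
      rw [hG, Finset.sum_apply, ← Finset.sum_add_distrib]
      exact Finset.sum_le_sum fun k _ => hH1 k t ht x
    have : ‖convM f μ t x‖ₑ < ENNReal.ofReal l := by
      rw [convM_split μ f fl K fk hf t x]
      calc _ ≤ ‖convM fl μ t x‖ₑ + ‖∑ k ∈ Finset.range K, convM (fk k) μ t x‖ₑ := enorm_add_le _ _
        _ ≤ ENNReal.ofReal (l/2) + (ENNReal.ofReal (l/4) + G x) := by
            refine add_le_add hB ((enorm_sum_le _ _).trans (hC.trans (add_le_add hA le_rfl)))
        _ < ENNReal.ofReal (l/2) + (ENNReal.ofReal (l/4) + ENNReal.ofReal (l/4)) :=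
            ENNReal.add_lt_add_left ENNReal.ofReal_ne_top
              (ENNReal.add_lt_add_left ENNReal.ofReal_ne_top hn2)
        _ = ENNReal.ofReal l := by
            rw [← ENNReal.ofReal_add (by positivity) (by positivity),
              ← ENNReal.ofReal_add (by positivity) (by positivity)]
            congr 1; ring
    exact absurd hlt (not_lt.2 this.le)
  refine (measure_mono hincl).trans ((measure_union_le _ _).trans ?_)
  have hbad2 : volume {x | ∃ r:ℝ, 0<r ∧
      ENNReal.ofReal Λ * ENNReal.ofReal (r^d) < ∫⁻ y in ball x r, h y} ≤
      ENNReal.ofReal (V * (8 * L * (c*l/L) ^ (1-p)) / Λ) := by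
    rw [ENNReal.ofReal_div_of_pos hΛ0, ENNReal.le_div_iff_mul_le
      (Or.inl (by simp; positivity)) (Or.inl ENNReal.ofReal_ne_top), mul_comm,
      ENNReal.ofReal_mul hV.le]
    exact hbad
  refine (add_le_add hbad2 hcheb).trans ?_
  rw [← ENNReal.ofReal_add (by positivity) (by positivity)]
  apply ENNReal.ofReal_le_ofReal
  apply le_of_eq
  have hx : 0 < L / l := by positivity
  have e0 : c * l / L = c * (L/l)⁻¹ := by field_simp
  have e1 : (c*l/L)^(1-p) = c^(1-p) * ((L/l)^p / (L/l)) := by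
    rw [e0, Real.mul_rpow hc0.le (by positivity), Real.inv_rpow hx.le, ← Real.rpow_neg hx.le,
      neg_sub, Real.rpow_sub_one hx.ne']
  have e2 : ((c*l/L)^(1-p/2))^2 = c^(2-p) * ((L/l)^p / (L/l)^2) := by
    rw [← Real.rpow_natCast, ← Real.rpow_mul (by positivity), e0,
      Real.mul_rpow hc0.le (by positivity), Real.inv_rpow hx.le, ← Real.rpow_neg hx.le]
    rw [show (1-p/2) * ((2:ℕ):ℝ) = 2 - p by push_cast; ring, neg_sub, Real.rpow_sub hx]
    norm_num
  rw [e1, show (K2 * (8 * L * (c*l/L) ^ (1-p/2)))^2 = K2^2 * 64 * L^2 * ((c*l/L)^(1-p/2))^2 by ring, e2, hΛ]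
  generalize (L/l)^p = Y
  field_simp
  ring

/-- Under Fourier decay of order a > 1/2 and the Frostman condition of order b with
d−1 < b ≤ d, the restricted weak-type endpoint estimate
‖M_μ f‖_{L^{p_{(a,b)},∞}} ≤ C'‖f‖_{L^{p_{(a,b)},1}} holds,
where p_{(a,b)} = (2(d−b)+2a−1)/(d−b+2a−1). -/
theorem stmt3 (d : ℕ) (hd : 1 ≤ d) (μ : Measure (EuclideanSpace ℝ (Fin d)))
    [IsFiniteMeasure μ] (hcomp : ∃ K : Set (EuclideanSpace ℝ (Fin d)), IsCompact K ∧ μ Kᶜ = 0)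
    (a b C : ℝ) (ha : 1/2 < a) (hb1 : (d:ℝ) - 1 < b) (hb2 : b ≤ d)
    (hdecay : ∀ ξ : EuclideanSpace ℝ (Fin d), ξ ≠ 0 → ‖mFT μ ξ‖ ≤ C * ‖ξ‖ ^ (-a))
    (hfrostman : ∀ (x : EuclideanSpace ℝ (Fin d)) (r : ℝ), 0 < r →
      μ (ball x r) ≤ ENNReal.ofReal (C * r ^ b)) :
    ∃ C' : ℝ, 0 < C' ∧ ∀ f : SchwartzMap (EuclideanSpace ℝ (Fin d)) ℂ,
      wlpE (Mmax μ ⇑f) ((2*((d:ℝ)-b)+2*a-1)/((d:ℝ)-b+2*a-1)) ≤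
        ENNReal.ofReal C' * lorentz1 (⇑f) ((2*((d:ℝ)-b)+2*a-1)/((d:ℝ)-b+2*a-1)) := by
  obtain ⟨K, hK, hK0⟩ := hcomp
  obtain ⟨R, hR0, hKR⟩ := hK.isBounded.subset_closedBall_lt 0 0
  have hR : μ (closedBall 0 R)ᶜ = 0 := measure_mono_null (compl_subset_compl.2 hKR) hK0
  obtain ⟨p, hp⟩ : ∃ p : ℝ, p = (2*((d:ℝ)-b)+2*a-1)/((d:ℝ)-b+2*a-1) := ⟨_, rfl⟩
  obtain ⟨Q, hQ, hcore⟩ := core hd μ hR0 hR ha hb2 hdecay hfrostman hp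
  rw [← hp]
  have hp0 : 0 < p := by
    have h1 : 0 < 2*((d:ℝ)-b)+2*a-1 := by linarith
    have h2 : 0 < (d:ℝ)-b+2*a-1 := by linarith
    rw [hp]; positivity
  refine ⟨Q^(1/p), by positivity, fun f => ?_⟩
  rcases eq_or_ne (lorentz1 f p) ∞ with htop | htop
  · rw [htop, ENNReal.mul_top (by simp; positivity)]
    exact le_top
  apply iSup_le
  intro l
  rcases eq_or_ne l 0 with h0 | h0
  · simp [h0]
  have hl : 0 < (l:ℝ) := by positivity
  have key : ∀ η : ℝ, 0 < η → (l : ℝ≥0∞) * (volume {x | (l : ℝ≥0∞) < Mmax μ f x}) ^ (1 / p) ≤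
      ENNReal.ofReal (Q^(1/p)) * (lorentz1 f p + ENNReal.ofReal η) := by
    intro η hη
    have hL : 0 < (lorentz1 f p).toReal + η := by positivity
    have e : lorentz1 f p + ENNReal.ofReal η = ENNReal.ofReal ((lorentz1 f p).toReal + η) := by
      rw [ENNReal.ofReal_add ENNReal.toReal_nonneg hη.le, ENNReal.ofReal_toReal htop]
    have h1 := hcore f l _ hl hL (by rw [← e]; exact le_self_add)
    rw [e]
    generalize (lorentz1 f p).toReal + η = L at hL h1
    rw [ENNReal.ofReal_coe_nnreal] at h1
    refine (mul_le_mul_right (ENNReal.rpow_le_rpow h1 (by positivity)) _).trans ?_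
    rw [ENNReal.ofReal_rpow_of_nonneg (by positivity) (by positivity),
      ← ENNReal.ofReal_coe_nnreal, ← ENNReal.ofReal_mul hl.le,
      ← ENNReal.ofReal_mul (by positivity)]
    apply ENNReal.ofReal_le_ofReal
    rw [Real.mul_rpow hQ.le (by positivity), ← Real.rpow_mul (by positivity),
      mul_one_div_cancel hp0.ne', Real.rpow_one]
    apply le_of_eq
    field_simp
  have hlim : Filter.Tendsto (fun η : ℝ => ENNReal.ofReal (Q^(1/p)) *
      (lorentz1 f p + ENNReal.ofReal η)) (nhdsWithin 0 (Ioi 0))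
      (nhds (ENNReal.ofReal (Q^(1/p)) * (lorentz1 f p + ENNReal.ofReal 0))) := by
    apply ENNReal.Tendsto.const_mul _ (Or.inr ENNReal.ofReal_ne_top)
    apply Filter.Tendsto.const_add
    exact (ENNReal.continuous_ofReal.tendsto 0).mono_left nhdsWithin_le_nhds
  rw [ENNReal.ofReal_zero, add_zero] at hlim
  exact ge_of_tendsto hlim (by filter_upwards [self_mem_nhdsWithin] with η hη using key η hη)
end
end

section
/- Let μ be a finite Borel measure on ℝ^d supported in the ball B(2^{-1}e_1, 2^{-2}) and satisfying |μ̂(ξ)| ≤ C|ξ|^{−a} for all ξ ≠ 0, where a > 1/2. Then there is a constant C', independent of j and of the atom, such that for every integer j ≥ 1 and every H^1-atom 𝔞 — that is, every measurable function 𝔞 : ℝ^d → ℂ supported in some ball B ⊂ ℝ^d with ‖𝔞‖_{L^∞(ℝ^d)} ≤ |B|^{−1} and ∫_{ℝ^d} 𝔞(x) dx = 0 — one has ‖T_j^* 𝔞‖_{L^1(ℝ^d)} ≤ C' 2^j. -/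
open MeasureTheory Real Set Metric FourierTransform
open scoped ENNReal NNReal RealInnerProductSpace

noncomputable section

variable {d : ℕ}

/-- The model integrable weight. -/
def Jw (v : EuclideanSpace ℝ (Fin d)) : ℝ := ((1 + ‖v‖) ^ (d + 1))⁻¹

lemma Jw_pos (v : EuclideanSpace ℝ (Fin d)) : 0 < Jw v := by unfold Jw; positivity

lemma Jw_cont : Continuous (Jw (d := d)) := by
  unfold Jw
  refine Continuous.inv₀ (by fun_prop) (fun x => by positivity)

lemma Jw_int : Integrable (Jw (d := d)) := by
  have h := integrable_one_add_norm (E := EuclideanSpace ℝ (Fin d)) (μ := volume)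
    (r := ((d + 1 : ℕ) : ℝ)) (by simp)
  refine h.congr (Filter.Eventually.of_forall fun x => ?_)
  simp only [Jw]
  rw [Real.rpow_neg (by positivity), Real.rpow_natCast]

lemma Jw_scale_int (s : ℝ) (hs : 0 < s) (u : EuclideanSpace ℝ (Fin d)) :
    Integrable (fun w => Jw (s⁻¹ • (u - w))) := by
  have h1 := (Jw_int (d := d)).comp_smul (inv_ne_zero hs.ne')
  exact h1.comp_sub_left u

lemma Jw_scale (s : ℝ) (hs : 0 < s) (u : EuclideanSpace ℝ (Fin d)) :
    ∫ w, Jw (s⁻¹ • (u - w)) = s ^ d * ∫ v, Jw (d := d) v := by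
  rw [integral_sub_left_eq_self (fun w => Jw (s⁻¹ • w)) volume u,
    Measure.integral_comp_inv_smul_of_nonneg _ _ hs.le]
  simp

lemma Jw_lint (σ : ℝ) (hσ : 0 < σ) (p : EuclideanSpace ℝ (Fin d)) :
    ∫⁻ x, ENNReal.ofReal (((σ + ‖p - x‖) ^ (d + 1))⁻¹) =
      ENNReal.ofReal (σ⁻¹ * ∫ v, Jw (d := d) v) := by
  have key : ∀ x, ((σ + ‖p - x‖) ^ (d + 1))⁻¹ = (σ ^ (d + 1))⁻¹ * Jw (σ⁻¹ • (p - x)) := by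
    intro x
    unfold Jw
    rw [norm_smul, norm_inv, Real.norm_of_nonneg hσ.le, ← mul_inv, ← mul_pow, mul_add,
      mul_inv_cancel_left₀ hσ.ne', mul_one]
  simp_rw [key]
  rw [← ofReal_integral_eq_lintegral_ofReal ((Jw_scale_int σ hσ p).const_mul _)
    (Filter.Eventually.of_forall fun x => by
      have := Jw_pos (σ⁻¹ • (p - x)); simp only [Pi.zero_apply]; positivity),
    integral_const_mul, Jw_scale σ hσ]
  congr 1
  field_simp
  ring

lemma t_lint (c r : ℝ) (hc : 0 < c) (hr : 0 < r) :
    ∫⁻ t in Ioi (0:ℝ), ENNReal.ofReal (((c * t + r) ^ 2)⁻¹) = ENNReal.ofReal (c⁻¹ * r⁻¹) := by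
  have hd : ∀ x ∈ Ici (0:ℝ), HasDerivAt (fun t => - (c⁻¹ * (c * t + r)⁻¹))
      (((c * x + r) ^ 2)⁻¹) x := by
    intro x hx
    have hx : 0 ≤ x := hx
    have h0 : c * x + r ≠ 0 := by positivity
    have h1 : HasDerivAt (fun t => c * t + r) c x := by
      simpa using ((hasDerivAt_id x).const_mul c).add_const r
    have e : ((c * x + r) ^ 2)⁻¹ = -(c⁻¹ * (-c / (c * x + r) ^ 2)) := by field_simp
    rw [e]
    exact ((h1.inv h0).const_mul c⁻¹).neg
  have hpos : ∀ x ∈ Ioi (0:ℝ), 0 ≤ ((c * x + r) ^ 2)⁻¹ := fun x hx => by positivity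
  have hlim : Filter.Tendsto (fun t => - (c⁻¹ * (c * t + r)⁻¹)) Filter.atTop (nhds 0) := by
    have h1 : Filter.Tendsto (fun t : ℝ => c * t + r) Filter.atTop Filter.atTop :=
      Filter.tendsto_atTop_add_const_right _ _ (Filter.tendsto_id.const_mul_atTop hc)
    simpa using (h1.inv_tendsto_atTop.const_mul c⁻¹).neg
  have h1 := integral_Ioi_of_hasDerivAt_of_nonneg' hd hpos hlim
  have h2 := integrableOn_Ioi_deriv_of_nonneg' hd hpos hlim
  rw [← ofReal_integral_eq_lintegral_ofReal h2
    ((ae_restrict_iff' measurableSet_Ioi).2 (Filter.Eventually.of_forall hpos)), h1]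
  simp

lemma schwartz_bounds (Ψ : SchwartzMap (EuclideanSpace ℝ (Fin d)) ℂ) :
    ∃ A : ℝ, 0 < A ∧ (∀ u, ‖Ψ u‖ ≤ A * (Jw u * Jw u)) ∧
      ∀ p q, ‖q - p‖ ≤ 1 → ‖Ψ q - Ψ p‖ ≤ A * ‖q - p‖ * Jw p := by
  obtain ⟨A0, hA0⟩ : ∃ A0, ∀ u, (1 + ‖u‖) ^ (2 * (d + 1)) * ‖Ψ u‖ ≤ A0 := by
    have := fun u => SchwartzMap.one_add_le_sup_seminorm_apply (𝕜 := ℝ) (m := (2 * (d + 1), 0))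
      (k := 2 * (d + 1)) (n := 0) le_rfl le_rfl Ψ u
    simp only [norm_iteratedFDeriv_zero] at this
    exact ⟨_, this⟩
  obtain ⟨A1, hA1⟩ : ∃ A1, ∀ u, (1 + ‖u‖) ^ (d + 1) * ‖fderiv ℝ Ψ u‖ ≤ A1 := by
    have := fun u => SchwartzMap.one_add_le_sup_seminorm_apply (𝕜 := ℝ) (m := (d + 1, 1))
      (k := d + 1) (n := 1) le_rfl le_rfl Ψ u
    simp only [norm_iteratedFDeriv_one] at this
    exact ⟨_, this⟩
  have hA0' : 0 ≤ A0 := le_trans (by positivity) (hA0 0)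
  have hA1' : 0 ≤ A1 := le_trans (by positivity) (hA1 0)
  refine ⟨A0 + 2 ^ (d + 1) * A1 + 1, by positivity, fun u => ?_, fun p q hpq => ?_⟩
  · have h : ‖Ψ u‖ ≤ A0 * (Jw u * Jw u) := by
      unfold Jw
      rw [← mul_inv, ← pow_add, ← two_mul, ← div_eq_mul_inv, le_div_iff₀ (by positivity), mul_comm]
      exact hA0 u
    refine h.trans ?_
    have := Jw_pos u
    gcongr
    have : 0 ≤ 2 ^ (d + 1) * A1 := by positivity
    linarith
  · have h : ‖Ψ q - Ψ p‖ ≤ (2 ^ (d + 1) * A1 * Jw p) * ‖q - p‖ := by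
      refine (convex_closedBall p 1).norm_image_sub_le_of_norm_fderiv_le (𝕜 := ℝ)
        (fun x _ => Ψ.differentiableAt) (fun x hx => ?_) (by simp) (by simpa [dist_eq_norm] using hpq)
      have hx' : ‖x - p‖ ≤ 1 := by simpa [dist_eq_norm] using hx
      have h1 : 1 + ‖p‖ ≤ 2 * (1 + ‖x‖) := by
        have : ‖p‖ ≤ ‖x‖ + ‖x - p‖ := by
          have := norm_sub_le x (x - p); simpa using this
        have := norm_nonneg x
        linarith
      have h2 : (1 + ‖p‖) ^ (d + 1) ≤ 2 ^ (d + 1) * (1 + ‖x‖) ^ (d + 1) := by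
        rw [← mul_pow]; gcongr
      unfold Jw
      rw [← div_eq_mul_inv, le_div_iff₀ (by positivity)]
      calc ‖fderiv ℝ Ψ x‖ * (1 + ‖p‖) ^ (d + 1)
          ≤ ‖fderiv ℝ Ψ x‖ * (2 ^ (d + 1) * (1 + ‖x‖) ^ (d + 1)) := by gcongr
        _ = 2 ^ (d + 1) * ((1 + ‖x‖) ^ (d + 1) * ‖fderiv ℝ Ψ x‖) := by ring
        _ ≤ _ := by gcongr; exact hA1 x
    refine h.trans ?_
    have := Jw_pos p
    rw [mul_right_comm]
    gcongr
    linarith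

lemma radial_smooth (β : ℝ → ℝ) (hβsm : ContDiff ℝ (⊤ : ℕ∞) β)
    (hβsupp : Function.support β ⊆ Ioo (1/2 : ℝ) 2) :
    ContDiff ℝ (⊤ : ℕ∞) (fun ξ : EuclideanSpace ℝ (Fin d) => ((β ‖ξ‖ : ℝ) : ℂ)) := by
  refine Complex.ofRealCLM.contDiff.comp ?_
  rw [contDiff_iff_contDiffAt]
  intro ξ
  by_cases h : ξ = 0
  · subst h
    have : (fun ξ : EuclideanSpace ℝ (Fin d) => β ‖ξ‖) =ᶠ[nhds 0] fun _ => 0 := by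
      filter_upwards [ball_mem_nhds (0 : EuclideanSpace ℝ (Fin d)) (by norm_num : (0:ℝ) < 1/2)]
        with x hx
      by_contra hne
      have h1 := (hβsupp hne).1
      simp only [mem_ball, dist_zero_right] at hx
      linarith
    exact contDiffAt_const.congr_of_eventuallyEq this
  · exact hβsm.contDiffAt.comp ξ (contDiffAt_norm ℝ h)

lemma radial_compact (β : ℝ → ℝ) (hβsupp : Function.support β ⊆ Ioo (1/2 : ℝ) 2) :
    HasCompactSupport (fun ξ : EuclideanSpace ℝ (Fin d) => ((β ‖ξ‖ : ℝ) : ℂ)) := by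
  refine HasCompactSupport.of_support_subset_isCompact
    (isCompact_closedBall (0 : EuclideanSpace ℝ (Fin d)) 2) ?_
  intro x hx
  have : β ‖x‖ ≠ 0 := by simpa using hx
  have h1 := (hβsupp this).2
  simpa using h1.le

lemma kernel_exists (β : ℝ → ℝ) (hβsm : ContDiff ℝ (⊤ : ℕ∞) β)
    (hβsupp : Function.support β ⊆ Ioo (1/2 : ℝ) 2) :
    ∃ Ψ : SchwartzMap (EuclideanSpace ℝ (Fin d)) ℂ, ∀ s : ℝ, 0 < s → ∀ u,
      ∫ ξ, Complex.exp (2 * (π : ℂ) * Complex.I * ((⟪u, ξ⟫ : ℝ) : ℂ)) * ((β (s * ‖ξ‖) : ℝ) : ℂ)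
        = (((s ^ d)⁻¹ : ℝ) : ℂ) * Ψ (s⁻¹ • u) := by
  set b := (radial_compact (d := d) β hβsupp).toSchwartzMap (radial_smooth β hβsm hβsupp) with hb
  refine ⟨𝓕⁻ b, fun s hs u => ?_⟩
  rw [SchwartzMap.fourierInv_coe, Real.fourierInv_eq']
  have := Measure.integral_comp_smul_of_nonneg (μ := (volume : Measure (EuclideanSpace ℝ (Fin d))))
    (fun ξ : EuclideanSpace ℝ (Fin d) =>
      Complex.exp (2 * (π : ℂ) * Complex.I * ((⟪s⁻¹ • u, ξ⟫ : ℝ) : ℂ)) * ((β (‖ξ‖) : ℝ) : ℂ))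
    s (hR := hs.le)
  rw [finrank_euclideanSpace_fin] at this
  convert this using 1
  · refine integral_congr_ae (Filter.Eventually.of_forall fun ξ => ?_)
    simp only [norm_smul, Real.norm_of_nonneg hs.le, inner_smul_left, inner_smul_right]
    congr 4
    simp
    field_simp
  · rw [Complex.real_smul]
    congr 1
    refine integral_congr_ae (Filter.Eventually.of_forall fun ξ => ?_)
    simp only [smul_eq_mul, real_inner_comm ξ]
    congr 2
    push_cast
    ring

lemma Tj_eq (μ : Measure (EuclideanSpace ℝ (Fin d))) [IsFiniteMeasure μ]
    (β : ℝ → ℝ) (hβsm : ContDiff ℝ (⊤ : ℕ∞) β)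
    (hβsupp : Function.support β ⊆ Ioo (1/2 : ℝ) 2)
    (Ψ : SchwartzMap (EuclideanSpace ℝ (Fin d)) ℂ)
    (hΨ : ∀ s : ℝ, 0 < s → ∀ u,
      ∫ ξ, Complex.exp (2 * (π : ℂ) * Complex.I * ((⟪u, ξ⟫ : ℝ) : ℂ)) * ((β (s * ‖ξ‖) : ℝ) : ℂ)
        = (((s ^ d)⁻¹ : ℝ) : ℂ) * Ψ (s⁻¹ • u))
    (j : ℕ) (t : ℝ) (ht : 0 < t) (f : EuclideanSpace ℝ (Fin d) → ℂ)
    (hf : Integrable f) (x : EuclideanSpace ℝ (Fin d)) (s : ℝ) (hs : s = (2:ℝ) ^ (-(j:ℤ)) * t) :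
    Tj μ β j t f x = ∫ y, (∫ w, f w * ((((s ^ d)⁻¹ : ℝ) : ℂ) * Ψ (s⁻¹ • (x - t • y - w)))) ∂μ := by
  have hs0 : 0 < s := by rw [hs]; positivity
  set F : EuclideanSpace ℝ (Fin d) → (EuclideanSpace ℝ (Fin d) × EuclideanSpace ℝ (Fin d)) → ℂ :=
    fun ξ q => Complex.exp (2 * (π : ℂ) * Complex.I * ((⟪x - t • q.1 - q.2, ξ⟫ : ℝ) : ℂ)) *
      (((β (s * ‖ξ‖) : ℝ) : ℂ) * f q.2) with hF
  have hb : Integrable (fun ξ : EuclideanSpace ℝ (Fin d) => ((β (s * ‖ξ‖) : ℝ) : ℂ)) := by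
    have h0 : Integrable (fun ξ : EuclideanSpace ℝ (Fin d) => ((β (‖ξ‖) : ℝ) : ℂ)) :=
      (radial_smooth β hβsm hβsupp).continuous.integrable_of_hasCompactSupport
        (radial_compact β hβsupp)
    have h1 := h0.comp_smul hs0.ne'
    refine h1.congr (Filter.Eventually.of_forall fun ξ => ?_)
    simp [norm_smul, abs_of_pos hs0]
  have hint : Integrable (Function.uncurry F)
      ((volume : Measure (EuclideanSpace ℝ (Fin d))).prod (μ.prod volume)) := by
    have hf2 : Integrable (fun q : EuclideanSpace ℝ (Fin d) × EuclideanSpace ℝ (Fin d) => f q.2)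
        (μ.prod volume) := hf.comp_snd μ
    have h2 := hb.mul_prod hf2
    refine h2.bdd_mul (c := 1) (Continuous.aestronglyMeasurable ?_)
      (Filter.Eventually.of_forall fun q => ?_)
    · fun_prop
    · rw [show ∀ r : ℝ, 2 * (π : ℂ) * Complex.I * (r : ℂ) = ((2 * π * r : ℝ) : ℂ) * Complex.I by
        intro r; push_cast; ring, Complex.norm_exp_ofReal_mul_I]
  have hL : Tj μ β j t f x = ∫ ξ, ∫ q, F ξ q ∂(μ.prod volume) := by
    unfold Tj
    refine integral_congr_ae (Filter.Eventually.of_forall fun ξ => ?_)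
    simp only
    have e1 : (2:ℝ) ^ (-(j:ℤ)) * ‖t • ξ‖ = s * ‖ξ‖ := by
      rw [norm_smul, Real.norm_of_nonneg ht.le, hs]; ring
    rw [e1, Real.fourier_eq', mFT]
    have e2 : ∀ q, F ξ q =
        (Complex.exp (2 * (π : ℂ) * Complex.I * ((⟪x, ξ⟫ : ℝ) : ℂ)) * ((β (s * ‖ξ‖) : ℝ) : ℂ)) *
        (Complex.exp (-(2 * (π : ℂ) * Complex.I * ((⟪q.1, t • ξ⟫ : ℝ) : ℂ))) *
          (Complex.exp (((-2 * π * ⟪q.2, ξ⟫ : ℝ) : ℂ) * Complex.I) • f q.2)) := by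
      intro q
      have e3 : Complex.exp (2 * (π : ℂ) * Complex.I * ((⟪x - t • q.1 - q.2, ξ⟫ : ℝ) : ℂ)) =
          Complex.exp (2 * (π : ℂ) * Complex.I * ((⟪x, ξ⟫ : ℝ) : ℂ)) *
          Complex.exp (-(2 * (π : ℂ) * Complex.I * ((⟪q.1, t • ξ⟫ : ℝ) : ℂ))) *
          Complex.exp (((-2 * π * ⟪q.2, ξ⟫ : ℝ) : ℂ) * Complex.I) := by
        rw [← Complex.exp_add, ← Complex.exp_add]
        congr 1
        rw [inner_sub_left, inner_sub_left, real_inner_smul_left, real_inner_smul_right]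
        push_cast
        ring
      simp only [hF, smul_eq_mul]
      rw [e3]
      ring
    simp_rw [e2]
    rw [integral_const_mul,
      integral_prod_mul (μ := μ) (ν := volume)
        (fun y => Complex.exp (-(2 * (π : ℂ) * Complex.I * ((⟪y, t • ξ⟫ : ℝ) : ℂ))))
        (fun w => (Complex.exp (((-2 * π * ⟪w, ξ⟫ : ℝ) : ℂ) * Complex.I) • f w))]
    ring
  rw [hL, integral_integral_swap hint]
  have h3 : ∀ q, ∫ ξ, F ξ q = f q.2 * ((((s ^ d)⁻¹ : ℝ) : ℂ) * Ψ (s⁻¹ • (x - t • q.1 - q.2))) := by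
    intro q
    rw [← hΨ s hs0, ← integral_const_mul]
    refine integral_congr_ae (Filter.Eventually.of_forall fun ξ => ?_)
    simp only [hF]
    ring
  have h4 := hint.integral_prod_right
  simp only [Function.uncurry] at h4
  simp_rw [h3] at h4 ⊢
  rw [integral_prod _ h4]

lemma atom_integrable (f : EuclideanSpace ℝ (Fin d) → ℂ) (z : EuclideanSpace ℝ (Fin d)) (r : ℝ)
    (hm : Measurable f) (h0 : ∀ x, x ∉ ball z r → f x = 0) (M : ℝ) (hb : ∀ x, ‖f x‖ ≤ M) :
    Integrable f := by
  have h1 : IntegrableOn f (ball z r) := by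
    refine Measure.integrableOn_of_bounded (M := M) measure_ball_lt_top.ne
      hm.aestronglyMeasurable (Filter.Eventually.of_forall hb)
  refine (integrableOn_iff_integrable_of_support_subset ?_).1 h1
  intro x hx
  by_contra h
  exact hx (h0 x h)

lemma atom_bound (Ψ : SchwartzMap (EuclideanSpace ℝ (Fin d)) ℂ) :
    ∃ A : ℝ, 0 < A ∧ ∀ (f : EuclideanSpace ℝ (Fin d) → ℂ) (z : EuclideanSpace ℝ (Fin d)) (r : ℝ),
      0 < r → Measurable f → (∀ x, x ∉ ball z r → f x = 0) →
      (∀ x, ‖f x‖ ≤ ((volume (ball z r)).toReal)⁻¹) → (∫ x, f x = 0) →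
      ∀ (s : ℝ), 0 < s → ∀ u,
      ‖∫ w, f w * ((((s ^ d)⁻¹ : ℝ) : ℂ) * Ψ (s⁻¹ • (u - w)))‖ ≤
        A * r * ((s + r + ‖u - z‖) ^ (d + 1))⁻¹ := by
  obtain ⟨A, hA, hA1, hA2⟩ := schwartz_bounds Ψ
  set c := ∫ v, Jw (d := d) v with hc
  have hc0 : 0 ≤ c := integral_nonneg fun v => (Jw_pos v).le
  set vd := (volume (ball (0 : EuclideanSpace ℝ (Fin d)) 1)).toReal with hvd
  have hvd0 : 0 < vd := ENNReal.toReal_pos (measure_ball_pos _ _ one_pos).ne' measure_ball_lt_top.ne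
  refine ⟨vd⁻¹ * A * 3 ^ (d + 1) * c + A * 2 ^ (d + 1), by positivity, ?_⟩
  intro f z r hr hm h0 hb hz s hs u
  have hV : (volume (ball z r)).toReal = r ^ d * vd := by
    rw [Measure.addHaar_ball_of_pos _ _ hr, ENNReal.toReal_mul, ENNReal.toReal_ofReal (by positivity)]
    simp [hvd]
  set D := s + r + ‖u - z‖ with hD
  have hD0 : 0 < D := by positivity
  rcases le_total s r with hsr | hsr
  · have h1 : ‖∫ w, f w * ((((s ^ d)⁻¹ : ℝ) : ℂ) * Ψ (s⁻¹ • (u - w)))‖ ≤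
        ∫ w, ((r ^ d * vd)⁻¹ * (s ^ d)⁻¹ * A * (3 ^ (d + 1) * r ^ (d + 1) * (D ^ (d + 1))⁻¹)) *
          Jw (s⁻¹ • (u - w)) := by
      refine norm_integral_le_of_norm_le ((Jw_scale_int s hs u).const_mul _)
        (Filter.Eventually.of_forall fun w => ?_)
      have hJ := Jw_pos (s⁻¹ • (u - w))
      by_cases hw : w ∈ ball z r
      · have hw' : ‖w - z‖ ≤ r := by
          rw [← dist_eq_norm]; exact (mem_ball.1 hw).le
        have e1 : Jw (s⁻¹ • (u - w)) ≤ 3 ^ (d + 1) * r ^ (d + 1) * (D ^ (d + 1))⁻¹ := by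
          unfold Jw
          rw [← mul_pow, ← inv_pow, ← inv_pow, ← mul_pow]
          gcongr
          rw [← div_eq_mul_inv, inv_le_comm₀ (by positivity) (by positivity), inv_div,
            div_le_iff₀ (by positivity), norm_smul, norm_inv, Real.norm_of_nonneg hs.le]
          have e2 : ‖u - w‖ ≤ s⁻¹ * ‖u - w‖ * r := by
            rw [mul_right_comm]
            refine le_mul_of_one_le_left (norm_nonneg _) ?_
            rw [inv_mul_eq_div, le_div_iff₀ hs]; linarith
          have e3 : ‖u - z‖ ≤ ‖u - w‖ + ‖w - z‖ := by
            have := norm_add_le (u - w) (w - z); simpa using this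
          have e4 := norm_nonneg (u - w)
          rw [hD]
          nlinarith
        rw [norm_mul, norm_mul, Complex.norm_real, Real.norm_of_nonneg (by positivity)]
        calc ‖f w‖ * ((s ^ d)⁻¹ * ‖Ψ (s⁻¹ • (u - w))‖)
            ≤ (r ^ d * vd)⁻¹ * ((s ^ d)⁻¹ * (A * (Jw (s⁻¹ • (u - w)) * Jw (s⁻¹ • (u - w))))) := by
              gcongr
              · exact hV ▸ hb w
              · exact hA1 _
          _ ≤ (r ^ d * vd)⁻¹ * ((s ^ d)⁻¹ * (A *
                ((3 ^ (d + 1) * r ^ (d + 1) * (D ^ (d + 1))⁻¹) * Jw (s⁻¹ • (u - w))))) := by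
              gcongr
          _ = _ := by ring
      · rw [h0 w hw]
        simp only [zero_mul, norm_zero]
        positivity
    rw [integral_const_mul, Jw_scale s hs] at h1
    refine h1.trans ?_
    have e : (r ^ d * vd)⁻¹ * (s ^ d)⁻¹ * A * (3 ^ (d + 1) * r ^ (d + 1) * (D ^ (d + 1))⁻¹) *
        (s ^ d * c) = (vd⁻¹ * A * 3 ^ (d + 1) * c) * r * (D ^ (d + 1))⁻¹ := by
      field_simp
      ring
    rw [e]
    gcongr
    have : 0 ≤ A * 2 ^ (d + 1) := by positivity
    linarith
  · have hfi := atom_integrable f z r hm h0 _ hb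
    have h1 : ∫ w, f w * ((((s ^ d)⁻¹ : ℝ) : ℂ) * Ψ (s⁻¹ • (u - w))) =
        ∫ w, f w * ((((s ^ d)⁻¹ : ℝ) : ℂ) * (Ψ (s⁻¹ • (u - w)) - Ψ (s⁻¹ • (u - z)))) := by
      have e : ∀ w, f w * ((((s ^ d)⁻¹ : ℝ) : ℂ) * (Ψ (s⁻¹ • (u - w)) - Ψ (s⁻¹ • (u - z)))) =
          f w * ((((s ^ d)⁻¹ : ℝ) : ℂ) * Ψ (s⁻¹ • (u - w))) -
          f w * ((((s ^ d)⁻¹ : ℝ) : ℂ) * Ψ (s⁻¹ • (u - z))) := fun w => by ring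
      simp_rw [e]
      rw [integral_sub, integral_mul_const, hz, zero_mul, sub_zero]
      · refine hfi.mul_bdd (c := (s ^ d)⁻¹ * A) (Continuous.aestronglyMeasurable ?_)
          (Filter.Eventually.of_forall fun w => ?_)
        · have := Ψ.continuous
          fun_prop
        · rw [norm_mul, Complex.norm_real, Real.norm_of_nonneg (by positivity)]
          gcongr
          refine (hA1 _).trans ?_
          have h2 : Jw (s⁻¹ • (u - w)) ≤ 1 := by
            unfold Jw
            refine inv_le_one_of_one_le₀ (one_le_pow₀ ?_)
            have := norm_nonneg (s⁻¹ • (u - w))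
            linarith
          have h3 := Jw_pos (s⁻¹ • (u - w))
          have h4 : Jw (s⁻¹ • (u - w)) * Jw (s⁻¹ • (u - w)) ≤ 1 := mul_le_one₀ h2 h3.le h2
          nlinarith
      · exact hfi.mul_const _
    rw [h1, ← setIntegral_eq_integral_of_forall_compl_eq_zero (s := ball z r)
      (fun w hw => by rw [h0 w hw, zero_mul])]
    have hJz : Jw (s⁻¹ • (u - z)) ≤ 2 ^ (d + 1) * s ^ (d + 1) * (D ^ (d + 1))⁻¹ := by
      unfold Jw
      rw [← mul_pow, ← inv_pow, ← inv_pow, ← mul_pow]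
      gcongr
      rw [← div_eq_mul_inv, inv_le_comm₀ (by positivity) (by positivity), inv_div,
        div_le_iff₀ (by positivity), norm_smul, norm_inv, Real.norm_of_nonneg hs.le]
      have e2 : s⁻¹ * ‖u - z‖ * s = ‖u - z‖ := by field_simp
      have e4 := norm_nonneg (u - z)
      rw [hD]
      nlinarith
    have h2 := norm_setIntegral_le_of_norm_le_const (μ := volume) (s := ball z r)
      (f := fun w => f w * ((((s ^ d)⁻¹ : ℝ) : ℂ) * (Ψ (s⁻¹ • (u - w)) - Ψ (s⁻¹ • (u - z)))))
      (C := (r ^ d * vd)⁻¹ * ((s ^ d)⁻¹ * (A * (s⁻¹ * r) *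
        (2 ^ (d + 1) * s ^ (d + 1) * (D ^ (d + 1))⁻¹))))
      measure_ball_lt_top (fun w hw => by
        have hw' : ‖z - w‖ ≤ r := by
          rw [← dist_eq_norm, dist_comm]; exact (mem_ball.1 hw).le
        have e1 : s⁻¹ • (u - w) - s⁻¹ • (u - z) = s⁻¹ • (z - w) := by
          rw [← smul_sub]; congr 1; abel
        have e2 : ‖s⁻¹ • (u - w) - s⁻¹ • (u - z)‖ ≤ s⁻¹ * r := by
          rw [e1, norm_smul, norm_inv, Real.norm_of_nonneg hs.le]
          gcongr
        have e3 : s⁻¹ * r ≤ 1 := by rw [inv_mul_eq_div, div_le_one hs]; exact hsr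
        rw [norm_mul, norm_mul, Complex.norm_real, Real.norm_of_nonneg (by positivity)]
        gcongr
        · exact hV ▸ hb w
        · refine (hA2 _ _ (e2.trans e3)).trans ?_
          have := Jw_pos (s⁻¹ • (u - z))
          gcongr)
    refine h2.trans ?_
    rw [measureReal_def, hV]
    have e : (r ^ d * vd)⁻¹ * ((s ^ d)⁻¹ * (A * (s⁻¹ * r) *
        (2 ^ (d + 1) * s ^ (d + 1) * (D ^ (d + 1))⁻¹))) * (r ^ d * vd) =
        (A * 2 ^ (d + 1)) * r * (D ^ (d + 1))⁻¹ := by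
      field_simp
      try ring
    rw [e]
    gcongr
    have : 0 ≤ vd⁻¹ * A * 3 ^ (d + 1) * c := by positivity
    linarith

lemma sup_le_int (k r t : ℝ) (hk : 0 < k) (hk1 : k ≤ 1) (hr : 0 < r) (ht : 0 < t)
    (x y z : EuclideanSpace ℝ (Fin d)) (hy : ‖y‖ ≤ 1) :
    ENNReal.ofReal (((k * t + r + ‖x - t • y - z‖) ^ (d + 1))⁻¹) ≤
      ∫⁻ τ in Ioi (0:ℝ), ENNReal.ofReal (2 * 3 ^ (d + 1) * (k * τ + r)⁻¹) *
        ENNReal.ofReal (((k * τ + r + ‖(z + τ • y) - x‖) ^ (d + 1))⁻¹) := by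
  set σ := k * t + r with hσ
  have hσ0 : 0 < σ := by positivity
  set h := ((σ + ‖x - t • y - z‖) ^ (d + 1))⁻¹ with hh
  calc ENNReal.ofReal h = ENNReal.ofReal (σ⁻¹ * h) * volume (Ioc t (t + σ)) := by
        rw [Real.volume_Ioc, ← ENNReal.ofReal_mul (by positivity)]
        congr 1
        field_simp
        ring
    _ = ∫⁻ τ in Ioc t (t + σ), ENNReal.ofReal (σ⁻¹ * h) := by rw [setLIntegral_const]
    _ ≤ ∫⁻ τ in Ioc t (t + σ), ENNReal.ofReal (2 * 3 ^ (d + 1) * (k * τ + r)⁻¹) *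
        ENNReal.ofReal (((k * τ + r + ‖(z + τ • y) - x‖) ^ (d + 1))⁻¹) := by
        refine setLIntegral_mono' measurableSet_Ioc fun τ hτ => ?_
        obtain ⟨h1, h2⟩ := hτ
        have hτ0 : 0 < τ := ht.trans h1
        rw [← ENNReal.ofReal_mul (by positivity)]
        refine ENNReal.ofReal_le_ofReal ?_
        have e1 : k * τ + r ≤ 2 * σ := by
          have : k * τ ≤ k * (t + σ) := by gcongr
          nlinarith
        have e2 : ‖(z + τ • y) - x‖ ≤ ‖x - t • y - z‖ + σ := by
          have q1 : (z + τ • y) - x = -(x - t • y - z) + (τ - t) • y := by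
            rw [sub_smul]; abel
          rw [q1]
          refine (norm_add_le _ _).trans ?_
          rw [norm_neg, norm_smul, Real.norm_of_nonneg (by linarith)]
          have : (τ - t) * ‖y‖ ≤ σ * 1 := by gcongr; linarith
          linarith
        have e3 : k * τ + r + ‖(z + τ • y) - x‖ ≤ 3 * (σ + ‖x - t • y - z‖) := by
          have := norm_nonneg (x - t • y - z)
          linarith
        have e4 : σ⁻¹ ≤ 2 * (k * τ + r)⁻¹ := by
          rw [← div_eq_mul_inv, le_div_iff₀ (by positivity), inv_mul_eq_div,
            div_le_iff₀ hσ0]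
          exact e1
        have e5 : h ≤ 3 ^ (d + 1) * ((k * τ + r + ‖(z + τ • y) - x‖) ^ (d + 1))⁻¹ := by
          rw [hh, ← div_eq_mul_inv, le_div_iff₀ (by positivity), inv_mul_eq_div,
            div_le_iff₀ (by positivity), ← mul_pow]
          gcongr
        calc σ⁻¹ * h ≤ (2 * (k * τ + r)⁻¹) *
            (3 ^ (d + 1) * ((k * τ + r + ‖(z + τ • y) - x‖) ^ (d + 1))⁻¹) := by
              gcongr
          _ = _ := by ring
    _ ≤ _ := by
        refine lintegral_mono_set fun τ hτ => ?_
        exact ht.trans hτ.1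

lemma triple_int (μ : Measure (EuclideanSpace ℝ (Fin d))) [IsFiniteMeasure μ]
    (k r : ℝ) (hk : 0 < k) (hr : 0 < r) (z : EuclideanSpace ℝ (Fin d)) :
    ∫⁻ x, (∫⁻ y, (∫⁻ τ in Ioi (0:ℝ), ENNReal.ofReal (2 * 3 ^ (d + 1) * (k * τ + r)⁻¹) *
        ENNReal.ofReal (((k * τ + r + ‖(z + τ • y) - x‖) ^ (d + 1))⁻¹)) ∂μ) =
    ENNReal.ofReal (2 * 3 ^ (d + 1) * (∫ v, Jw (d := d) v) * (k⁻¹ * r⁻¹) * μ.real univ) := by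
  have hc0 : 0 ≤ ∫ v, Jw (d := d) v := integral_nonneg fun v => (Jw_pos v).le
  rw [lintegral_lintegral_swap]
  · have hy : ∀ y : EuclideanSpace ℝ (Fin d), (∫⁻ x, ∫⁻ τ in Ioi (0:ℝ),
        ENNReal.ofReal (2 * 3 ^ (d + 1) * (k * τ + r)⁻¹) *
        ENNReal.ofReal (((k * τ + r + ‖(z + τ • y) - x‖) ^ (d + 1))⁻¹)) =
        ENNReal.ofReal (2 * 3 ^ (d + 1) * (∫ v, Jw (d := d) v) * (k⁻¹ * r⁻¹)) := by
      intro y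
      rw [lintegral_lintegral_swap]
      · rw [ENNReal.ofReal_mul (by positivity), ← t_lint k r hk hr, ← lintegral_const_mul _
          (by fun_prop)]
        refine setLIntegral_congr_fun measurableSet_Ioi fun τ hτ => ?_
        have hτ : 0 < τ := hτ
        rw [lintegral_const_mul _ (by fun_prop), Jw_lint _ (by positivity),
          ← ENNReal.ofReal_mul (by positivity), ← ENNReal.ofReal_mul (by positivity)]
        congr 1
        field_simp
      · refine Measurable.aemeasurable ?_
        unfold Function.uncurry
        fun_prop
    simp_rw [hy]
    rw [lintegral_const, ENNReal.ofReal_mul (q := μ.real univ) (by positivity), ofReal_measureReal]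
  · refine Measurable.aemeasurable ?_
    unfold Function.uncurry
    refine Measurable.lintegral_prod_right' (f := fun p : (EuclideanSpace ℝ (Fin d) ×
      EuclideanSpace ℝ (Fin d)) × ℝ => ENNReal.ofReal (2 * 3 ^ (d + 1) * (k * p.2 + r)⁻¹) *
        ENNReal.ofReal (((k * p.2 + r + ‖(z + p.2 • p.1.2) - p.1.1‖) ^ (d + 1))⁻¹)) ?_
    fun_prop

/-- Atom estimate: for μ supported in B(2⁻¹e₁, 2⁻²) with |μ̂(ξ)| ≤ C|ξ|^{−a}, a > 1/2,
and any H¹-atom 𝔞, one has ‖T_j^* 𝔞‖_{L¹} ≤ C' 2^j with C' independent of j and 𝔞. -/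
theorem stmt6 (d : ℕ) (hd : 0 < d) (μ : Measure (EuclideanSpace ℝ (Fin d)))
    [IsFiniteMeasure μ]
    (hsupp : μ (ball ((2:ℝ)⁻¹ • EuclideanSpace.single (⟨0, hd⟩ : Fin d) (1:ℝ)) (4:ℝ)⁻¹)ᶜ = 0)
    (a C : ℝ) (ha : 1/2 < a)
    (hdecay : ∀ ξ : EuclideanSpace ℝ (Fin d), ξ ≠ 0 → ‖mFT μ ξ‖ ≤ C * ‖ξ‖ ^ (-a))
    (β : ℝ → ℝ) (hβsm : ContDiff ℝ (⊤ : ℕ∞) β)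
    (hβsupp : Function.support β ⊆ Ioo (1/2 : ℝ) 2)
    (hβsum : ∀ t : ℝ, 0 < t → HasSum (fun j : ℤ => β ((2:ℝ) ^ j * t)) 1) :
    ∃ C' : ℝ, 0 < C' ∧ ∀ j : ℕ, 1 ≤ j →
      ∀ (𝔞 : EuclideanSpace ℝ (Fin d) → ℂ) (z : EuclideanSpace ℝ (Fin d)) (r : ℝ), 0 < r →
        Measurable 𝔞 →
        (∀ x, x ∉ ball z r → 𝔞 x = 0) →
        (∀ x, ‖𝔞 x‖ ≤ ((volume (ball z r)).toReal)⁻¹) →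
        (∫ x, 𝔞 x = 0) →
        (∫⁻ x, TjStar μ β j 𝔞 x) ≤ ENNReal.ofReal (C' * 2 ^ (j:ℝ)) := by
  obtain ⟨Ψ, hΨ⟩ := kernel_exists (d := d) β hβsm hβsupp
  obtain ⟨A, hA, hAb⟩ := atom_bound Ψ
  set c := ∫ v, Jw (d := d) v with hc
  have hc0 : 0 ≤ c := integral_nonneg fun v => (Jw_pos v).le
  have hy : ∀ᵐ y ∂μ, ‖y‖ ≤ 1 := by
    rw [ae_iff]
    refine measure_mono_null (fun y hy => ?_) hsupp
    simp only [mem_setOf_eq, not_le] at hy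
    simp only [mem_compl_iff, mem_ball, not_lt, dist_eq_norm]
    have h1 := norm_sub_norm_le y ((2:ℝ)⁻¹ • EuclideanSpace.single (⟨0, hd⟩ : Fin d) (1:ℝ))
    have h2 : ‖(2:ℝ)⁻¹ • EuclideanSpace.single (⟨0, hd⟩ : Fin d) (1:ℝ)‖ = 2⁻¹ := by
      rw [norm_smul]; simp
    rw [h2] at h1
    refine le_trans ?_ h1
    linarith
  refine ⟨A * (2 * 3 ^ (d + 1)) * c * μ.real univ + 1, by positivity, ?_⟩
  intro j hj f z r hr hm h0 hb hz
  set k : ℝ := (2:ℝ) ^ (-(j:ℤ)) with hk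
  have hk0 : 0 < k := by positivity
  have hkj : k = ((2:ℝ) ^ j)⁻¹ := by rw [hk, zpow_neg, zpow_natCast]
  have hk1 : k ≤ 1 := by
    rw [hkj]; exact inv_le_one_of_one_le₀ (one_le_pow₀ (by norm_num))
  have hfi := atom_integrable f z r hm h0 _ hb
  have hsup : ∀ x, TjStar μ β j f x ≤ ENNReal.ofReal (A * r) *
      ∫⁻ y, (∫⁻ τ in Ioi (0:ℝ), ENNReal.ofReal (2 * 3 ^ (d + 1) * (k * τ + r)⁻¹) *
        ENNReal.ofReal (((k * τ + r + ‖(z + τ • y) - x‖) ^ (d + 1))⁻¹)) ∂μ := by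
    intro x
    refine iSup_le fun ⟨t, ht⟩ => ?_
    rw [← lintegral_const_mul' _ _ ENNReal.ofReal_ne_top]
    simp only
    rw [Tj_eq μ β hβsm hβsupp Ψ hΨ j t ht f hfi x (k * t) rfl]
    refine (enorm_integral_le_lintegral_enorm _).trans (lintegral_mono_ae ?_)
    filter_upwards [hy] with y hy1
    have h1 := hAb f z r hr hm h0 hb hz (k * t) (by positivity) (x - t • y)
    rw [← ofReal_norm_eq_enorm]
    refine (ENNReal.ofReal_le_ofReal h1).trans ?_
    rw [ENNReal.ofReal_mul (by positivity)]
    gcongr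
    exact sup_le_int k r t hk0 hk1 hr ht x y z hy1
  refine (lintegral_mono hsup).trans ?_
  rw [lintegral_const_mul' _ _ ENNReal.ofReal_ne_top, triple_int μ k r hk0 hr z,
    ← ENNReal.ofReal_mul (by positivity)]
  refine ENNReal.ofReal_le_ofReal ?_
  rw [hkj, inv_inv, Real.rpow_natCast, ← hc]
  have e : A * r * (2 * 3 ^ (d + 1) * c * (2 ^ j * r⁻¹) * μ.real univ) =
      (A * (2 * 3 ^ (d + 1)) * c * μ.real univ) * 2 ^ j := by
    field_simp
  rw [e]
  gcongr
  linarith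
end
end
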